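/- For ρ > 2, 1 < p₁, p₂ < ∞ and 1/p = 1/p₁ + 1/p₂, there is a constant C such that ‖V_ρ(Q(φ,ψ))‖_{ℓ^p(ℤ)} ≤ C ‖φ‖_{ℓ^{p₁}(ℤ)} ‖ψ‖_{ℓ^{p₂}(ℤ)} for all finitely supported φ, ψ : ℤ → ℝ. -/

import Mathlib

open MeasureTheory Set ENNReal NNReal

/-- The ρ-variation norm of a family `a : ι → E` sampled along finite increasing
systems of indices lying in `S`. -/
noncomputable def varNorm {ι E : Type*} [Preorder ι] [SeminormedAddGroup E]
    (ρ : ℝ) (S : Set ι) (a : ι → E) : ℝ≥0∞ :=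
  ⨆ (n : ℕ) (t : Fin (n + 1) → ι) (_ : StrictMono t) (_ : ∀ i, t i ∈ S),
    (∑ i : Fin n, (‖a (t i.succ) - a (t i.castSucc)‖₊ : ℝ≥0∞) ^ ρ) ^ (1 / ρ)

/-- Discrete bilinear averages
`Q_L(φ,ψ)(i) = (2L+1)⁻² Σ_{|l|,|k|≤L} φ(i-l) ψ(i-k)`. -/
noncomputable def Qdisc (φ ψ : ℤ → ℝ) (L : ℕ) (i : ℤ) : ℝ :=
  ((2 * (L : ℝ) + 1) ^ 2)⁻¹ *
    ∑ l ∈ Finset.Icc (-(L : ℤ)) (L : ℤ), ∑ k ∈ Finset.Icc (-(L : ℤ)) (L : ℤ),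
      φ (i - l) * ψ (i - k)


/-! ### Variation seminorms of sequences -/

theorem varNorm_le_ofReal {ρ : ℝ} (hρ : 0 < ρ) (S : Set ℕ) (a : ℕ → ℝ) (X : ℝ)
    (h : ∀ (n : ℕ) (t : ℕ → ℕ), Monotone t → (∀ i, t i ∈ S) →
      (∑ i ∈ Finset.range n, |a (t (i + 1)) - a (t i)| ^ ρ) ^ (1 / ρ) ≤ X) :
    varNorm ρ S a ≤ ENNReal.ofReal X := by
  unfold varNorm
  refine iSup_le fun n => iSup_le fun t => iSup_le fun ht => iSup_le fun hS => ?_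
  have key := h n (fun i => t ⟨min i n, by omega⟩)
    (fun i j hij => ht.monotone (by simp only [Fin.mk_le_mk]; omega)) (fun i => hS _)
  refine le_trans (le_of_eq ?_) (ENNReal.ofReal_le_ofReal key)
  rw [← ENNReal.ofReal_rpow_of_nonneg (Finset.sum_nonneg fun _ _ => by positivity) (by positivity),
    ENNReal.ofReal_sum_of_nonneg (fun _ _ => by positivity), Finset.sum_range]
  congr 1
  refine Finset.sum_congr rfl fun i _ => ?_
  rw [← ENNReal.ofReal_rpow_of_nonneg (abs_nonneg _) hρ.le, ← Real.enorm_eq_ofReal_abs]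
  have h1 : (⟨min (i + 1) n, by omega⟩ : Fin (n + 1)) = i.succ := by
    ext; simp
  have h2 : (⟨min (i : ℕ) n, by omega⟩ : Fin (n + 1)) = i.castSucc := by
    ext; simp
  rw [h1, h2]
  rfl

theorem enorm_sub_le_varNorm {ρ : ℝ} (hρ : 0 < ρ) {S : Set ℕ} (a : ℕ → ℝ) {m n : ℕ}
    (hm : m ∈ S) (hn : n ∈ S) : ‖a m - a n‖ₑ ≤ varNorm ρ S a := by
  wlog hmn : n ≤ m generalizing m n
  · rw [← neg_sub, enorm_neg]
    exact this hn hm (by omega)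
  rcases hmn.eq_or_lt with rfl | hlt
  · simp
  have ht : StrictMono ![n, m] := by
    intro i j hij
    fin_cases i <;> fin_cases j <;> simp_all
  have hS : ∀ i, ![n, m] i ∈ S := by
    intro i
    fin_cases i <;> simp_all
  unfold varNorm
  refine le_trans ?_ (le_iSup_of_le 1 (le_iSup_of_le ![n, m]
    (le_iSup_of_le ht (le_iSup_of_le hS le_rfl))))
  simp only [Finset.univ_unique, Finset.sum_singleton]
  rw [← ENNReal.rpow_mul, mul_one_div_cancel hρ.ne', ENNReal.rpow_one]
  rfl

/-- If the increments of `c` are controlled by those of `a` and `b`, so is its variation. -/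
theorem varNorm_le_of_enorm_sub_le {ρ : ℝ} (hρ : 1 ≤ ρ) {S : Set ℕ} {a b c : ℕ → ℝ} {A B : ℝ≥0∞}
    (h : ∀ m ∈ S, ∀ n ∈ S, ‖c m - c n‖ₑ ≤ A * ‖a m - a n‖ₑ + B * ‖b m - b n‖ₑ) :
    varNorm ρ S c ≤ A * varNorm ρ S a + B * varNorm ρ S b := by
  have hρ0 : 0 < ρ := by linarith
  conv_lhs => unfold varNorm
  refine iSup_le fun n => iSup_le fun t => iSup_le fun ht => iSup_le fun hS => ?_
  have scale : ∀ (A : ℝ≥0∞) (a : ℕ → ℝ),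
      (∑ i : Fin n, (A * ‖a (t i.succ) - a (t i.castSucc)‖ₑ) ^ ρ) ^ (1 / ρ)
        ≤ A * varNorm ρ S a := by
    intro A a
    simp_rw [ENNReal.mul_rpow_of_nonneg _ _ hρ0.le]
    rw [← Finset.mul_sum, ENNReal.mul_rpow_of_nonneg _ _ (by positivity), ← ENNReal.rpow_mul,
      mul_one_div_cancel hρ0.ne', ENNReal.rpow_one]
    gcongr
    unfold varNorm
    exact le_iSup_of_le n (le_iSup_of_le t (le_iSup_of_le ht (le_iSup_of_le hS le_rfl)))
  calc _ ≤ (∑ i : Fin n, (A * ‖a (t i.succ) - a (t i.castSucc)‖ₑ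
            + B * ‖b (t i.succ) - b (t i.castSucc)‖ₑ) ^ ρ) ^ (1 / ρ) := by
        gcongr with i _
        exact h _ (hS _) _ (hS _)
    _ ≤ _ := ENNReal.Lp_add_le _ _ _ hρ
    _ ≤ _ := add_le_add (scale A a) (scale B b)

theorem varNorm_mono_set {ρ : ℝ} {S S' : Set ℕ} (h : S ⊆ S') (a : ℕ → ℝ) :
    varNorm ρ S a ≤ varNorm ρ S' a := by
  unfold varNorm
  refine iSup_le fun n => iSup_le fun t => iSup_le fun ht => iSup_le fun hS => ?_
  exact le_iSup_of_le n (le_iSup_of_le t (le_iSup_of_le ht (le_iSup_of_le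
    (fun i => h (hS i)) le_rfl)))

theorem varNorm_univ_eq_iSup (ρ : ℝ) (a : ℕ → ℝ) :
    varNorm ρ Set.univ a = ⨆ N : ℕ, varNorm ρ (Set.Iic N) a := by
  refine le_antisymm ?_ (iSup_le fun N => varNorm_mono_set (Set.subset_univ _) a)
  conv_lhs => unfold varNorm
  refine iSup_le fun n => iSup_le fun t => iSup_le fun ht => iSup_le fun _ => ?_
  refine le_iSup_of_le (t (Fin.last n)) ?_
  unfold varNorm
  exact le_iSup_of_le n (le_iSup_of_le t (le_iSup_of_le ht (le_iSup_of_le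
    (fun i => ht.monotone (Fin.le_last i)) le_rfl)))

theorem sum_rpow_le_rpow_sum {ι : Type*} (s : Finset ι) {r : ℝ} (hr : 1 ≤ r) (x : ι → ℝ)
    (hx : ∀ i, 0 ≤ x i) : ∑ i ∈ s, x i ^ r ≤ (∑ i ∈ s, x i) ^ r := by
  classical
  induction s using Finset.induction_on with
  | empty => simp [Real.zero_rpow (by linarith : r ≠ 0)]
  | insert i s hi ih =>
    rw [Finset.sum_insert hi, Finset.sum_insert hi]
    refine le_trans (add_le_add_right ih _) ?_
    exact Real.add_rpow_le_rpow_add (hx i) (Finset.sum_nonneg fun _ _ => hx _) hr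

/-- The signed square `u ↦ u |u|`. -/
def signedSq (u : ℝ) : ℝ := u * |u|

theorem sq_sub_le_signedSq (u v : ℝ) : (u - v) ^ 2 ≤ 2 * |signedSq u - signedSq v| := by
  unfold signedSq
  rcases abs_cases u with ⟨hu, hu'⟩ | ⟨hu, hu'⟩ <;> rcases abs_cases v with ⟨hv, hv'⟩ | ⟨hv, hv'⟩ <;>
    rw [hu, hv]
  · rcases le_total u v with h | h
    · have := neg_le_abs (u * u - v * v); nlinarith
    · have := le_abs_self (u * u - v * v); nlinarith
  · have := le_abs_self (u * u - v * -v); nlinarith [sq_nonneg (u + v)]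
  · have := neg_le_abs (u * -u - v * v); nlinarith [sq_nonneg (u + v)]
  · rcases le_total u v with h | h
    · have := neg_le_abs (u * -u - v * -v); nlinarith
    · have := le_abs_self (u * -u - v * -v); nlinarith

theorem abs_signedSq_sub_le (u v : ℝ) :
    |signedSq u - signedSq v| ≤ |u - v| * (|u| + |v|) := by
  have h : signedSq u - signedSq v = (u - v) * |u| + v * (|u| - |v|) := by
    unfold signedSq; ring
  rw [h]
  refine (abs_add_le _ _).trans ?_
  rw [abs_mul, abs_mul, abs_abs]
  have := abs_abs_sub_abs_le_abs_sub u v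
  nlinarith [abs_nonneg v]

theorem sum_abs_sub_le_of_monotone (u : ℕ → ℝ) (t : ℕ → ℕ) (ht : Monotone t) (n : ℕ) :
    ∑ i ∈ Finset.range n, |u (t (i + 1)) - u (t i)|
      ≤ ∑ k ∈ Finset.Ico (t 0) (t n), |u (k + 1) - u k| := by
  induction n with
  | zero => simp
  | succ n ih =>
    rw [Finset.sum_range_succ, ← Finset.sum_Ico_consecutive _ (ht (Nat.zero_le n)) (ht n.le_succ)]
    gcongr
    rw [← Finset.sum_Ico_sub u (ht n.le_succ)]
    exact Finset.abs_sum_le_sum_abs _ _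

theorem chain_rpow_le_sq {ρ : ℝ} (hρ : 2 ≤ ρ) {N : ℕ} (a : ℕ → ℝ) (n : ℕ) (t : ℕ → ℕ)
    (ht : Monotone t) (hN : ∀ i, t i ≤ N) :
    ∑ i ∈ Finset.range n, |a (t (i + 1)) - a (t i)| ^ ρ
      ≤ (2 * ∑ L ∈ Finset.range N, |signedSq (a (L + 1)) - signedSq (a L)|) ^ (ρ / 2) := by
  have h1 : ∑ i ∈ Finset.range n, |a (t (i + 1)) - a (t i)| ^ ρ
      = ∑ i ∈ Finset.range n, ((a (t (i + 1)) - a (t i)) ^ 2) ^ (ρ / 2) := by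
    refine Finset.sum_congr rfl fun i _ => ?_
    rw [← sq_abs, ← Real.rpow_natCast, ← Real.rpow_mul (abs_nonneg _)]
    congr 1
    push_cast
    ring
  rw [h1]
  refine (sum_rpow_le_rpow_sum _ (by linarith) _ fun _ => sq_nonneg _).trans ?_
  refine Real.rpow_le_rpow (Finset.sum_nonneg fun _ _ => sq_nonneg _) ?_ (by linarith)
  calc ∑ i ∈ Finset.range n, (a (t (i + 1)) - a (t i)) ^ 2
      ≤ ∑ i ∈ Finset.range n, 2 * |signedSq (a (t (i + 1))) - signedSq (a (t i))| :=
        Finset.sum_le_sum fun i _ => sq_sub_le_signedSq _ _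
    _ ≤ 2 * ∑ k ∈ Finset.Ico (t 0) (t n), |signedSq (a (k + 1)) - signedSq (a k)| := by
        rw [← Finset.mul_sum]
        gcongr
        exact sum_abs_sub_le_of_monotone (fun k => signedSq (a k)) t ht n
    _ ≤ _ := by
        gcongr
        intro k hk
        simp only [Finset.mem_Ico, Finset.mem_range] at *
        exact hk.2.trans_le (hN n)

/-- The `ρ`-variation of a real sequence over the indices `0, …, N`. -/
noncomputable def truncVar (ρ : ℝ) (N : ℕ) (a : ℕ → ℝ) : ℝ :=
  (varNorm ρ (Set.Iic N) a).toReal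

theorem truncVar_nonneg (ρ : ℝ) (N : ℕ) (a : ℕ → ℝ) : 0 ≤ truncVar ρ N a :=
  ENNReal.toReal_nonneg

theorem truncVar_le {ρ : ℝ} (hρ : 0 < ρ) {N : ℕ} {a : ℕ → ℝ} {X : ℝ}
    (h : ∀ (n : ℕ) (t : ℕ → ℕ), Monotone t → (∀ i, t i ≤ N) →
      (∑ i ∈ Finset.range n, |a (t (i + 1)) - a (t i)| ^ ρ) ^ (1 / ρ) ≤ X) :
    truncVar ρ N a ≤ X := by
  have hX : 0 ≤ X := by
    have := h 0 (fun _ => 0) monotone_const (fun _ => Nat.zero_le _)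
    exact le_trans (by positivity) this
  exact ENNReal.toReal_le_of_le_ofReal hX (varNorm_le_ofReal hρ _ _ _ h)

theorem chain_rpow_root_le {ρ : ℝ} (hρ : 2 ≤ ρ) {N : ℕ} (a : ℕ → ℝ) (n : ℕ) (t : ℕ → ℕ)
    (ht : Monotone t) (hN : ∀ i, t i ≤ N) :
    (∑ i ∈ Finset.range n, |a (t (i + 1)) - a (t i)| ^ ρ) ^ (1 / ρ)
      ≤ √(2 * ∑ L ∈ Finset.range N, |signedSq (a (L + 1)) - signedSq (a L)|) := by
  rw [Real.sqrt_eq_rpow]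
  refine (Real.rpow_le_rpow (Finset.sum_nonneg fun _ _ => by positivity)
    (chain_rpow_le_sq hρ a n t ht hN) (by positivity)).trans_eq ?_
  rw [← Real.rpow_mul (by positivity)]
  congr 1
  field_simp

theorem varNorm_Iic_ne_top {ρ : ℝ} (hρ : 2 ≤ ρ) (N : ℕ) (a : ℕ → ℝ) :
    varNorm ρ (Set.Iic N) a ≠ ⊤ := by
  refine ne_top_of_le_ne_top ENNReal.ofReal_ne_top
    (varNorm_le_ofReal (by linarith) (Set.Iic N) a _ fun n t ht hN =>
      chain_rpow_root_le hρ a n t ht hN)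

theorem ofReal_truncVar {ρ : ℝ} (hρ : 2 ≤ ρ) (N : ℕ) (a : ℕ → ℝ) :
    ENNReal.ofReal (truncVar ρ N a) = varNorm ρ (Set.Iic N) a :=
  ENNReal.ofReal_toReal (varNorm_Iic_ne_top hρ N a)

theorem truncVar_sq_le {ρ : ℝ} (hρ : 2 ≤ ρ) (N : ℕ) (a : ℕ → ℝ) :
    truncVar ρ N a ^ 2
      ≤ 2 * ∑ L ∈ Finset.range N, |signedSq (a (L + 1)) - signedSq (a L)| := by
  have h : truncVar ρ N a ≤ _ :=
    truncVar_le (by linarith) fun n t ht hN => chain_rpow_root_le hρ a n t ht hN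
  calc _ ≤ _ := pow_le_pow_left₀ (truncVar_nonneg _ _ _) h 2
    _ = _ := Real.sq_sqrt (by positivity)

theorem truncVar_le_of_abs_sub_le {ρ : ℝ} (hρ : 2 ≤ ρ) {N : ℕ} {a b c : ℕ → ℝ} {A B : ℝ}
    (hA : 0 ≤ A) (hB : 0 ≤ B)
    (h : ∀ m ≤ N, ∀ n ≤ N, |c m - c n| ≤ A * |a m - a n| + B * |b m - b n|) :
    truncVar ρ N c ≤ A * truncVar ρ N a + B * truncVar ρ N b := by
  have hX : 0 ≤ A * truncVar ρ N a + B * truncVar ρ N b :=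
    add_nonneg (mul_nonneg hA (truncVar_nonneg _ _ _)) (mul_nonneg hB (truncVar_nonneg _ _ _))
  refine ENNReal.toReal_le_of_le_ofReal hX ?_
  rw [ENNReal.ofReal_add (mul_nonneg hA (truncVar_nonneg _ _ _))
    (mul_nonneg hB (truncVar_nonneg _ _ _)), ENNReal.ofReal_mul hA, ENNReal.ofReal_mul hB,
    ofReal_truncVar hρ, ofReal_truncVar hρ]
  refine varNorm_le_of_enorm_sub_le (by linarith) fun m hm n hn => ?_
  simp only [Real.enorm_eq_ofReal_abs]
  rw [← ENNReal.ofReal_mul hA, ← ENNReal.ofReal_mul hB, ← ENNReal.ofReal_add (by positivity)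
    (by positivity)]
  exact ENNReal.ofReal_le_ofReal (h m hm n hn)

theorem truncVar_add_le {ρ : ℝ} (hρ : 2 ≤ ρ) {N : ℕ} (a b : ℕ → ℝ) :
    truncVar ρ N (fun n => a n + b n) ≤ truncVar ρ N a + truncVar ρ N b := by
  have := truncVar_le_of_abs_sub_le (ρ := ρ) (N := N) (a := a) (b := b) (c := fun n => a n + b n)
    hρ zero_le_one zero_le_one fun m _ n _ => by
      rw [add_sub_add_comm, one_mul, one_mul]; exact abs_add_le _ _
  simpa using this

theorem abs_truncVar_sub_le {ρ : ℝ} (hρ : 2 ≤ ρ) {N : ℕ} (a b : ℕ → ℝ) :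
    |truncVar ρ N a - truncVar ρ N b| ≤ truncVar ρ N (fun n => a n - b n) := by
  have key : ∀ a b d : ℕ → ℝ, (∀ m n, |a m - a n| ≤ |b m - b n| + |d m - d n|) →
      truncVar ρ N a ≤ truncVar ρ N b + truncVar ρ N d := fun a b d h => by
    simpa using truncVar_le_of_abs_sub_le (ρ := ρ) (N := N) (a := b) (b := d) (c := a)
      hρ zero_le_one zero_le_one fun m _ n _ => by simpa using h m n
  have h1 := key a b (fun n => a n - b n) fun m n => by
    have := abs_add_le (b m - b n) (a m - b m - (a n - b n))
    rwa [show b m - b n + (a m - b m - (a n - b n)) = a m - a n by ring] at this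
  have h2 := key b a (fun n => a n - b n) fun m n => by
    have := abs_sub (a m - a n) (a m - b m - (a n - b n))
    rwa [show a m - a n - (a m - b m - (a n - b n)) = b m - b n by ring] at this
  rw [abs_le]
  constructor <;> linarith

theorem abs_sub_le_truncVar {ρ : ℝ} (hρ : 2 ≤ ρ) {N : ℕ} (a : ℕ → ℝ) {m n : ℕ}
    (hm : m ≤ N) (hn : n ≤ N) : |a m - a n| ≤ truncVar ρ N a := by
  have := enorm_sub_le_varNorm (ρ := ρ) (by linarith) a (S := Set.Iic N) hm hn
  rw [← ofReal_truncVar hρ, Real.enorm_eq_ofReal_abs] at this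
  exact (ENNReal.ofReal_le_ofReal_iff (truncVar_nonneg _ _ _)).1 this

/-! ### Dyadic intervals and conditional expectations on `ℤ` -/

/-- The dyadic interval of length `2 ^ k` containing `x`. -/
noncomputable def dyadic (k : ℕ) (x : ℤ) : Finset ℤ :=
  Finset.Ico (x / 2 ^ k * 2 ^ k) (x / 2 ^ k * 2 ^ k + 2 ^ k)

theorem mem_dyadic {k : ℕ} {x y : ℤ} : y ∈ dyadic k x ↔ y / 2 ^ k = x / 2 ^ k := by
  have h2 : (0 : ℤ) < 2 ^ k := by positivity
  unfold dyadic
  rw [Finset.mem_Ico, ← Int.le_ediv_iff_mul_le h2,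
    show x / 2 ^ k * 2 ^ k + 2 ^ k = (x / 2 ^ k + 1) * 2 ^ k by ring,
    ← Int.ediv_lt_iff_lt_mul h2]
  omega

theorem self_mem_dyadic (k : ℕ) (x : ℤ) : x ∈ dyadic k x := mem_dyadic.2 rfl

theorem card_dyadic (k : ℕ) (x : ℤ) : (dyadic k x).card = 2 ^ k := by
  unfold dyadic
  rw [Int.card_Ico, add_sub_cancel_left]
  norm_cast

theorem dyadic_congr {k : ℕ} {x y : ℤ} (h : x / 2 ^ k = y / 2 ^ k) : dyadic k x = dyadic k y := by
  unfold dyadic; rw [h]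

theorem ediv_two_pow_congr {j k : ℕ} (hjk : j ≤ k) {x y : ℤ} (h : x / 2 ^ j = y / 2 ^ j) :
    x / 2 ^ k = y / 2 ^ k := by
  obtain ⟨d, rfl⟩ := Nat.exists_eq_add_of_le hjk
  rw [pow_add, ← Int.ediv_ediv_of_nonneg (by positivity),
    ← Int.ediv_ediv_of_nonneg (by positivity), h]

theorem dyadic_subset_dyadic {j k : ℕ} (hjk : j ≤ k) (x : ℤ) : dyadic j x ⊆ dyadic k x :=
  fun _ hy => mem_dyadic.2 (ediv_two_pow_congr hjk (mem_dyadic.1 hy))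

/-- `u` is constant on dyadic intervals of length `2 ^ k`. -/
def DyadicConst {α : Type*} (k : ℕ) (u : ℤ → α) : Prop :=
  ∀ ⦃x y : ℤ⦄, x / 2 ^ k = y / 2 ^ k → u x = u y

theorem DyadicConst.mono {α : Type*} {j k : ℕ} {u : ℤ → α} (hu : DyadicConst k u) (hjk : j ≤ k) :
    DyadicConst j u := fun _ _ h => hu (ediv_two_pow_congr hjk h)

theorem dyadicConst_zero {α : Type*} (u : ℤ → α) : DyadicConst 0 u := fun x y h => by
  simp at h; rw [h]

/-- A finite set that is a union of dyadic intervals of length `2 ^ k`. -/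
def DyadicClosed (k : ℕ) (s : Finset ℤ) : Prop := ∀ x ∈ s, dyadic k x ⊆ s

theorem DyadicClosed.mono {j k : ℕ} {s : Finset ℤ} (hs : DyadicClosed k s) (hjk : j ≤ k) :
    DyadicClosed j s := fun x hx => (dyadic_subset_dyadic hjk x).trans (hs x hx)

theorem dyadicClosed_dyadic (k : ℕ) (x : ℤ) : DyadicClosed k (dyadic k x) := fun y hy => by
  rw [dyadic_congr (mem_dyadic.1 hy)]

/-- The symmetric box `[-2 ^ K, 2 ^ K)`. -/
noncomputable def box (K : ℕ) : Finset ℤ := Finset.Ico (-2 ^ K) (2 ^ K)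

theorem mem_box_iff {K : ℕ} {x : ℤ} : x ∈ box K ↔ x / 2 ^ K = 0 ∨ x / 2 ^ K = -1 := by
  have h2 : (0 : ℤ) < 2 ^ K := by positivity
  have h1 : x ∈ box K ↔ -1 ≤ x / 2 ^ K ∧ x / 2 ^ K < 1 := by
    unfold box
    rw [Finset.mem_Ico, Int.le_ediv_iff_mul_le h2, Int.ediv_lt_iff_lt_mul h2]
    simp
  rw [h1]
  omega

theorem dyadicClosed_box (K : ℕ) : DyadicClosed K (box K) := fun x hx y hy => by
  rw [mem_box_iff] at *
  rwa [mem_dyadic.1 hy]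

theorem card_box (K : ℕ) : (box K).card = 2 * 2 ^ K := by
  unfold box
  rw [Int.card_Ico]
  have : ((2 : ℤ) ^ K - -2 ^ K) = ((2 * 2 ^ K : ℕ) : ℤ) := by push_cast; ring
  rw [this, Int.toNat_natCast]

/-- The conditional expectation onto dyadic intervals of length `2 ^ k`. -/
noncomputable def condAvg (k : ℕ) (f : ℤ → ℝ) (x : ℤ) : ℝ :=
  (∑ y ∈ dyadic k x, f y) / 2 ^ k

theorem dyadicConst_condAvg (k : ℕ) (f : ℤ → ℝ) : DyadicConst k (condAvg k f) := fun x y h => by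
  unfold condAvg; rw [dyadic_congr h]

theorem condAvg_of_dyadicConst {k : ℕ} {f : ℤ → ℝ} (hf : DyadicConst k f) (x : ℤ) :
    condAvg k f x = f x := by
  unfold condAvg
  rw [Finset.sum_congr rfl fun y hy => hf (mem_dyadic.1 hy), Finset.sum_const, card_dyadic]
  simp

theorem condAvg_zero (f : ℤ → ℝ) (x : ℤ) : condAvg 0 f x = f x :=
  condAvg_of_dyadicConst (dyadicConst_zero f) x

theorem condAvg_mono {k : ℕ} {f g : ℤ → ℝ} {x : ℤ} (h : ∀ y ∈ dyadic k x, f y ≤ g y) :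
    condAvg k f x ≤ condAvg k g x := by
  unfold condAvg
  gcongr with y hy
  exact h y hy

theorem condAvg_nonneg {k : ℕ} {f : ℤ → ℝ} (hf : ∀ x, 0 ≤ f x) (x : ℤ) : 0 ≤ condAvg k f x :=
  div_nonneg (Finset.sum_nonneg fun _ _ => hf _) (by positivity)

theorem condAvg_const (k : ℕ) (c : ℝ) (x : ℤ) : condAvg k (fun _ => c) x = c :=
  condAvg_of_dyadicConst (fun _ _ _ => rfl) x

theorem condAvg_add (k : ℕ) (f g : ℤ → ℝ) (x : ℤ) :
    condAvg k (fun y => f y + g y) x = condAvg k f x + condAvg k g x := by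
  unfold condAvg; rw [Finset.sum_add_distrib, add_div]

theorem condAvg_sub (k : ℕ) (f g : ℤ → ℝ) (x : ℤ) :
    condAvg k (fun y => f y - g y) x = condAvg k f x - condAvg k g x := by
  unfold condAvg; rw [Finset.sum_sub_distrib, _root_.sub_div]

theorem abs_condAvg_le (k : ℕ) (f : ℤ → ℝ) (x : ℤ) :
    |condAvg k f x| ≤ condAvg k (fun y => |f y|) x := by
  unfold condAvg
  rw [abs_div, abs_of_pos (by positivity : (0 : ℝ) < 2 ^ k)]
  gcongr
  exact Finset.abs_sum_le_sum_abs _ _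

theorem condAvg_sq_le (k : ℕ) (f : ℤ → ℝ) (x : ℤ) :
    condAvg k f x ^ 2 ≤ condAvg k (fun y => f y ^ 2) x := by
  unfold condAvg
  have h := sq_sum_le_card_mul_sum_sq (s := dyadic k x) (f := f)
  rw [card_dyadic] at h
  rw [div_pow, div_le_div_iff₀ (by positivity) (by positivity)]
  push_cast at h
  nlinarith [show (0 : ℝ) < 2 ^ k by positivity]

theorem condAvg_le_two_mul {k : ℕ} {f : ℤ → ℝ} (hf : ∀ x, 0 ≤ f x) (x : ℤ) :
    condAvg k f x ≤ 2 * condAvg (k + 1) f x := by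
  unfold condAvg
  rw [pow_succ, ← mul_div_assoc, mul_comm (2 : ℝ),
    mul_div_mul_right _ _ (by norm_num : (2 : ℝ) ≠ 0)]
  gcongr
  · intros; exact hf _
  · exact dyadic_subset_dyadic k.le_succ x

theorem sum_mul_condAvg {k : ℕ} {s : Finset ℤ} (hs : DyadicClosed k s) {u : ℤ → ℝ}
    (hu : DyadicConst k u) (f : ℤ → ℝ) :
    ∑ x ∈ s, u x * condAvg k f x = ∑ x ∈ s, u x * f x := by
  unfold condAvg
  simp_rw [← mul_div_assoc, Finset.mul_sum]
  rw [← Finset.sum_div, Finset.sum_comm' (t' := s) (s' := fun y => dyadic k y), Finset.sum_div]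
  · refine Finset.sum_congr rfl fun y _ => ?_
    rw [Finset.sum_congr rfl fun x hx => by rw [hu (mem_dyadic.1 hx)], Finset.sum_const,
      card_dyadic]
    simp
  · intro x y
    simp only [mem_dyadic]
    constructor
    · rintro ⟨hx, h⟩; exact ⟨h.symm, hs x hx (mem_dyadic.2 h)⟩
    · rintro ⟨h, hy⟩; exact ⟨hs y hy (mem_dyadic.2 h), h.symm⟩

theorem sum_condAvg {k : ℕ} {s : Finset ℤ} (hs : DyadicClosed k s) (f : ℤ → ℝ) :
    ∑ x ∈ s, condAvg k f x = ∑ x ∈ s, f x := by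
  simpa using sum_mul_condAvg hs (u := fun _ => 1) (fun _ _ _ => rfl) f

theorem condAvg_condAvg {j k : ℕ} (hjk : j ≤ k) (f : ℤ → ℝ) (x : ℤ) :
    condAvg k (condAvg j f) x = condAvg k f x := by
  unfold condAvg
  congr 1
  exact sum_condAvg ((dyadicClosed_dyadic k x).mono hjk) f

theorem condAvg_eq_zero_of_notMem {k : ℕ} {s : Finset ℤ} (hs : DyadicClosed k s) {f : ℤ → ℝ}
    (hf : ∀ x, x ∉ s → f x = 0) {x : ℤ} (hx : x ∉ s) : condAvg k f x = 0 := by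
  unfold condAvg
  rw [Finset.sum_eq_zero, zero_div]
  intro y hy
  refine hf y fun hys => hx (hs y hys ?_)
  exact mem_dyadic.2 (mem_dyadic.1 hy).symm

/-- The dyadic martingale on `box K` generated by `f`, indexed from coarse to fine. -/
noncomputable def dyadicMart (K : ℕ) (f : ℤ → ℝ) (s : ℕ) (x : ℤ) : ℝ := condAvg (K - s) f x

theorem dyadicMart_last (K : ℕ) (f : ℤ → ℝ) (x : ℤ) : dyadicMart K f K x = f x := by
  unfold dyadicMart; rw [Nat.sub_self, condAvg_zero]

theorem dyadicConst_dyadicMart (K : ℕ) (f : ℤ → ℝ) {s r : ℕ} (h : r ≤ s) :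
    DyadicConst (K - s) (dyadicMart K f r) :=
  (dyadicConst_condAvg (K - r) f).mono (by omega)

theorem sum_mul_dyadicMart {K : ℕ} {s r : ℕ} (hsr : s ≤ r) {u : ℤ → ℝ}
    (hu : DyadicConst (K - s) u) (f : ℤ → ℝ) :
    ∑ x ∈ box K, u x * dyadicMart K f r x = ∑ x ∈ box K, u x * f x :=
  sum_mul_condAvg ((dyadicClosed_box K).mono (by omega)) (hu.mono (by omega)) f

theorem sum_mul_dyadicMart_sub {K : ℕ} {s : ℕ} {u : ℤ → ℝ}
    (hu : DyadicConst (K - s) u) (f : ℤ → ℝ) :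
    ∑ x ∈ box K, u x * (dyadicMart K f (s + 1) x - dyadicMart K f s x) = 0 := by
  simp_rw [mul_sub]
  rw [Finset.sum_sub_distrib, sum_mul_dyadicMart s.le_succ hu, sum_mul_dyadicMart le_rfl hu,
    sub_self]

theorem dyadicConst_partialSups {K s : ℕ} (g : ℕ → ℤ → ℝ)
    (hg : ∀ r ≤ s, DyadicConst (K - s) (g r)) :
    DyadicConst (K - s) (fun x => partialSups (fun r => g r x) s) := by
  intro x y hxy
  simp only [partialSups_apply]
  refine Finset.sup'_congr _ rfl fun r hr => hg r (Finset.mem_Iic.1 hr) hxy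

/-! ### Doob's maximal inequality -/

theorem mul_rpow_sub_one_le {p : ℝ} (hp : 1 < p) {a b : ℝ} (ha : 0 ≤ a) (hb : 0 ≤ b) :
    p * (a * b ^ (p - 1)) ≤ a ^ p + (p - 1) * b ^ p := by
  have hp1 : 0 < p - 1 := by linarith
  have hc : p.HolderConjugate (p / (p - 1)) := Real.HolderConjugate.conjExponent hp
  have := Real.young_inequality_of_nonneg ha (Real.rpow_nonneg hb (p - 1)) hc
  rw [← Real.rpow_mul hb, mul_div_cancel₀ _ hp1.ne'] at this
  have h2 : b ^ p / (p / (p - 1)) = (p - 1) * b ^ p / p := by field_simp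
  rw [h2, ← add_div, le_div_iff₀ (by linarith)] at this
  linarith

theorem mul_rpow_sub_one_le_eps {p : ℝ} (hp : 1 < p) {a b ε : ℝ} (ha : 0 ≤ a) (hb : 0 ≤ b)
    (hε : 0 < ε) : a * b ^ (p - 1) ≤ ε ^ (1 - p) * a ^ p + ε * b ^ p := by
  have hpow : ∀ c : ℝ, 0 ≤ c → c ^ p = c * c ^ (p - 1) := fun c hc => by
    rw [← Real.rpow_one_add' hc (by linarith)]; congr 1; ring
  rcases le_total a (ε * b) with h | h
  · calc a * b ^ (p - 1) ≤ ε * b * b ^ (p - 1) := by gcongr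
      _ = ε * b ^ p := by rw [hpow b hb]; ring
      _ ≤ _ := by have : 0 ≤ ε ^ (1 - p) * a ^ p := by positivity
                  linarith
  · have hb' : b ≤ a / ε := by rw [le_div_iff₀ hε]; linarith
    calc a * b ^ (p - 1) ≤ a * (a / ε) ^ (p - 1) := by
          gcongr
      _ = ε ^ (1 - p) * a ^ p := by
          rw [Real.div_rpow ha hε.le, hpow a ha, show 1 - p = -(p - 1) by ring,
            Real.rpow_neg hε.le]
          ring
      _ ≤ _ := by have : 0 ≤ ε * b ^ p := by positivity
                  linarith

theorem partialSups_nonneg {g : ℕ → ℝ} (hg : ∀ r, 0 ≤ g r) (s : ℕ) : 0 ≤ partialSups g s :=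
  (hg 0).trans (le_partialSups_of_le g (Nat.zero_le s))

/-- A pathwise form of Doob's maximal inequality. -/
theorem partialSups_rpow_le_pathwise {p : ℝ} (hp : 1 < p) (g : ℕ → ℝ) (hg : ∀ r, 0 ≤ g r) (K : ℕ) :
    (p - 1) * partialSups g K ^ p + p * ∑ s ∈ Finset.range K,
        partialSups g s ^ (p - 1) * (g (s + 1) - g s)
      ≤ p * (partialSups g K ^ (p - 1) * g K) := by
  have hpow : ∀ c : ℝ, 0 ≤ c → c ^ p = c ^ (p - 1) * c := fun c hc => by
    rw [← Real.rpow_add_one' hc (by linarith)]; congr 1; ring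
  induction K with
  | zero =>
    simp only [Finset.range_zero, Finset.sum_empty, mul_zero, add_zero]
    rw [show partialSups g 0 = g 0 by simp, ← hpow _ (hg 0)]
    have : 0 ≤ g 0 ^ p := Real.rpow_nonneg (hg 0) p
    linarith
  | succ K ih =>
    rw [Finset.sum_range_succ, partialSups_add_one]
    have hM := partialSups_nonneg hg K
    rcases le_total (g (K + 1)) (partialSups g K) with h | h
    · rw [sup_eq_left.2 h]
      linarith
    · rw [sup_eq_right.2 h, ← hpow _ (hg _)]
      have h1 := mul_rpow_sub_one_le hp (hg (K + 1)) hM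
      linarith

theorem doob_maximal {p : ℝ} (hp : 1 < p) : ∃ C : ℝ, 0 < C ∧ ∀ (K : ℕ) (f : ℤ → ℝ),
    (∀ x, 0 ≤ f x) → ∑ x ∈ box K, partialSups (fun s => dyadicMart K f s x) K ^ p
      ≤ C * ∑ x ∈ box K, f x ^ p := by
  have hp1 : 0 < p - 1 := by linarith
  set ε : ℝ := (p - 1) / (2 * p) with hε
  have hε0 : 0 < ε := by positivity
  refine ⟨2 * p / (p - 1) * ε ^ (1 - p), by positivity, fun K f hf => ?_⟩
  have hg : ∀ x s, 0 ≤ dyadicMart K f s x := fun x s => condAvg_nonneg hf x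
  have h1 := Finset.sum_le_sum fun x (_ : x ∈ box K) =>
    partialSups_rpow_le_pathwise hp (fun s => dyadicMart K f s x) (hg x) K
  rw [Finset.sum_add_distrib, ← Finset.mul_sum, ← Finset.mul_sum, Finset.sum_comm,
    Finset.sum_eq_zero (s := Finset.range K), mul_zero, add_zero, ← Finset.mul_sum] at h1
  · have h2 : ∑ x ∈ box K, partialSups (fun s => dyadicMart K f s x) K ^ (p - 1)
          * dyadicMart K f K x
        ≤ ∑ x ∈ box K, (ε ^ (1 - p) * f x ^ p
          + ε * partialSups (fun s => dyadicMart K f s x) K ^ p) := by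
      refine Finset.sum_le_sum fun x _ => ?_
      rw [dyadicMart_last, mul_comm]
      exact mul_rpow_sub_one_le_eps hp (hf x) (partialSups_nonneg (hg x) K) hε0
    rw [Finset.sum_add_distrib, ← Finset.mul_sum, ← Finset.mul_sum] at h2
    set A := ∑ x ∈ box K, partialSups (fun s => dyadicMart K f s x) K ^ p
    set B := ∑ x ∈ box K, f x ^ p
    have h3 : (p - 1) * A ≤ p * (ε ^ (1 - p) * B) + (p - 1) / 2 * A := by
      calc (p - 1) * A ≤ _ := h1
        _ ≤ p * (ε ^ (1 - p) * B + ε * A) := by gcongr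
        _ = _ := by rw [hε]; field_simp
    rw [show 2 * p / (p - 1) * ε ^ (1 - p) * B = (p * (ε ^ (1 - p) * B)) / ((p - 1) / 2) by
      field_simp, le_div_iff₀ (by linarith)]
    linarith
  · intro s _
    have hc := dyadicConst_partialSups (K := K) (s := s) (dyadicMart K f)
      (fun r hr => dyadicConst_dyadicMart K f hr)
    exact sum_mul_dyadicMart_sub
      (u := fun x => partialSups (fun s => dyadicMart K f s x) s ^ (p - 1))
      (fun x y hxy => by
        have := hc hxy
        simp only at this ⊢
        rw [this]) f

/-! ### Lépingle's inequality for dyadic martingales in `ℓ²` -/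

/-- The path `g` sampled at the successive times at which it has moved away from the last sampled
value by at least `η` times the running maximum of `|g|`. -/
noncomputable def anchor (η : ℝ) (g : ℕ → ℝ) : ℕ → ℝ
  | 0 => g 0
  | s + 1 => if η * partialSups (fun r => |g r|) (s + 1) ≤ |g (s + 1) - anchor η g s|
      then g (s + 1) else anchor η g s

/-- The quadratic variation of `anchor`. -/
noncomputable def anchorAcc (η : ℝ) (g : ℕ → ℝ) (s : ℕ) : ℝ :=
  ∑ r ∈ Finset.range s, (anchor η g (r + 1) - anchor η g r) ^ 2

theorem anchorAcc_succ (η : ℝ) (g : ℕ → ℝ) (s : ℕ) :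
    anchorAcc η g (s + 1) = anchorAcc η g s + (anchor η g (s + 1) - anchor η g s) ^ 2 :=
  Finset.sum_range_succ _ _

theorem anchorAcc_mono (η : ℝ) (g : ℕ → ℝ) : Monotone (anchorAcc η g) :=
  monotone_nat_of_le_succ fun s => by rw [anchorAcc_succ]; nlinarith

theorem anchorAcc_nonneg (η : ℝ) (g : ℕ → ℝ) (s : ℕ) : 0 ≤ anchorAcc η g s :=
  Finset.sum_nonneg fun _ _ => sq_nonneg _

theorem anchor_congr (η : ℝ) {g g' : ℕ → ℝ} {s : ℕ} (h : ∀ r ≤ s, g r = g' r) :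
    anchor η g s = anchor η g' s := by
  induction s with
  | zero => exact h 0 le_rfl
  | succ s ih =>
    have h1 : partialSups (fun r => |g r|) (s + 1) = partialSups (fun r => |g' r|) (s + 1) := by
      simp only [partialSups_apply]
      exact Finset.sup'_congr _ rfl fun r hr => by rw [h r (Finset.mem_Iic.1 hr)]
    simp only [anchor]
    rw [h1, ih fun r hr => h r (by omega), h (s + 1) le_rfl]

theorem le_partialSups_abs (g : ℕ → ℝ) {r s : ℕ} (h : r ≤ s) :
    |g r| ≤ partialSups (fun r => |g r|) s :=
  le_partialSups_of_le (fun r => |g r|) h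

theorem partialSups_abs_nonneg (g : ℕ → ℝ) (s : ℕ) : 0 ≤ partialSups (fun r => |g r|) s :=
  partialSups_nonneg (fun _ => abs_nonneg _) s

theorem abs_sub_anchor_le {η : ℝ} (hη : 0 < η) (g : ℕ → ℝ) (s : ℕ) :
    |g s - anchor η g s| ≤ η * partialSups (fun r => |g r|) s := by
  have hM := partialSups_abs_nonneg g s
  cases s with
  | zero => simp only [anchor, sub_self, abs_zero]; positivity
  | succ s =>
    simp only [anchor]
    split_ifs with h
    · simp only [sub_self, abs_zero]; positivity
    · exact (not_le.1 h).le

theorem anchorAcc_add_sq (η : ℝ) (g : ℕ → ℝ) (s : ℕ) :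
    anchorAcc η g (s + 1) + (g (s + 1) - anchor η g (s + 1)) ^ 2 - g (s + 1) ^ 2
      = anchorAcc η g s + (g s - anchor η g s) ^ 2 - g s ^ 2
        - 2 * (anchor η g s * (g (s + 1) - g s)) := by
  rw [anchorAcc_succ]
  simp only [anchor]
  split_ifs <;> ring

theorem anchor_eq_or_exists {η : ℝ} (hη : 0 < η) (g : ℕ → ℝ) {s t : ℕ} (hst : s ≤ t) :
    anchor η g t = anchor η g s ∨ ∃ B : ℝ, 0 ≤ B ∧
      (η * B) ^ 2 ≤ anchorAcc η g t - anchorAcc η g s ∧ |anchor η g t| ≤ B ∧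
      partialSups (fun r => |g r|) t ≤ B + η * partialSups (fun r => |g r|) t := by
  induction t, hst using Nat.le_induction with
  | base => exact Or.inl rfl
  | succ t hst ih =>
    set M := partialSups (fun r => |g r|) (t + 1) with hMdef
    have hM : 0 ≤ M := partialSups_abs_nonneg g _
    have hMt : partialSups (fun r => |g r|) t ≤ M := (partialSups _).monotone t.le_succ
    by_cases h : η * M ≤ |g (t + 1) - anchor η g t|
    · have ha : anchor η g (t + 1) = g (t + 1) := by simp only [anchor]; rw [if_pos h]
      refine Or.inr ⟨M, hM, ?_, ?_, ?_⟩
      · rw [anchorAcc_succ, ha]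
        have h1 := anchorAcc_mono η g hst
        have h2 : (η * M) ^ 2 ≤ |g (t + 1) - anchor η g t| ^ 2 := by gcongr
        rw [sq_abs] at h2
        linarith
      · rw [ha]; exact le_partialSups_abs g le_rfl
      · have : 0 ≤ η * M := by positivity
        linarith
    · have ha : anchor η g (t + 1) = anchor η g t := by simp only [anchor]; rw [if_neg h]
      rw [ha]
      rcases ih with ih | ⟨B, hB, h1, h2, h3⟩
      · exact Or.inl ih
      · refine Or.inr ⟨B, hB, ?_, h2, ?_⟩
        · rw [anchorAcc_succ, ha]; simpa using h1
        · have h4 : M = max (partialSups (fun r => |g r|) t) |g (t + 1)| :=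
            partialSups_add_one _ _
          have h5 : |g (t + 1)| ≤ |g (t + 1) - anchor η g t| + |anchor η g t| := by
            simpa using abs_add_le (g (t + 1) - anchor η g t) (anchor η g t)
          have h6 : η * partialSups (fun r => |g r|) t ≤ η * M := by gcongr
          have h7 := not_le.1 h
          conv_lhs => rw [h4]
          exact max_le (by linarith) (by linarith)

theorem sq_sub_le_anchorAcc {η : ℝ} (hη : 0 < η) (hη' : η ≤ 1 / 2) (g : ℕ → ℝ) {s t : ℕ}
    (hst : s ≤ t) (h1 : 2 * (η * partialSups (fun r => |g r|) t) < |g t - g s|)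
    (h2 : |g t - g s| ≤ 4 * (η * partialSups (fun r => |g r|) t)) :
    |g t - g s| ^ 2 ≤ 64 * (anchorAcc η g t - anchorAcc η g s) := by
  have hs := abs_sub_anchor_le hη g s
  have ht := abs_sub_anchor_le hη g t
  have hM : η * partialSups (fun r => |g r|) s ≤ η * partialSups (fun r => |g r|) t := by
    gcongr
  rcases anchor_eq_or_exists hη g hst with h | ⟨B, hB, h3, -, h4⟩
  · rw [h] at ht
    have := abs_sub_le (g t) (anchor η g s) (g s)
    rw [abs_sub_comm (anchor η g s)] at this
    linarith
  · set M := partialSups (fun r => |g r|) t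
    have hM0 : 0 ≤ M := partialSups_abs_nonneg g t
    have h5 : M ≤ 2 * B := by nlinarith
    have h6 : |g t - g s| ≤ 8 * (η * B) := by nlinarith
    calc |g t - g s| ^ 2 ≤ (8 * (η * B)) ^ 2 := by gcongr
      _ = 64 * (η * B) ^ 2 := by ring
      _ ≤ _ := by linarith

theorem exists_scale (g : ℕ → ℝ) {s t : ℕ} (hst : s ≤ t) (h : g t ≠ g s) : ∃ m : ℕ,
    2 * ((1 / 2) ^ (m + 1) * partialSups (fun r => |g r|) t) < |g t - g s| ∧
      |g t - g s| ≤ 4 * ((1 / 2) ^ (m + 1) * partialSups (fun r => |g r|) t) := by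
  have h0 : 0 < |g t - g s| := abs_pos.2 (sub_ne_zero.2 h)
  have h1 := le_partialSups_abs g (le_refl t)
  have h2 := le_partialSups_abs g hst
  have h3 := abs_sub (g t) (g s)
  set M := partialSups (fun r => |g r|) t
  have hM : 0 < M := by linarith
  obtain ⟨m, hm1, hm2⟩ := exists_nat_pow_near_of_lt_one (x := |g t - g s| / (2 * M))
    (y := (1 / 2 : ℝ)) (by positivity) (by rw [div_le_one (by positivity)]; linarith)
    (by norm_num) (by norm_num)
  rw [lt_div_iff₀ (by positivity)] at hm1
  rw [div_le_iff₀ (by positivity)] at hm2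
  refine ⟨m, by linarith, ?_⟩
  rw [pow_succ]
  linarith

/-- A weighted sum of the quadratic variations of the anchors at scales `2⁻¹, …, 2⁻ᵐ`. -/
noncomputable def scaleSum (ρ : ℝ) (m₀ : ℕ) (g : ℕ → ℝ) (s : ℕ) : ℝ :=
  64 * 4 ^ (ρ - 2) * ∑ m ∈ Finset.range m₀,
    ((1 / 2 : ℝ) ^ (ρ - 2)) ^ (m + 1) * anchorAcc ((1 / 2) ^ (m + 1)) g s

theorem rpow_sub_le_scaleSum {ρ : ℝ} (hρ : 2 < ρ) (g : ℕ → ℝ) {s t K m m₀ : ℕ} (hst : s ≤ t)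
    (htK : t ≤ K) (hm : m < m₀)
    (h1 : 2 * ((1 / 2) ^ (m + 1) * partialSups (fun r => |g r|) t) < |g t - g s|)
    (h2 : |g t - g s| ≤ 4 * ((1 / 2) ^ (m + 1) * partialSups (fun r => |g r|) t)) :
    |g t - g s| ^ ρ ≤ partialSups (fun r => |g r|) K ^ (ρ - 2)
      * (scaleSum ρ m₀ g t - scaleSum ρ m₀ g s) := by
  have hη : (0 : ℝ) < (1 / 2) ^ (m + 1) := by positivity
  have hη' : (1 / 2 : ℝ) ^ (m + 1) ≤ 1 / 2 := by
    rw [pow_succ]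
    have : (1 / 2 : ℝ) ^ m ≤ 1 := pow_le_one₀ (by norm_num) (by norm_num)
    linarith
  have h3 := sq_sub_le_anchorAcc hη hη' g hst h1 h2
  have hM0 := partialSups_abs_nonneg g K
  have hMt := partialSups_abs_nonneg g t
  have hM : partialSups (fun r => |g r|) t ≤ partialSups (fun r => |g r|) K :=
    (partialSups _).monotone htK
  set M := partialSups (fun r => |g r|) K
  have h4 : |g t - g s| ≤ 4 * ((1 / 2) ^ (m + 1) * M) := h2.trans (by gcongr)
  have h5 : |g t - g s| ^ (ρ - 2) ≤ 4 ^ (ρ - 2) * (((1 / 2 : ℝ) ^ (ρ - 2)) ^ (m + 1)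
      * M ^ (ρ - 2)) := by
    calc |g t - g s| ^ (ρ - 2) ≤ (4 * ((1 / 2) ^ (m + 1) * M)) ^ (ρ - 2) := by
          apply Real.rpow_le_rpow (abs_nonneg _) h4 (by linarith)
      _ = _ := by
          rw [Real.mul_rpow (by norm_num) (by positivity), Real.mul_rpow (by positivity) hM0,
            ← Real.rpow_natCast_mul (by norm_num), ← Real.rpow_mul_natCast (by norm_num),
            mul_comm (ρ - 2)]
  have h6 : ((1 / 2 : ℝ) ^ (ρ - 2)) ^ (m + 1) *
      (anchorAcc ((1 / 2) ^ (m + 1)) g t - anchorAcc ((1 / 2) ^ (m + 1)) g s)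
      ≤ ∑ m ∈ Finset.range m₀, ((1 / 2 : ℝ) ^ (ρ - 2)) ^ (m + 1) *
      (anchorAcc ((1 / 2) ^ (m + 1)) g t - anchorAcc ((1 / 2) ^ (m + 1)) g s) :=
    Finset.single_le_sum (f := fun m => ((1 / 2 : ℝ) ^ (ρ - 2)) ^ (m + 1) *
      (anchorAcc ((1 / 2) ^ (m + 1)) g t - anchorAcc ((1 / 2) ^ (m + 1)) g s))
      (fun m _ => mul_nonneg (by positivity) (sub_nonneg.2 (anchorAcc_mono _ g hst)))
      (Finset.mem_range.2 hm)
  calc |g t - g s| ^ ρ = |g t - g s| ^ (ρ - 2) * |g t - g s| ^ 2 := by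
        rw [← Real.rpow_natCast, ← Real.rpow_add_of_nonneg (abs_nonneg _) (by linarith)
          (by norm_num)]
        congr 1; push_cast; ring
    _ ≤ 4 ^ (ρ - 2) * (((1 / 2 : ℝ) ^ (ρ - 2)) ^ (m + 1) * M ^ (ρ - 2))
        * (64 * (anchorAcc ((1 / 2) ^ (m + 1)) g t - anchorAcc ((1 / 2) ^ (m + 1)) g s)) := by
        gcongr
    _ = M ^ (ρ - 2) * (64 * 4 ^ (ρ - 2) * (((1 / 2 : ℝ) ^ (ρ - 2)) ^ (m + 1) *
      (anchorAcc ((1 / 2) ^ (m + 1)) g t - anchorAcc ((1 / 2) ^ (m + 1)) g s))) := by ring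
    _ ≤ M ^ (ρ - 2) * (64 * 4 ^ (ρ - 2) * ∑ m ∈ Finset.range m₀,
      ((1 / 2 : ℝ) ^ (ρ - 2)) ^ (m + 1) *
      (anchorAcc ((1 / 2) ^ (m + 1)) g t - anchorAcc ((1 / 2) ^ (m + 1)) g s)) := by gcongr
    _ = _ := by
      unfold scaleSum
      rw [← mul_sub, ← Finset.sum_sub_distrib]
      simp_rw [mul_sub]

theorem scaleSum_nonneg (ρ : ℝ) (m₀ : ℕ) (g : ℕ → ℝ) (s : ℕ) : 0 ≤ scaleSum ρ m₀ g s :=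
  mul_nonneg (by positivity) (Finset.sum_nonneg fun _ _ =>
    mul_nonneg (by positivity) (anchorAcc_nonneg _ _ _))

theorem scaleSum_mono (ρ : ℝ) (m₀ : ℕ) (g : ℕ → ℝ) : Monotone (scaleSum ρ m₀ g) := by
  intro s t hst
  unfold scaleSum
  gcongr
  exact anchorAcc_mono _ _ hst

/-- The `ρ`-variation of a path is controlled by its maximal function and the quadratic variations
of its anchors. -/
theorem exists_chain_rpow_le {ρ : ℝ} (hρ : 2 < ρ) (g : ℕ → ℝ) (K : ℕ) : ∃ m₁ : ℕ, ∀ m₀ ≥ m₁,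
    ∀ (n : ℕ) (t : ℕ → ℕ), Monotone t → (∀ i, t i ≤ K) →
      (∑ i ∈ Finset.range n, |g (t (i + 1)) - g (t i)| ^ ρ) ^ (1 / ρ)
        ≤ √(partialSups (fun r => |g r|) K ^ 2 + scaleSum ρ m₀ g K) := by
  classical
  have hex : ∀ q : ℕ × ℕ, ∃ m : ℕ, q.1 ≤ q.2 → g q.2 ≠ g q.1 →
      2 * ((1 / 2) ^ (m + 1) * partialSups (fun r => |g r|) q.2) < |g q.2 - g q.1| ∧
      |g q.2 - g q.1| ≤ 4 * ((1 / 2) ^ (m + 1) * partialSups (fun r => |g r|) q.2) := by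
    intro q
    by_cases h : q.1 ≤ q.2 ∧ g q.2 ≠ g q.1
    · obtain ⟨m, hm⟩ := exists_scale g h.1 h.2
      exact ⟨m, fun _ _ => hm⟩
    · exact ⟨0, fun h1 h2 => absurd ⟨h1, h2⟩ h⟩
  choose m hm using hex
  refine ⟨(Finset.range (K + 1) ×ˢ Finset.range (K + 1)).sup m + 1, fun m₀ hm₀ n t ht hK => ?_⟩
  have hM := partialSups_abs_nonneg g K
  have hS := scaleSum_nonneg ρ m₀ g K
  have h1 : ∑ i ∈ Finset.range n, |g (t (i + 1)) - g (t i)| ^ ρ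
      ≤ ∑ i ∈ Finset.range n, partialSups (fun r => |g r|) K ^ (ρ - 2)
        * (scaleSum ρ m₀ g (t (i + 1)) - scaleSum ρ m₀ g (t i)) := by
    refine Finset.sum_le_sum fun i _ => ?_
    have hle : t i ≤ t (i + 1) := ht i.le_succ
    by_cases h : g (t (i + 1)) = g (t i)
    · rw [h, sub_self, abs_zero, Real.zero_rpow (by linarith)]
      exact mul_nonneg (by positivity) (sub_nonneg.2 (scaleSum_mono _ _ _ hle))
    · obtain ⟨h1, h2⟩ := hm (t i, t (i + 1)) hle h
      refine rpow_sub_le_scaleSum hρ g hle (hK _) ?_ h1 h2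
      have : m (t i, t (i + 1)) ≤ (Finset.range (K + 1) ×ˢ Finset.range (K + 1)).sup m := by
        apply Finset.le_sup
        simp only [Finset.mem_product, Finset.mem_range]
        exact ⟨Nat.lt_succ_of_le (hK _), Nat.lt_succ_of_le (hK _)⟩
      omega
  rw [← Finset.mul_sum, Finset.sum_range_sub (fun i => scaleSum ρ m₀ g (t i))] at h1
  set M := partialSups (fun r => |g r|) K
  set S := scaleSum ρ m₀ g K
  set Z := M ^ 2 + S with hZ
  have hZ0 : 0 ≤ Z := by positivity
  have h2 : M ^ (ρ - 2) * (scaleSum ρ m₀ g (t n) - scaleSum ρ m₀ g (t 0)) ≤ Z ^ (ρ / 2) := by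
    calc _ ≤ (√Z) ^ (ρ - 2) * Z := by
          have e1 : M ≤ √Z := Real.le_sqrt_of_sq_le (by linarith)
          have e2 := scaleSum_mono ρ m₀ g (hK n)
          have e3 := scaleSum_nonneg ρ m₀ g (t 0)
          have e4 : scaleSum ρ m₀ g (t n) - scaleSum ρ m₀ g (t 0) ≤ Z := by
            have : 0 ≤ M ^ 2 := by positivity
            linarith
          exact (mul_le_mul_of_nonneg_left e4 (by positivity)).trans
            (mul_le_mul_of_nonneg_right (Real.rpow_le_rpow hM e1 (by linarith)) hZ0)
      _ = Z ^ (ρ / 2) := by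
          rw [Real.sqrt_eq_rpow, ← Real.rpow_mul hZ0, ← Real.rpow_add_one' hZ0 (by linarith)]
          congr 1; ring
  calc _ ≤ (Z ^ (ρ / 2)) ^ (1 / ρ) :=
        Real.rpow_le_rpow (Finset.sum_nonneg fun i _ => by positivity) (h1.trans h2)
          (by positivity)
    _ = √Z := by
        rw [← Real.rpow_mul hZ0, Real.sqrt_eq_rpow]
        congr 1; field_simp

theorem sum_anchorAcc_le (η : ℝ) (K : ℕ) (f : ℤ → ℝ) :
    ∑ x ∈ box K, anchorAcc η (fun s => dyadicMart K f s x) K ≤ ∑ x ∈ box K, f x ^ 2 := by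
  have key : ∀ s, ∑ x ∈ box K, (anchorAcc η (fun s => dyadicMart K f s x) s
      + (dyadicMart K f s x - anchor η (fun s => dyadicMart K f s x) s) ^ 2
      - dyadicMart K f s x ^ 2) ≤ 0 := by
    intro s
    induction s with
    | zero =>
      refine Finset.sum_nonpos fun x _ => ?_
      simp only [anchorAcc, anchor, Finset.range_zero, Finset.sum_empty]
      nlinarith [sq_nonneg (dyadicMart K f 0 x)]
    | succ s ih =>
      have hd : DyadicConst (K - s) (fun x => anchor η (fun s => dyadicMart K f s x) s) :=
        fun x y hxy => anchor_congr η fun r hr => dyadicConst_dyadicMart K f hr hxy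
      rw [Finset.sum_congr rfl fun x _ => anchorAcc_add_sq η (fun s => dyadicMart K f s x) s,
        Finset.sum_sub_distrib, ← Finset.mul_sum, sum_mul_dyadicMart_sub hd f]
      simpa using ih
  have h := key K
  rw [Finset.sum_sub_distrib, sub_nonpos] at h
  simp only [dyadicMart_last] at h
  refine le_trans (Finset.sum_le_sum fun x _ => ?_) h
  nlinarith [sq_nonneg (f x - anchor η (fun s => dyadicMart K f s x) K)]

theorem sum_partialSups_abs_dyadicMart_le {p : ℝ} (hp : 1 < p) : ∃ C : ℝ, 0 < C ∧
    ∀ (K : ℕ) (f : ℤ → ℝ), ∑ x ∈ box K, partialSups (fun s => |dyadicMart K f s x|) K ^ p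
      ≤ C * ∑ x ∈ box K, |f x| ^ p := by
  obtain ⟨C, hC, h⟩ := doob_maximal hp
  refine ⟨C, hC, fun K f => le_trans (Finset.sum_le_sum fun x _ => ?_)
    (h K (fun y => |f y|) fun _ => abs_nonneg _)⟩
  have h0 := partialSups_nonneg (g := fun s => |dyadicMart K f s x|) (fun _ => abs_nonneg _) K
  refine Real.rpow_le_rpow h0 ?_ (by linarith)
  exact partialSups_mono (fun s => abs_condAvg_le (K - s) f x) K

/-- Lépingle's inequality for dyadic averages in `ℓ²`. -/
theorem lepingle {ρ : ℝ} (hρ : 2 < ρ) : ∃ C : ℝ, 0 < C ∧ ∀ (K : ℕ) (f : ℤ → ℝ),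
    ∃ W : ℤ → ℝ, (∀ x ∈ box K, ∀ (n : ℕ) (t : ℕ → ℕ), Monotone t → (∀ i, t i ≤ K) →
      (∑ i ∈ Finset.range n, |condAvg (t (i + 1)) f x - condAvg (t i) f x| ^ ρ) ^ (1 / ρ) ≤ W x) ∧
      ∑ x ∈ box K, W x ^ 2 ≤ C * ∑ x ∈ box K, f x ^ 2 := by
  obtain ⟨C, hC, hdoob⟩ := sum_partialSups_abs_dyadicMart_le (p := 2) (by norm_num)
  set q : ℝ := (1 / 2 : ℝ) ^ (ρ - 2) with hq
  have hq0 : 0 < q := by positivity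
  have hq1 : q < 1 := Real.rpow_lt_one (by norm_num) (by norm_num) (by linarith)
  have hq2 : 0 < (1 - q)⁻¹ := inv_pos.2 (by linarith)
  refine ⟨C + 64 * 4 ^ (ρ - 2) * (1 - q)⁻¹, by positivity, fun K f => ?_⟩
  have hex : ∀ x, ∃ m₁ : ℕ, ∀ m₀ ≥ m₁, ∀ (n : ℕ) (t : ℕ → ℕ), Monotone t → (∀ i, t i ≤ K) →
      (∑ i ∈ Finset.range n, |dyadicMart K f (t (i + 1)) x - dyadicMart K f (t i) x| ^ ρ) ^ (1 / ρ)
        ≤ √(partialSups (fun r => |dyadicMart K f r x|) K ^ 2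
          + scaleSum ρ m₀ (fun r => dyadicMart K f r x) K) :=
    fun x => exists_chain_rpow_le hρ (fun r => dyadicMart K f r x) K
  choose m hm using hex
  set m₀ := (box K).sup m
  refine ⟨fun x => √(partialSups (fun r => |dyadicMart K f r x|) K ^ 2
          + scaleSum ρ m₀ (fun r => dyadicMart K f r x) K), fun x hx n t ht hK => ?_, ?_⟩
  · have := hm x m₀ (Finset.le_sup hx) n (fun i => K - t (n - i))
      (fun i j hij => by
        have := ht (show n - j ≤ n - i by omega)
        simp only; omega) (fun i => by omega)
    refine le_trans (le_of_eq ?_) this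
    congr 1
    rw [← Finset.sum_range_reflect]
    refine Finset.sum_congr rfl fun i hi => ?_
    have hi' := Finset.mem_range.1 hi
    unfold dyadicMart
    rw [abs_sub_comm, show n - 1 - i + 1 = n - i by omega,
      show n - (i + 1) = n - 1 - i by omega, Nat.sub_sub_self (hK _), Nat.sub_sub_self (hK _)]
  · have h1 : ∀ x, √(partialSups (fun r => |dyadicMart K f r x|) K ^ 2
          + scaleSum ρ m₀ (fun r => dyadicMart K f r x) K) ^ 2 =
        partialSups (fun r => |dyadicMart K f r x|) K ^ 2
          + scaleSum ρ m₀ (fun r => dyadicMart K f r x) K := fun x =>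
      Real.sq_sqrt (add_nonneg (sq_nonneg _) (scaleSum_nonneg _ _ _ _))
    simp_rw [h1]
    rw [Finset.sum_add_distrib, add_mul]
    refine add_le_add ?_ ?_
    · have := hdoob K f
      simp only [Real.rpow_two, sq_abs] at this
      exact this
    · unfold scaleSum
      rw [← Finset.mul_sum, Finset.sum_comm, mul_assoc (64 * 4 ^ (ρ - 2) : ℝ)]
      refine mul_le_mul_of_nonneg_left ?_ (by positivity)
      have hS : 0 ≤ ∑ x ∈ box K, f x ^ 2 := Finset.sum_nonneg fun _ _ => sq_nonneg _
      calc _ ≤ ∑ m ∈ Finset.range m₀, q ^ (m + 1) * ∑ x ∈ box K, f x ^ 2 := by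
            refine Finset.sum_le_sum fun m _ => ?_
            rw [← Finset.mul_sum]
            exact mul_le_mul_of_nonneg_left (sum_anchorAcc_le _ K f) (by positivity)
        _ = (∑ m ∈ Finset.range m₀, q ^ (m + 1)) * ∑ x ∈ box K, f x ^ 2 := by
            rw [Finset.sum_mul]
        _ ≤ (1 - q)⁻¹ * ∑ x ∈ box K, f x ^ 2 := by
            refine mul_le_mul_of_nonneg_right ?_ hS
            calc ∑ m ∈ Finset.range m₀, q ^ (m + 1) ≤ ∑ m ∈ Finset.range m₀, q ^ m :=
                  Finset.sum_le_sum fun m _ => pow_le_pow_of_le_one hq0.le hq1.le m.le_succ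
              _ ≤ ∑' m, q ^ m := (summable_geometric_of_lt_one hq0.le hq1).sum_le_tsum _
                  (fun i _ => pow_nonneg hq0.le i)
              _ = _ := tsum_geometric_of_lt_one hq0.le hq1

/-! ### Forward averages -/

/-- The forward average of `f` over `[x, x + n)`. -/
noncomputable def avg (n : ℕ) (f : ℤ → ℝ) (x : ℤ) : ℝ :=
  (∑ l ∈ Finset.range n, f (x + l)) / n

theorem avg_add (n : ℕ) (f g : ℤ → ℝ) (x : ℤ) :
    avg n (fun y => f y + g y) x = avg n f x + avg n g x := by
  unfold avg; rw [Finset.sum_add_distrib, add_div]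

theorem avg_sub (n : ℕ) (f g : ℤ → ℝ) (x : ℤ) :
    avg n (fun y => f y - g y) x = avg n f x - avg n g x := by
  unfold avg; rw [Finset.sum_sub_distrib, _root_.sub_div]

theorem avg_sum {ι : Type*} (s : Finset ι) (n : ℕ) (f : ι → ℤ → ℝ) (x : ℤ) :
    avg n (fun y => ∑ i ∈ s, f i y) x = ∑ i ∈ s, avg n (f i) x := by
  unfold avg; rw [Finset.sum_comm, Finset.sum_div]

theorem condAvg_sum {ι : Type*} (s : Finset ι) (k : ℕ) (f : ι → ℤ → ℝ) (x : ℤ) :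
    condAvg k (fun y => ∑ i ∈ s, f i y) x = ∑ i ∈ s, condAvg k (f i) x := by
  unfold condAvg; rw [Finset.sum_comm, Finset.sum_div]

theorem avg_const {n : ℕ} (hn : n ≠ 0) (c : ℝ) (x : ℤ) : avg n (fun _ => c) x = c := by
  unfold avg
  have : (n : ℝ) ≠ 0 := Nat.cast_ne_zero.2 hn
  simp [this]

theorem avg_one (f : ℤ → ℝ) (x : ℤ) : avg 1 f x = f x := by simp [avg]

theorem avg_sq_le (n : ℕ) (f : ℤ → ℝ) (x : ℤ) : avg n f x ^ 2 ≤ avg n (fun y => f y ^ 2) x := by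
  rcases Nat.eq_zero_or_pos n with rfl | hn
  · simp [avg]
  unfold avg
  have h := sq_sum_le_card_mul_sum_sq (s := Finset.range n) (f := fun l : ℕ => f (x + l))
  rw [Finset.card_range] at h
  have hn' : (0 : ℝ) < n := Nat.cast_pos.2 hn
  rw [div_pow, div_le_div_iff₀ (by positivity) hn']
  nlinarith

theorem avg_succ_sub {n : ℕ} (hn : n ≠ 0) (f : ℤ → ℝ) (x : ℤ) :
    avg (n + 1) f x - avg n f x = (f (x + n) - avg n f x) / (n + 1) := by
  unfold avg
  have : (n : ℝ) ≠ 0 := Nat.cast_ne_zero.2 hn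
  have h' : (n : ℝ) + 1 ≠ 0 := by positivity
  rw [Finset.sum_range_succ]
  push_cast
  field_simp
  ring

theorem sum_shift_le (F s : Finset ℤ) {h : ℤ → ℝ} (h0 : ∀ x, 0 ≤ h x) (hs : ∀ x, x ∉ s → h x = 0)
    (l : ℤ) : ∑ x ∈ F, h (x + l) ≤ ∑ x ∈ s, h x := by
  classical
  calc ∑ x ∈ F, h (x + l) = ∑ y ∈ F.map (addRightEmbedding l), h y := by simp
    _ ≤ ∑ y ∈ F.map (addRightEmbedding l) ∪ s, h y :=
        Finset.sum_le_sum_of_subset_of_nonneg Finset.subset_union_left fun _ _ _ => h0 _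
    _ = ∑ y ∈ s, h y :=
        (Finset.sum_subset Finset.subset_union_right fun x _ hx => hs x hx).symm

theorem sum_avg_le (F s : Finset ℤ) {h : ℤ → ℝ} (h0 : ∀ x, 0 ≤ h x) (hs : ∀ x, x ∉ s → h x = 0)
    (n : ℕ) : ∑ x ∈ F, avg n h x ≤ ∑ x ∈ s, h x := by
  unfold avg
  rw [← Finset.sum_div, Finset.sum_comm]
  refine div_le_of_le_mul₀ (Nat.cast_nonneg n) (Finset.sum_nonneg fun _ _ => h0 _) ?_
  calc _ ≤ ∑ _l ∈ Finset.range n, ∑ x ∈ s, h x :=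
        Finset.sum_le_sum fun l _ => sum_shift_le F s h0 hs l
    _ = _ := by simp [mul_comm]

theorem sum_avg_sq_le (F s : Finset ℤ) {h : ℤ → ℝ} (hs : ∀ x, x ∉ s → h x = 0) (n : ℕ) :
    ∑ x ∈ F, avg n h x ^ 2 ≤ ∑ x ∈ s, h x ^ 2 :=
  (Finset.sum_le_sum fun x _ => avg_sq_le n h x).trans
    (sum_avg_le F s (fun _ => sq_nonneg _) (fun x hx => by simp [hs x hx]) n)

theorem sum_Ico_int_succ (h : ℤ → ℝ) {a y : ℤ} (hay : a ≤ y) :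
    ∑ z ∈ Finset.Ico a (y + 1), h z = ∑ z ∈ Finset.Ico a y, h z + h y := by
  have : Finset.Ico a (y + 1) = insert y (Finset.Ico a y) := by
    ext z; simp only [Finset.mem_Ico, Finset.mem_insert]; omega
  rw [this, Finset.sum_insert (by simp), add_comm]

/-- The sum of `h` over the part of the dyadic interval of `y` lying to the left of `y`. -/
noncomputable def leftSum (j : ℕ) (h : ℤ → ℝ) (y : ℤ) : ℝ :=
  ∑ z ∈ Finset.Ico (y / 2 ^ j * 2 ^ j) y, h z

theorem ediv_mul_le_self (j : ℕ) (y : ℤ) : y / 2 ^ j * 2 ^ j ≤ y :=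
  Int.ediv_mul_le y (by positivity)

theorem lt_ediv_mul_add (j : ℕ) (y : ℤ) : y < y / 2 ^ j * 2 ^ j + 2 ^ j := by
  have := Int.lt_ediv_add_one_mul_self y (show (0 : ℤ) < 2 ^ j by positivity)
  linarith

theorem leftSum_succ {j : ℕ} {h : ℤ → ℝ} (y : ℤ) (hj : condAvg j h y = 0) :
    leftSum j h (y + 1) = leftSum j h y + h y := by
  have h1 := ediv_mul_le_self j y
  have h2 := lt_ediv_mul_add j y
  unfold leftSum
  rcases (show y + 1 ≤ y / 2 ^ j * 2 ^ j + 2 ^ j by omega).lt_or_eq with h3 | h3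
  · have : (y + 1) / 2 ^ j = y / 2 ^ j := by
      rw [← mem_dyadic]; exact Finset.mem_Ico.2 ⟨by omega, h3⟩
    rw [this, sum_Ico_int_succ h h1]
  · have h4 : (y + 1) / 2 ^ j * 2 ^ j = y + 1 := by
      rw [h3, show y / 2 ^ j * 2 ^ j + 2 ^ j = (y / 2 ^ j + 1) * 2 ^ j by ring,
        Int.mul_ediv_cancel _ (by positivity)]
    have h5 : ∑ z ∈ Finset.Ico (y / 2 ^ j * 2 ^ j) (y + 1), h z = 0 := by
      unfold condAvg dyadic at hj
      rw [_root_.div_eq_zero_iff] at hj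
      rw [h3]
      exact hj.resolve_right (by positivity)
    rw [h4, Finset.Ico_self, Finset.sum_empty, ← h5, sum_Ico_int_succ h h1]

theorem avg_eq_leftSum {j : ℕ} {h : ℤ → ℝ} (n : ℕ) (x : ℤ) (hj : ∀ y, condAvg j h y = 0) :
    avg n h x = (leftSum j h (x + n) - leftSum j h x) / n := by
  unfold avg
  congr 1
  induction n with
  | zero => simp
  | succ n ih =>
    rw [Finset.sum_range_succ, ih]
    push_cast
    rw [← add_assoc, leftSum_succ _ (hj _)]
    ring

theorem leftSum_sq_le (j : ℕ) (h : ℤ → ℝ) (y : ℤ) :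
    leftSum j h y ^ 2 ≤ 4 ^ j * condAvg j (fun z => h z ^ 2) y := by
  have h1 := ediv_mul_le_self j y
  have h2 := lt_ediv_mul_add j y
  have hsub : Finset.Ico (y / 2 ^ j * 2 ^ j) y ⊆ dyadic j y :=
    Finset.Ico_subset_Ico le_rfl h2.le
  have hc : ((Finset.Ico (y / 2 ^ j * 2 ^ j) y).card : ℝ) ≤ 2 ^ j := by
    exact_mod_cast (card_dyadic j y) ▸ Finset.card_le_card hsub
  unfold leftSum condAvg
  calc _ ≤ ((Finset.Ico (y / 2 ^ j * 2 ^ j) y).card : ℝ)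
        * ∑ z ∈ Finset.Ico (y / 2 ^ j * 2 ^ j) y, h z ^ 2 := sq_sum_le_card_mul_sum_sq
    _ ≤ 2 ^ j * ∑ z ∈ dyadic j y, h z ^ 2 := by
        gcongr
    _ = _ := by
        rw [show (4 : ℝ) ^ j = 2 ^ j * 2 ^ j by rw [← mul_pow]; norm_num]
        field_simp

theorem sum_avg_sq_le_of_condAvg_eq_zero {K j k n : ℕ} (hjK : j ≤ K) {h : ℤ → ℝ}
    (hs : ∀ x, x ∉ box K → h x = 0) (hj : ∀ y, condAvg j h y = 0) (hn : 2 ^ k ≤ n) :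
    ∑ x ∈ box K, avg n h x ^ 2 ≤ 4 * (4 ^ j / 4 ^ k) * ∑ x ∈ box K, h x ^ 2 := by
  set e := condAvg j (fun z => h z ^ 2) with he
  have he0 : ∀ x, 0 ≤ e x := condAvg_nonneg fun _ => sq_nonneg _
  have hes : ∀ x, x ∉ box K → e x = 0 := fun x hx =>
    condAvg_eq_zero_of_notMem ((dyadicClosed_box K).mono hjK) (fun y hy => by simp [hs y hy]) hx
  have hsum : ∑ x ∈ box K, e x = ∑ x ∈ box K, h x ^ 2 :=
    sum_condAvg ((dyadicClosed_box K).mono hjK) _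
  have hn' : (2 : ℝ) ^ k ≤ n := by exact_mod_cast hn
  have hn'' : (4 : ℝ) ^ k ≤ (n : ℝ) ^ 2 := by
    rw [show (4 : ℝ) ^ k = (2 ^ k) ^ 2 by rw [← pow_mul, mul_comm, pow_mul]; norm_num]
    gcongr
  have hpt : ∀ x, avg n h x ^ 2 ≤ 2 * (4 ^ j / 4 ^ k) * (e (x + n) + e x) := by
    intro x
    rw [avg_eq_leftSum n x hj, div_pow]
    calc _ ≤ (2 * (4 ^ j * e (x + n)) + 2 * (4 ^ j * e x)) / 4 ^ k := by
          have h1 := leftSum_sq_le j h (x + n)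
          have h2 := leftSum_sq_le j h x
          have := he0 x
          have := he0 (x + n)
          gcongr
          nlinarith [sq_nonneg (leftSum j h (x + n) + leftSum j h x)]
      _ = _ := by ring
  calc _ ≤ ∑ x ∈ box K, 2 * (4 ^ j / 4 ^ k) * (e (x + n) + e x) :=
        Finset.sum_le_sum fun x _ => hpt x
    _ = 2 * (4 ^ j / 4 ^ k) * (∑ x ∈ box K, e (x + n) + ∑ x ∈ box K, e x) := by
        rw [← Finset.mul_sum, Finset.sum_add_distrib]
    _ ≤ 2 * (4 ^ j / 4 ^ k) * (∑ x ∈ box K, e x + ∑ x ∈ box K, e x) := by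
        gcongr _ * (?_ + _)
        exact sum_shift_le _ _ he0 hes n
    _ = _ := by rw [hsum]; ring

theorem sum_indicator_le {K i l : ℕ} (hiK : i ≤ K) {h : ℤ → ℝ} (hh : DyadicConst i h)
    {P : ℤ → Prop} [DecidablePred P] (hP : ∀ x, ((dyadic i x).filter P).card ≤ l) :
    ∑ x ∈ box K, (if P x then h x ^ 2 else 0) ≤ l / 2 ^ i * ∑ x ∈ box K, h x ^ 2 := by
  have h1 := sum_mul_condAvg ((dyadicClosed_box K).mono hiK) (u := fun x => h x ^ 2)
    (fun x y hxy => by simp only [hh hxy]) (fun x => if P x then 1 else 0)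
  simp only [mul_ite, mul_one, mul_zero] at h1
  rw [← h1, Finset.mul_sum]
  refine Finset.sum_le_sum fun x _ => ?_
  rw [mul_comm]
  refine mul_le_mul_of_nonneg_right ?_ (sq_nonneg _)
  unfold condAvg
  gcongr
  rw [Finset.sum_boole]
  exact_mod_cast hP x

theorem sum_shift_sub_sq_le {K i : ℕ} (hiK : i ≤ K) {h : ℤ → ℝ} (hh : DyadicConst i h)
    (hs : ∀ x, x ∉ box K → h x = 0) (l : ℕ) :
    ∑ x ∈ box K, (h (x + l) - h x) ^ 2 ≤ 4 * (l / 2 ^ i) * ∑ x ∈ box K, h x ^ 2 := by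
  have h2 : (0 : ℤ) < 2 ^ i := by positivity
  have hpt : ∀ x, (h (x + l) - h x) ^ 2 ≤
      2 * (if (x + l - l) / 2 ^ i ≠ (x + l) / 2 ^ i then h (x + l) ^ 2 else 0)
      + 2 * (if (x + l) / 2 ^ i ≠ x / 2 ^ i then h x ^ 2 else 0) := by
    intro x
    rw [add_sub_cancel_right]
    by_cases hx : x / 2 ^ i = (x + l) / 2 ^ i
    · rw [hh hx]; simp [hx]
    · rw [if_pos hx, if_pos (Ne.symm hx)]
      nlinarith [sq_nonneg (h (x + l) + h x)]
  have hA : ∑ x ∈ box K, (if (x + l) / 2 ^ i ≠ x / 2 ^ i then h x ^ 2 else 0)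
      ≤ l / 2 ^ i * ∑ x ∈ box K, h x ^ 2 := by
    refine sum_indicator_le hiK hh fun x => ?_
    have : (dyadic i x).filter (fun x : ℤ => (x + l) / 2 ^ i ≠ x / 2 ^ i) ⊆
        Finset.Ico (x / 2 ^ i * 2 ^ i + 2 ^ i - l) (x / 2 ^ i * 2 ^ i + 2 ^ i) := by
      intro y hy
      rw [Finset.mem_filter] at hy
      have h3 := Finset.mem_Ico.1 hy.1
      refine Finset.mem_Ico.2 ⟨?_, h3.2⟩
      by_contra hlt
      refine hy.2 ?_
      rw [mem_dyadic.1 hy.1, ← mem_dyadic]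
      exact Finset.mem_Ico.2 ⟨by omega, by omega⟩
    refine (Finset.card_le_card this).trans ?_
    rw [Int.card_Ico]; omega
  have hB : ∑ x ∈ box K, (if (x - l) / 2 ^ i ≠ x / 2 ^ i then h x ^ 2 else 0)
      ≤ l / 2 ^ i * ∑ x ∈ box K, h x ^ 2 := by
    refine sum_indicator_le hiK hh fun x => ?_
    have : (dyadic i x).filter (fun x : ℤ => (x - l) / 2 ^ i ≠ x / 2 ^ i) ⊆
        Finset.Ico (x / 2 ^ i * 2 ^ i) (x / 2 ^ i * 2 ^ i + l) := by
      intro y hy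
      rw [Finset.mem_filter] at hy
      have h3 := Finset.mem_Ico.1 hy.1
      refine Finset.mem_Ico.2 ⟨h3.1, ?_⟩
      by_contra hlt
      refine hy.2 ?_
      rw [mem_dyadic.1 hy.1, ← mem_dyadic]
      exact Finset.mem_Ico.2 ⟨by omega, by omega⟩
    refine (Finset.card_le_card this).trans ?_
    rw [Int.card_Ico]; omega
  have hB' := sum_shift_le (box K) (box K)
    (h := fun x => if (x - l) / 2 ^ i ≠ x / 2 ^ i then h x ^ 2 else 0)
    (fun x => by positivity) (fun x hx => by simp [hs x hx]) l
  have hsum := Finset.sum_le_sum fun x (_ : x ∈ box K) => hpt x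
  rw [Finset.sum_add_distrib, ← Finset.mul_sum, ← Finset.mul_sum] at hsum
  linarith

theorem sum_avg_sub_sq_le {K i k n : ℕ} (hiK : i ≤ K) {h : ℤ → ℝ} (hh : DyadicConst i h)
    (hs : ∀ x, x ∉ box K → h x = 0) (hn0 : n ≠ 0) (hn : n < 2 ^ (k + 1)) :
    ∑ x ∈ box K, (avg n h x - h x) ^ 2 ≤ 8 * (2 ^ k / 2 ^ i) * ∑ x ∈ box K, h x ^ 2 := by
  have hH : 0 ≤ ∑ x ∈ box K, h x ^ 2 := Finset.sum_nonneg fun _ _ => sq_nonneg _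
  have hpt : ∀ x, (avg n h x - h x) ^ 2
      ≤ (∑ l ∈ Finset.range n, (h (x + l) - h x) ^ 2) / n := by
    intro x
    have := avg_sq_le n (fun y => h y - h x) x
    rw [avg_sub, avg_const hn0] at this
    exact this
  have hn' : (0 : ℝ) < n := by positivity
  calc _ ≤ ∑ x ∈ box K, (∑ l ∈ Finset.range n, (h (x + l) - h x) ^ 2) / n :=
        Finset.sum_le_sum fun x _ => hpt x
    _ = (∑ l ∈ Finset.range n, ∑ x ∈ box K, (h (x + l) - h x) ^ 2) / n := by
        rw [← Finset.sum_div, Finset.sum_comm]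
    _ ≤ (∑ _l ∈ Finset.range n, 8 * (2 ^ k / 2 ^ i) * ∑ x ∈ box K, h x ^ 2) / n := by
        gcongr with l hl
        refine (sum_shift_sub_sq_le hiK hh hs l).trans ?_
        have hl' : (l : ℝ) ≤ 2 * 2 ^ k := by
          have := Finset.mem_range.1 hl
          rw [pow_succ] at hn
          exact_mod_cast (show l ≤ 2 * 2 ^ k by omega)
        have : 4 * ((l : ℝ) / 2 ^ i) ≤ 8 * (2 ^ k / 2 ^ i) := by
          rw [← mul_div_assoc, ← mul_div_assoc]
          exact div_le_div_of_nonneg_right (by linarith) (by positivity)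
        gcongr
    _ = _ := by
        rw [Finset.sum_const, Finset.card_range, nsmul_eq_mul]
        field_simp

/-! ### The `ℓ²` variational estimate for forward averages -/

theorem box_mono {K K' : ℕ} (h : K ≤ K') : box K ⊆ box K' := by
  have : (2 : ℤ) ^ K ≤ 2 ^ K' := pow_le_pow_right₀ (by norm_num) h
  exact Finset.Ico_subset_Ico (by omega) this

/-- The martingale differences of `f`, completed by the coarsest average. -/
noncomputable def dyadicDiff (K : ℕ) (f : ℤ → ℝ) (i : ℤ) (x : ℤ) : ℝ :=
  if i < 0 ∨ (K : ℤ) < i then 0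
  else if i = K then condAvg K f x else condAvg i.toNat f x - condAvg (i.toNat + 1) f x

theorem dyadicDiff_eq_zero {K : ℕ} {f : ℤ → ℝ} {i : ℤ} (hi : i < 0 ∨ (K : ℤ) < i) :
    dyadicDiff K f i = fun _ => 0 := by
  funext x; unfold dyadicDiff; rw [if_pos hi]

theorem dyadicDiff_natCast {K i : ℕ} (f : ℤ → ℝ) (hi : i < K) :
    dyadicDiff K f i = fun x => condAvg i f x - condAvg (i + 1) f x := by
  funext x
  unfold dyadicDiff
  rw [if_neg (by omega), if_neg (by omega), Int.toNat_natCast]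

theorem dyadicDiff_self (K : ℕ) (f : ℤ → ℝ) : dyadicDiff K f K = condAvg K f := by
  funext x
  unfold dyadicDiff
  rw [if_neg (by omega), if_pos rfl]

theorem dyadicDiff_notMem {K : ℕ} {f : ℤ → ℝ} (hf : ∀ x, x ∉ box K → f x = 0) (i : ℤ) {x : ℤ}
    (hx : x ∉ box K) : dyadicDiff K f i x = 0 := by
  have h0 : ∀ k ≤ K, condAvg k f x = 0 := fun k hk =>
    condAvg_eq_zero_of_notMem ((dyadicClosed_box K).mono hk) hf hx
  unfold dyadicDiff
  split_ifs with h1 h2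
  · rfl
  · exact h0 K le_rfl
  · rw [h0 _ (by omega), h0 _ (by omega), sub_zero]

theorem sum_eq_sum_range_of_dyadicDiff {K : ℕ} {F : ℤ → ℝ}
    (hF : ∀ i, (i < 0 ∨ (K : ℤ) < i) → F i = 0) {s : Finset ℤ}
    (hs : ∀ i : ℕ, i ≤ K → (i : ℤ) ∈ s) : ∑ i ∈ s, F i = ∑ i ∈ Finset.range (K + 1), F i := by
  have h := Finset.sum_map (Finset.range (K + 1)) Nat.castEmbedding F
  simp only [Nat.castEmbedding_apply] at h
  rw [← h]
  symm
  refine Finset.sum_subset (fun i hi => ?_) fun i _ hi => hF i ?_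
  · obtain ⟨j, hj, rfl⟩ := Finset.mem_map.1 hi
    exact hs j (Nat.lt_succ_iff.1 (Finset.mem_range.1 hj))
  · by_contra h
    refine hi (Finset.mem_map.2 ⟨i.toNat, Finset.mem_range.2 (by omega), ?_⟩)
    simp only [Nat.castEmbedding_apply]; omega

theorem sum_dyadicDiff {K : ℕ} (f : ℤ → ℝ) (x : ℤ) {s : Finset ℤ}
    (hs : ∀ i : ℕ, i ≤ K → (i : ℤ) ∈ s) : ∑ i ∈ s, dyadicDiff K f i x = f x := by
  rw [sum_eq_sum_range_of_dyadicDiff (K := K) (F := fun i => dyadicDiff K f i x)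
    (fun i hi => by rw [dyadicDiff_eq_zero hi]) hs, Finset.sum_range_succ, dyadicDiff_self,
    Finset.sum_congr rfl fun i hi => by rw [dyadicDiff_natCast f (Finset.mem_range.1 hi)],
    Finset.sum_range_sub' (fun i => condAvg i f x), condAvg_zero]
  ring

theorem sum_sum_dyadicDiff_sq_le (K : ℕ) (f : ℤ → ℝ) (s : Finset ℤ) :
    ∑ i ∈ s, ∑ x ∈ box K, dyadicDiff K f i x ^ 2 ≤ ∑ x ∈ box K, f x ^ 2 := by
  classical
  have h1 : ∑ i ∈ s, ∑ x ∈ box K, dyadicDiff K f i x ^ 2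
      ≤ ∑ i ∈ s ∪ Finset.Icc 0 (K : ℤ), ∑ x ∈ box K, dyadicDiff K f i x ^ 2 :=
    Finset.sum_le_sum_of_subset_of_nonneg Finset.subset_union_left fun _ _ _ =>
      Finset.sum_nonneg fun _ _ => sq_nonneg _
  refine h1.trans (le_of_eq ?_)
  rw [sum_eq_sum_range_of_dyadicDiff (K := K) (F := fun i => ∑ x ∈ box K, dyadicDiff K f i x ^ 2)
    (fun i hi => by simp [dyadicDiff_eq_zero hi])
    (fun i hi => Finset.mem_union_right _ (Finset.mem_Icc.2 ⟨by omega, by omega⟩)),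
    Finset.sum_range_succ, dyadicDiff_self]
  have h2 : ∀ i ∈ Finset.range K, ∑ x ∈ box K, dyadicDiff K f i x ^ 2
      = ∑ x ∈ box K, condAvg i f x ^ 2 - ∑ x ∈ box K, condAvg (i + 1) f x ^ 2 := by
    intro i hi
    have hiK := Finset.mem_range.1 hi
    rw [dyadicDiff_natCast f hiK]
    have hc : DyadicClosed (i + 1) (box K) := (dyadicClosed_box K).mono (by omega)
    have e1 := sum_mul_condAvg hc (dyadicConst_condAvg (i + 1) f) f
    have e2 := sum_mul_condAvg (hc.mono i.le_succ)
      ((dyadicConst_condAvg (i + 1) f).mono i.le_succ) f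
    have e3 : ∑ x ∈ box K, (condAvg i f x - condAvg (i + 1) f x) ^ 2
        = ∑ x ∈ box K, condAvg i f x ^ 2 - 2 * ∑ x ∈ box K, condAvg (i + 1) f x * condAvg i f x
          + ∑ x ∈ box K, condAvg (i + 1) f x * condAvg (i + 1) f x := by
      rw [Finset.mul_sum, ← Finset.sum_sub_distrib, ← Finset.sum_add_distrib]
      exact Finset.sum_congr rfl fun x _ => by ring
    have e4 : ∑ x ∈ box K, condAvg (i + 1) f x ^ 2
        = ∑ x ∈ box K, condAvg (i + 1) f x * condAvg (i + 1) f x :=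
      Finset.sum_congr rfl fun x _ => by ring
    rw [e3, e4, e1, e2]; ring
  rw [Finset.sum_congr rfl h2,
    Finset.sum_range_sub' (fun i => ∑ x ∈ box K, condAvg i f x ^ 2)]
  simp only [condAvg_zero]
  ring

theorem avg_zero_fun (n : ℕ) (x : ℤ) : avg n (fun _ => 0) x = 0 := by simp [avg]

theorem sum_avg_sub_condAvg_dyadicDiff_le {K k n : ℕ} (hk : k ≤ K) {f : ℤ → ℝ}
    (hf : ∀ x, x ∉ box K → f x = 0) (hn : 2 ^ k ≤ n) (hn' : n < 2 ^ (k + 1)) (m : ℤ) :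
    ∑ x ∈ box K, (avg n (dyadicDiff K f (k + m)) x - condAvg k (dyadicDiff K f (k + m)) x) ^ 2
      ≤ (4 * (3 / 4) ^ m.natAbs) ^ 2 * ∑ x ∈ box K, dyadicDiff K f (k + m) x ^ 2 := by
  have hn0 : n ≠ 0 := by have := Nat.pos_of_neZero (2 ^ k); omega
  have hH : 0 ≤ ∑ x ∈ box K, dyadicDiff K f (k + m) x ^ 2 :=
    Finset.sum_nonneg fun _ _ => sq_nonneg _
  have hD : ∀ x, x ∉ box K → dyadicDiff K f (k + m) x = 0 := fun x hx => dyadicDiff_notMem hf _ hx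
  have hpow : ∀ m : ℕ, (4 * (3 / 4 : ℝ) ^ m) ^ 2 = 16 * (9 / 16) ^ m := fun m => by
    rw [mul_pow, ← pow_mul, mul_comm m, pow_mul]; norm_num
  rw [hpow]
  by_cases h0 : (k : ℤ) + m < 0 ∨ (K : ℤ) < k + m
  · rw [dyadicDiff_eq_zero h0]
    simp [avg_zero_fun, condAvg_const]
  rcases le_or_gt 0 m with hm | hm
  · lift m to ℕ using hm
    have hik : k + m ≤ K := by omega
    have hconst : DyadicConst (k + m) (dyadicDiff K f (k + m)) := by
      rcases hik.lt_or_eq with h | h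
      · have := dyadicDiff_natCast f h
        push_cast at this
        rw [this]
        intro x y hxy
        simp only
        rw [dyadicConst_condAvg _ f hxy,
          (dyadicConst_condAvg (k + m + 1) f).mono (Nat.le_succ _) hxy]
      · rw [show (k : ℤ) + m = K by omega, dyadicDiff_self, h]
        exact dyadicConst_condAvg K f
    have h1 := sum_avg_sub_sq_le (k := k) hik hconst hD hn0 hn'
    simp_rw [condAvg_of_dyadicConst (hconst.mono (Nat.le_add_right k m))]
    refine h1.trans (mul_le_mul_of_nonneg_right ?_ hH)
    rw [Int.natAbs_natCast, pow_add, div_mul_cancel_left₀ (by positivity), ← inv_pow]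
    have : ((2 : ℝ)⁻¹) ^ m ≤ (9 / 16) ^ m := pow_le_pow_left₀ (by norm_num) (by norm_num) m
    have : 0 ≤ ((2 : ℝ)⁻¹) ^ m := by positivity
    linarith
  · obtain ⟨i, hi⟩ : ∃ i : ℕ, (i : ℤ) = k + m := ⟨(k + m).toNat, by omega⟩
    have hik : i + m.natAbs = k := by omega
    have hi1 : i + 1 ≤ k := by omega
    rw [← hi] at hD hH ⊢
    have hDi := dyadicDiff_natCast f (show i < K by omega)
    have hz : ∀ y, condAvg (i + 1) (dyadicDiff K f i) y = 0 := by
      intro y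
      rw [hDi, condAvg_sub, condAvg_condAvg i.le_succ, condAvg_condAvg le_rfl, sub_self]
    have hz' : ∀ y, condAvg k (dyadicDiff K f i) y = 0 := by
      intro y
      rw [hDi, condAvg_sub, condAvg_condAvg (by omega), condAvg_condAvg hi1, sub_self]
    have h1 := sum_avg_sq_le_of_condAvg_eq_zero (by omega) hD hz hn
    simp_rw [hz', sub_zero]
    refine h1.trans (mul_le_mul_of_nonneg_right ?_ hH)
    rw [← hik, pow_succ, pow_add, mul_comm ((4 : ℝ) ^ i) 4, mul_div_assoc,
      div_mul_cancel_left₀ (by positivity), ← inv_pow]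
    have : ((4 : ℝ)⁻¹) ^ m.natAbs ≤ (9 / 16) ^ m.natAbs :=
      pow_le_pow_left₀ (by norm_num) (by norm_num) _
    linarith

theorem mul_abs_add_le (d a b : ℝ) {t : ℝ} (ht : 0 < t) :
    |d| * (|a| + |b|) ≤ t * d ^ 2 + (a ^ 2 + b ^ 2) / (2 * t) := by
  rw [← sub_nonneg]
  have : t * d ^ 2 + (a ^ 2 + b ^ 2) / (2 * t) - |d| * (|a| + |b|)
      = ((2 * t * |d| - (|a| + |b|)) ^ 2 + (|a| - |b|) ^ 2) / (4 * t) := by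
    rw [← sq_abs d, ← sq_abs a, ← sq_abs b]
    field_simp
    ring
  rw [this]
  positivity

theorem sum_avg_succ_sub_sq_le {K n : ℕ} (hn : n ≠ 0) {h : ℤ → ℝ}
    (hs : ∀ x, x ∉ box K → h x = 0) :
    ∑ x ∈ box K, (avg (n + 1) h x - avg n h x) ^ 2
      ≤ 4 / n ^ 2 * ∑ x ∈ box K, h x ^ 2 := by
  have hn' : (0 : ℝ) < n := by positivity
  have hpt : ∀ x, (avg (n + 1) h x - avg n h x) ^ 2
      ≤ 2 / n ^ 2 * (h (x + n) ^ 2 + avg n h x ^ 2) := by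
    intro x
    rw [avg_succ_sub hn, div_pow, div_mul_eq_mul_div]
    gcongr
    · nlinarith [sq_nonneg (h (x + n) + avg n h x)]
    · linarith
  calc _ ≤ ∑ x ∈ box K, 2 / (n : ℝ) ^ 2 * (h (x + n) ^ 2 + avg n h x ^ 2) :=
        Finset.sum_le_sum fun x _ => hpt x
    _ = 2 / (n : ℝ) ^ 2 * (∑ x ∈ box K, h (x + n) ^ 2 + ∑ x ∈ box K, avg n h x ^ 2) := by
        rw [← Finset.mul_sum, Finset.sum_add_distrib]
    _ ≤ 2 / (n : ℝ) ^ 2 * (∑ x ∈ box K, h x ^ 2 + ∑ x ∈ box K, h x ^ 2) := by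
        have h1 := sum_shift_le (box K) (box K) (h := fun x => h x ^ 2) (fun _ => sq_nonneg _)
          (fun x hx => by simp [hs x hx]) n
        have h2 := sum_avg_sq_le (box K) (box K) hs n
        gcongr ?_ * (?_ + ?_)
    _ = _ := by ring

/-- The part of `avg n f - condAvg k f`, `2 ^ k ≤ n < 2 ^ (k + 1)`, coming from the martingale
difference `m` scales above `k`. -/
noncomputable def scalePart (K : ℕ) (f : ℤ → ℝ) (m : ℤ) (n : ℕ) (x : ℤ) : ℝ :=
  avg n (dyadicDiff K f (Nat.log 2 n + m)) x
    - condAvg (Nat.log 2 n) (dyadicDiff K f (Nat.log 2 n + m)) x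

theorem log_two_eq {k n : ℕ} (hn : 2 ^ k ≤ n) (hn' : n < 2 ^ (k + 1)) : Nat.log 2 n = k :=
  Nat.log_eq_of_pow_le_of_lt_pow hn hn'

theorem sum_abs_signedSq_scalePart_le {K k n : ℕ} (hk : k < K) {f : ℤ → ℝ}
    (hf : ∀ x, x ∉ box K → f x = 0) (hn : 2 ^ k ≤ n) (hn' : n < 2 ^ (k + 1)) (m : ℤ) :
    ∑ x ∈ box K, |signedSq (scalePart K f m (n + 1) x) - signedSq (scalePart K f m n x)|
      ≤ 4 * (3 / 4) ^ m.natAbs * (5 / 2 ^ k * ∑ x ∈ box K, dyadicDiff K f (k + m) x ^ 2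
        + if n + 1 = 2 ^ (k + 1) then 4 * (∑ x ∈ box K, dyadicDiff K f (k + m) x ^ 2
          + ∑ x ∈ box K, dyadicDiff K f ((k + 1 : ℕ) + m) x ^ 2) else 0) := by
  have hn0 : n ≠ 0 := by have := Nat.pos_of_neZero (2 ^ k); omega
  set e : ℝ := 4 * (3 / 4) ^ m.natAbs with he
  have he0 : 0 < e := by positivity
  have he4 : e ≤ 4 := by
    have : (3 / 4 : ℝ) ^ m.natAbs ≤ 1 := pow_le_one₀ (by norm_num) (by norm_num)
    linarith
  set H := ∑ x ∈ box K, dyadicDiff K f (k + m) x ^ 2 with hHdef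
  set H' := ∑ x ∈ box K, dyadicDiff K f ((k + 1 : ℕ) + m) x ^ 2
  have hH : 0 ≤ H := Finset.sum_nonneg fun _ _ => sq_nonneg _
  have hH' : 0 ≤ H' := Finset.sum_nonneg fun _ _ => sq_nonneg _
  have hlog := log_two_eq hn hn'
  have h1 : ∑ x ∈ box K, scalePart K f m n x ^ 2 ≤ e ^ 2 * H := by
    simp only [scalePart, hlog]
    exact sum_avg_sub_condAvg_dyadicDiff_le hk.le hf hn hn' m
  by_cases hc : n + 1 = 2 ^ (k + 1)
  · rw [if_pos hc]
    have hlog' : Nat.log 2 (n + 1) = k + 1 := by rw [hc]; exact Nat.log_pow (by norm_num) _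
    have h2 : ∑ x ∈ box K, scalePart K f m (n + 1) x ^ 2 ≤ e ^ 2 * H' := by
      simp only [scalePart, hlog']
      exact sum_avg_sub_condAvg_dyadicDiff_le hk hf hc.ge
        (by rw [hc]; exact Nat.pow_lt_pow_right (by norm_num) (by omega)) m
    have hpt : ∀ x, |signedSq (scalePart K f m (n + 1) x) - signedSq (scalePart K f m n x)|
        ≤ scalePart K f m (n + 1) x ^ 2 + scalePart K f m n x ^ 2 := by
      intro x
      unfold signedSq
      refine (abs_sub _ _).trans (le_of_eq ?_)
      rw [abs_mul, abs_mul, abs_abs, abs_abs, abs_mul_abs_self, abs_mul_abs_self]; ring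
    calc _ ≤ _ := Finset.sum_le_sum fun x _ => hpt x
      _ ≤ e ^ 2 * H' + e ^ 2 * H := by rw [Finset.sum_add_distrib]; exact add_le_add h2 h1
      _ ≤ e * (4 * (H + H')) := by nlinarith [mul_nonneg he0.le (add_nonneg hH hH')]
      _ ≤ _ := by
        have : 0 ≤ 5 / 2 ^ k * H := by positivity
        gcongr; linarith
  · rw [if_neg hc, add_zero]
    have hlog' : Nat.log 2 (n + 1) = k := log_two_eq (by omega) (by omega)
    have h2 : ∑ x ∈ box K, scalePart K f m (n + 1) x ^ 2 ≤ e ^ 2 * H := by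
      simp only [scalePart, hlog']
      exact sum_avg_sub_condAvg_dyadicDiff_le hk.le hf (by omega) (by omega) m
    have ht : 0 < 2 ^ k * e := by positivity
    have hn2 : (2 : ℝ) ^ k ≤ n := by exact_mod_cast hn
    have h3 := sum_avg_succ_sub_sq_le hn0 (fun x hx => dyadicDiff_notMem hf (k + m) hx)
    have h4 : ∑ x ∈ box K, (scalePart K f m (n + 1) x - scalePart K f m n x) ^ 2
        ≤ 4 / (2 ^ k) ^ 2 * H := by
      simp only [scalePart, hlog, hlog', sub_sub_sub_cancel_right]
      refine h3.trans ?_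
      gcongr
    calc _ ≤ ∑ x ∈ box K, (2 ^ k * e * (scalePart K f m (n + 1) x - scalePart K f m n x) ^ 2
          + (scalePart K f m (n + 1) x ^ 2 + scalePart K f m n x ^ 2) / (2 * (2 ^ k * e))) :=
          Finset.sum_le_sum fun x _ =>
            (abs_signedSq_sub_le _ _).trans (mul_abs_add_le _ _ _ ht)
      _ = 2 ^ k * e * ∑ x ∈ box K, (scalePart K f m (n + 1) x - scalePart K f m n x) ^ 2
          + (∑ x ∈ box K, scalePart K f m (n + 1) x ^ 2 + ∑ x ∈ box K, scalePart K f m n x ^ 2)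
            / (2 * (2 ^ k * e)) := by
          rw [Finset.sum_add_distrib, ← Finset.mul_sum, ← Finset.sum_div, Finset.sum_add_distrib]
      _ ≤ 2 ^ k * e * (4 / (2 ^ k) ^ 2 * H) + (e ^ 2 * H + e ^ 2 * H) / (2 * (2 ^ k * e)) := by
          gcongr
      _ = _ := by field_simp; ring

theorem sum_Ico_two_pow (F : ℕ → ℝ) (K : ℕ) :
    ∑ n ∈ Finset.Ico 1 (2 ^ K), F n
      = ∑ k ∈ Finset.range K, ∑ n ∈ Finset.Ico (2 ^ k) (2 ^ (k + 1)), F n := by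
  induction K with
  | zero => simp
  | succ K ih =>
    rw [Finset.sum_range_succ, ← ih, Finset.sum_Ico_consecutive _ Nat.one_le_two_pow
      (Nat.pow_le_pow_right (by norm_num) K.le_succ)]

theorem sum_range_dyadicDiff_le (K : ℕ) (f : ℤ → ℝ) (m : ℤ) :
    ∑ k ∈ Finset.range K, ∑ x ∈ box K, dyadicDiff K f (k + m) x ^ 2 ≤ ∑ x ∈ box K, f x ^ 2 := by
  have := sum_sum_dyadicDiff_sq_le K f
    ((Finset.range K).map (Nat.castEmbedding.trans (addRightEmbedding m)))
  simpa using this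

theorem sum_truncVar_scalePart_sq_le {ρ : ℝ} (hρ : 2 ≤ ρ) {N K : ℕ} (hN : N < 2 ^ K) {f : ℤ → ℝ}
    (hf : ∀ x, x ∉ box K → f x = 0) (m : ℤ) :
    ∑ x ∈ box K, truncVar ρ N (fun L => scalePart K f m (L + 1) x) ^ 2
      ≤ 104 * (3 / 4) ^ m.natAbs * ∑ x ∈ box K, f x ^ 2 := by
  set F : ℕ → ℝ := fun n => ∑ x ∈ box K,
    |signedSq (scalePart K f m (n + 1) x) - signedSq (scalePart K f m n x)| with hF
  have hF0 : ∀ n, 0 ≤ F n := fun n => Finset.sum_nonneg fun _ _ => abs_nonneg _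
  set H : ℕ → ℝ := fun k => ∑ x ∈ box K, dyadicDiff K f (k + m) x ^ 2 with hH
  set e : ℝ := 4 * (3 / 4) ^ m.natAbs with he
  have he0 : 0 < e := by positivity
  have h1 : ∑ x ∈ box K, truncVar ρ N (fun L => scalePart K f m (L + 1) x) ^ 2
      ≤ 2 * ∑ n ∈ Finset.Ico 1 (2 ^ K), F n := by
    calc _ ≤ ∑ x ∈ box K, 2 * ∑ L ∈ Finset.range N,
          |signedSq (scalePart K f m (L + 1 + 1) x) - signedSq (scalePart K f m (L + 1) x)| :=
          Finset.sum_le_sum fun x _ =>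
            truncVar_sq_le hρ N (fun L => scalePart K f m (L + 1) x)
      _ = 2 * ∑ L ∈ Finset.range N, F (L + 1) := by rw [← Finset.mul_sum, Finset.sum_comm]
      _ = 2 * ∑ n ∈ Finset.Ico 1 (N + 1), F n := by
          rw [Finset.sum_Ico_eq_sum_range]; simp [add_comm]
      _ ≤ _ := by
          gcongr
          exact hN
  have h2 : ∀ k ∈ Finset.range K, ∑ n ∈ Finset.Ico (2 ^ k) (2 ^ (k + 1)), F n
      ≤ e * (9 * H k + 4 * H (k + 1)) := by
    intro k hk
    have hk' := Finset.mem_range.1 hk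
    calc _ ≤ ∑ n ∈ Finset.Ico (2 ^ k) (2 ^ (k + 1)),
          e * (5 / 2 ^ k * H k + if n + 1 = 2 ^ (k + 1) then 4 * (H k + H (k + 1)) else 0) :=
          Finset.sum_le_sum fun n hn => sum_abs_signedSq_scalePart_le hk' hf
            (Finset.mem_Ico.1 hn).1 (Finset.mem_Ico.1 hn).2 m
      _ = e * (5 * H k + 4 * (H k + H (k + 1))) := by
          have hpos := Nat.pos_of_neZero (2 ^ k)
          have hc : ∀ n, (n + 1 = 2 ^ (k + 1)) = (n = 2 ^ (k + 1) - 1) := fun n => by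
            have := Nat.pos_of_neZero (2 ^ (k + 1))
            apply propext; omega
          rw [← Finset.mul_sum, Finset.sum_add_distrib, Finset.sum_const, Nat.card_Ico]
          simp_rw [hc]
          rw [Finset.sum_ite_eq' , if_pos (by rw [Finset.mem_Ico, pow_succ]; omega),
            show 2 ^ (k + 1) - 2 ^ k = 2 ^ k by rw [pow_succ]; omega, nsmul_eq_mul]
          push_cast
          field_simp
      _ = _ := by ring
  have hsum : ∑ k ∈ Finset.range K, H k ≤ ∑ x ∈ box K, f x ^ 2 := sum_range_dyadicDiff_le K f m
  have hsum' : ∑ k ∈ Finset.range K, H (k + 1) ≤ ∑ x ∈ box K, f x ^ 2 := by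
    refine le_trans (le_of_eq ?_) (sum_range_dyadicDiff_le K f (1 + m))
    simp only [hH]
    push_cast
    simp only [add_assoc]
  rw [sum_Ico_two_pow] at h1
  calc _ ≤ _ := h1
    _ ≤ 2 * ∑ k ∈ Finset.range K, e * (9 * H k + 4 * H (k + 1)) := by
        gcongr with k hk
        exact h2 k hk
    _ = 2 * (e * (9 * ∑ k ∈ Finset.range K, H k + 4 * ∑ k ∈ Finset.range K, H (k + 1))) := by
        rw [← Finset.mul_sum, Finset.sum_add_distrib, ← Finset.mul_sum, ← Finset.mul_sum]
    _ ≤ 2 * (e * (9 * ∑ x ∈ box K, f x ^ 2 + 4 * ∑ x ∈ box K, f x ^ 2)) := by gcongr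
    _ = _ := by rw [he]; ring

/-- The `ρ`-variation of the forward averages of `f` of lengths `1, …, N + 1`. -/
noncomputable def avgVar (ρ : ℝ) (N : ℕ) (f : ℤ → ℝ) (x : ℤ) : ℝ :=
  truncVar ρ N (fun L => avg (L + 1) f x)

theorem avgVar_nonneg (ρ : ℝ) (N : ℕ) (f : ℤ → ℝ) (x : ℤ) : 0 ≤ avgVar ρ N f x :=
  truncVar_nonneg _ _ _

/-- The strong-type `(p, p)` estimate for `avgVar`, uniform in the truncation. -/
def StrongType (ρ p : ℝ) : Prop :=
  ∃ C : ℝ, 0 < C ∧ ∀ (N K : ℕ) (f : ℤ → ℝ), (∀ x, x ∉ box K → f x = 0) →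
    ∑ x ∈ box K, avgVar ρ N f x ^ p ≤ C * ∑ x ∈ box K, |f x| ^ p

theorem sum_abs_rpow_box_mono {K K' : ℕ} (h : K ≤ K') {p : ℝ} (hp : 0 < p) {f : ℤ → ℝ}
    (hf : ∀ x, x ∉ box K → f x = 0) :
    ∑ x ∈ box K', |f x| ^ p = ∑ x ∈ box K, |f x| ^ p :=
  (Finset.sum_subset (box_mono h) fun x _ hx => by
    rw [hf x hx, abs_zero, Real.zero_rpow hp.ne']).symm

/-- It is enough to prove a strong-type estimate on boxes that are large compared with the
truncation. -/
theorem StrongType.of_large {ρ p : ℝ} (hp : 0 < p)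
    (h : ∃ C : ℝ, 0 < C ∧ ∀ (N K : ℕ) (f : ℤ → ℝ), N + 1 < 2 ^ K → (∀ x, x ∉ box K → f x = 0) →
      ∑ x ∈ box K, avgVar ρ N f x ^ p ≤ C * ∑ x ∈ box K, |f x| ^ p) : StrongType ρ p := by
  obtain ⟨C, hC, h⟩ := h
  refine ⟨C, hC, fun N K f hf => ?_⟩
  have hK : K ≤ max K (N + 1) := le_max_left _ _
  have hN : N + 1 < 2 ^ max K (N + 1) :=
    Nat.lt_two_pow_self.trans_le (Nat.pow_le_pow_right (by norm_num) (le_max_right _ _))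
  rw [← sum_abs_rpow_box_mono hK hp hf]
  refine le_trans ?_ (h N (max K (N + 1)) f hN fun x hx => hf x fun hx' => hx (box_mono hK hx'))
  exact Finset.sum_le_sum_of_subset_of_nonneg (box_mono hK) fun _ _ _ =>
    Real.rpow_nonneg (avgVar_nonneg _ _ _ _) p

theorem truncVar_zero {ρ : ℝ} (hρ : 2 ≤ ρ) (N : ℕ) : truncVar ρ N (fun _ => 0) = 0 := by
  have h : truncVar ρ N (fun _ => 0) ^ 2 ≤ _ := truncVar_sq_le hρ N _
  simp only [sub_self, abs_zero, Finset.sum_const_zero, mul_zero] at h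
  exact pow_eq_zero_iff (two_ne_zero) |>.1 (le_antisymm h (sq_nonneg _))

theorem truncVar_sum_le {ι : Type*} {ρ : ℝ} (hρ : 2 ≤ ρ) (N : ℕ) (s : Finset ι)
    (a : ι → ℕ → ℝ) :
    truncVar ρ N (fun n => ∑ i ∈ s, a i n) ≤ ∑ i ∈ s, truncVar ρ N (a i) := by
  classical
  induction s using Finset.induction_on with
  | empty => simp [truncVar_zero hρ]
  | insert i s hi ih =>
    simp only [Finset.sum_insert hi]
    exact (truncVar_add_le hρ _ _).trans (add_le_add_right ih _)

theorem exists_sum_pow_natAbs_le {q : ℝ} (hq0 : 0 ≤ q) (hq1 : q < 1) :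
    ∃ S : ℝ, 0 < S ∧ ∀ s : Finset ℤ, ∑ m ∈ s, q ^ m.natAbs ≤ S := by
  have hsum : Summable fun m : ℤ => q ^ m.natAbs := by
    refine Summable.of_nat_of_neg ?_ ?_ <;>
      simpa using summable_geometric_of_lt_one hq0 hq1
  refine ⟨∑' m : ℤ, q ^ m.natAbs + 1, ?_, fun s => ?_⟩
  · have : 0 ≤ ∑' m : ℤ, q ^ m.natAbs := tsum_nonneg fun _ => pow_nonneg hq0 _
    linarith
  · have := hsum.sum_le_tsum s fun _ _ => pow_nonneg hq0 _
    linarith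

theorem avg_eq_condAvg_add_sum_scalePart {K : ℕ} (f : ℤ → ℝ) {n : ℕ}
    (hn : Nat.log 2 n ≤ K) (x : ℤ) :
    avg n f x = condAvg (Nat.log 2 n) f x
      + ∑ m ∈ Finset.Icc (-(K : ℤ)) K, scalePart K f m n x := by
  have hf : f = fun y => ∑ m ∈ Finset.Icc (-(K : ℤ)) K, dyadicDiff K f (Nat.log 2 n + m) y := by
    funext y
    have e := Finset.sum_map (Finset.Icc (-(K : ℤ)) K) (addLeftEmbedding (Nat.log 2 n : ℤ))
      (fun i => dyadicDiff K f i y)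
    simp only [addLeftEmbedding_apply] at e
    rw [← e, sum_dyadicDiff]
    intro i hi
    refine Finset.mem_map.2 ⟨(i : ℤ) - Nat.log 2 n, Finset.mem_Icc.2 ⟨by omega, by omega⟩, ?_⟩
    simp
  unfold scalePart
  rw [Finset.sum_sub_distrib, ← avg_sum, ← condAvg_sum, ← hf]
  ring

theorem strongType_two {ρ : ℝ} (hρ : 2 < ρ) : StrongType ρ 2 := by
  apply StrongType.of_large two_pos
  obtain ⟨C, hC, hlep⟩ := lepingle hρ
  obtain ⟨S₁, hS₁, hs₁⟩ := exists_sum_pow_natAbs_le (q := 7 / 8) (by norm_num) (by norm_num)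
  obtain ⟨S₂, hS₂, hs₂⟩ := exists_sum_pow_natAbs_le (q := 6 / 7) (by norm_num) (by norm_num)
  refine ⟨2 * C + 2 * (S₁ * (104 * S₂)), by positivity, fun N K f hN hf => ?_⟩
  simp only [Real.rpow_two, sq_abs]
  obtain ⟨W, hW, hWsum⟩ := hlep K f
  set A := Finset.Icc (-(K : ℤ)) K
  set v : ℤ → ℤ → ℝ := fun m x => truncVar ρ N (fun L => scalePart K f m (L + 1) x) with hv
  have hlog : ∀ L ≤ N, Nat.log 2 (L + 1) ≤ K := fun L hL => by
    have : Nat.log 2 (L + 1) < K := Nat.log_lt_of_lt_pow (by omega) (by omega)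
    exact this.le
  have h1 : ∀ x ∈ box K, avgVar ρ N f x ≤ W x + ∑ m ∈ A, v m x := by
    intro x hx
    have e1 : avgVar ρ N f x ≤ 1 * truncVar ρ N (fun L => condAvg (Nat.log 2 (L + 1)) f x)
        + 1 * truncVar ρ N (fun L => ∑ m ∈ A, scalePart K f m (L + 1) x) := by
      refine truncVar_le_of_abs_sub_le hρ.le zero_le_one zero_le_one fun m hm n hn => ?_
      rw [avg_eq_condAvg_add_sum_scalePart f (hlog m hm),
        avg_eq_condAvg_add_sum_scalePart f (hlog n hn), add_sub_add_comm, one_mul, one_mul]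
      exact abs_add_le _ _
    have e2 : truncVar ρ N (fun L => condAvg (Nat.log 2 (L + 1)) f x) ≤ W x :=
      truncVar_le (by linarith) fun n t ht htN =>
        hW x hx n (fun i => Nat.log 2 (t i + 1))
          (fun i j hij => Nat.log_mono_right (Nat.add_le_add_right (ht hij) 1))
          fun i => hlog _ (htN i)
    have e3 := truncVar_sum_le hρ.le N A (fun m L => scalePart K f m (L + 1) x)
    linarith
  have h2 : ∀ x, (∑ m ∈ A, v m x) ^ 2 ≤ S₁ * ∑ m ∈ A, (8 / 7) ^ m.natAbs * v m x ^ 2 := by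
    intro x
    have := Finset.sum_sq_le_sum_mul_sum_of_sq_le_mul A (r := fun m => v m x)
      (f := fun m : ℤ => (7 / 8 : ℝ) ^ m.natAbs) (g := fun m => (8 / 7) ^ m.natAbs * v m x ^ 2)
      (fun m _ => by positivity) (fun m _ => by positivity) (fun m _ => by
        rw [← mul_assoc, ← mul_pow]; norm_num)
    refine this.trans (mul_le_mul_of_nonneg_right (hs₁ A) (Finset.sum_nonneg fun m _ => ?_))
    positivity
  have hF : 0 ≤ ∑ x ∈ box K, f x ^ 2 := Finset.sum_nonneg fun _ _ => sq_nonneg _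
  have h3 : ∑ x ∈ box K, ∑ m ∈ A, (8 / 7) ^ m.natAbs * v m x ^ 2
      ≤ 104 * S₂ * ∑ x ∈ box K, f x ^ 2 := by
    rw [Finset.sum_comm]
    calc _ ≤ ∑ m ∈ A, (8 / 7 : ℝ) ^ m.natAbs
          * (104 * (3 / 4) ^ m.natAbs * ∑ x ∈ box K, f x ^ 2) := by
          refine Finset.sum_le_sum fun m _ => ?_
          rw [← Finset.mul_sum]
          exact mul_le_mul_of_nonneg_left
            (sum_truncVar_scalePart_sq_le hρ.le (by omega) hf m) (by positivity)
      _ = 104 * (∑ m ∈ A, (6 / 7 : ℝ) ^ m.natAbs) * ∑ x ∈ box K, f x ^ 2 := by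
          generalize ∑ x ∈ box K, f x ^ 2 = G
          rw [Finset.mul_sum, Finset.sum_mul]
          refine Finset.sum_congr rfl fun m _ => ?_
          rw [show (6 / 7 : ℝ) = 8 / 7 * (3 / 4) by norm_num, mul_pow]; ring
      _ ≤ _ := by gcongr; exact hs₂ A
  calc ∑ x ∈ box K, avgVar ρ N f x ^ 2
      ≤ ∑ x ∈ box K, (2 * W x ^ 2
        + 2 * (S₁ * ∑ m ∈ A, (8 / 7) ^ m.natAbs * v m x ^ 2)) := by
        refine Finset.sum_le_sum fun x hx => ?_
        have e1 := h2 x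
        have e2 : avgVar ρ N f x ^ 2 ≤ (W x + ∑ m ∈ A, v m x) ^ 2 :=
          pow_le_pow_left₀ (avgVar_nonneg _ _ _ _) (h1 x hx) 2
        nlinarith [sq_nonneg (W x - ∑ m ∈ A, v m x)]
    _ = 2 * ∑ x ∈ box K, W x ^ 2
        + 2 * (S₁ * ∑ x ∈ box K, ∑ m ∈ A, (8 / 7) ^ m.natAbs * v m x ^ 2) := by
        rw [Finset.sum_add_distrib, ← Finset.mul_sum, ← Finset.mul_sum, ← Finset.mul_sum]
    _ ≤ 2 * (C * ∑ x ∈ box K, f x ^ 2)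
        + 2 * (S₁ * (104 * S₂ * ∑ x ∈ box K, f x ^ 2)) := by gcongr
    _ = _ := by ring

theorem sum_inv_sq_tail_le {m : ℕ} (hm : m ≠ 0) (N : ℕ) :
    ∑ L ∈ Finset.range N, (if m ≤ L + 1 then 1 / ((L : ℝ) + 1) ^ 2 else (0 : ℝ)) ≤ 2 / (m : ℝ) := by
  have hm1 : (1 : ℝ) ≤ m := by exact_mod_cast Nat.one_le_iff_ne_zero.2 hm
  have hm' : (0 : ℝ) < m := by positivity
  have key : ∀ N : ℕ, ∑ L ∈ Finset.range N, (if m ≤ L + 1 then 1 / ((L : ℝ) + 1) ^ 2 else (0 : ℝ))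
      ≤ if m ≤ N then 2 / m - 1 / (N : ℝ) else 0 := by
    intro N
    induction N with
    | zero => simp [hm]
    | succ N ih =>
      rw [Finset.sum_range_succ]
      by_cases h : m ≤ N
      · rw [if_pos h] at ih
        rw [if_pos (by omega), if_pos (by omega)]
        have hN : (0 : ℝ) < N := by
          have : 0 < N := by omega
          exact_mod_cast this
        have : 1 / ((N : ℝ) + 1) ^ 2 ≤ 1 / N - 1 / ((N : ℝ) + 1) := by
          rw [div_sub_div _ _ hN.ne' (by positivity), div_le_div_iff₀ (by positivity)
            (by positivity)]
          nlinarith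
        push_cast
        linarith
      · rw [if_neg h] at ih
        by_cases h' : m ≤ N + 1
        · rw [if_pos h', if_pos h']
          have e : (m : ℝ) = N + 1 := by
            have : m = N + 1 := by omega
            exact_mod_cast this
          push_cast
          rw [← e]
          have : 1 / (m : ℝ) ^ 2 ≤ 1 / m := by
            rw [div_le_div_iff₀ (by positivity) hm']; nlinarith
          have e2 : 2 / (m : ℝ) - 1 / m = 1 / m := by ring
          linarith
        · rw [if_neg h', if_neg h']; simpa using ih
  refine (key N).trans ?_
  split_ifs with h
  · have : (0 : ℝ) ≤ 1 / N := by positivity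
    linarith
  · positivity

theorem leftSum_eq_zero_of_ne {j : ℕ} (h : ℤ → ℝ) {y : ℤ} (hy : y ∉ dyadic j (y + 1)) :
    leftSum j h (y + 1) = 0 := by
  rw [mem_dyadic] at hy
  have h1 : y + 1 ≤ (y + 1) / 2 ^ j * 2 ^ j := by
    have h2 : y / 2 ^ j < (y + 1) / 2 ^ j :=
      lt_of_le_of_ne (Int.ediv_le_ediv (by positivity) (by omega)) hy
    have h3 := lt_ediv_mul_add j y
    have h4 : (y / 2 ^ j + 1) * 2 ^ j ≤ (y + 1) / 2 ^ j * 2 ^ j :=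
      mul_le_mul_of_nonneg_right h2 (by positivity)
    rw [add_mul, one_mul] at h4
    omega
  rw [leftSum, Finset.Ico_eq_empty (by omega), Finset.sum_empty]

theorem abs_leftSum_le (j : ℕ) (h : ℤ → ℝ) (y : ℤ) :
    |leftSum j h y| ≤ 2 ^ j * condAvg j (fun z => |h z|) y := by
  rw [condAvg, mul_div_cancel₀ _ (by positivity), leftSum]
  refine (Finset.abs_sum_le_sum_abs _ _).trans
    (Finset.sum_le_sum_of_subset_of_nonneg (fun z hz => ?_) fun _ _ _ => abs_nonneg _)
  rw [Finset.mem_Ico] at hz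
  rw [mem_dyadic]
  have h3 := lt_ediv_mul_add j y
  refine le_antisymm (Int.ediv_le_ediv (by positivity) (by omega)) ?_
  exact (Int.le_ediv_iff_mul_le (by positivity)).2 hz.1

/-- A finite set of integers partitioned into dyadic intervals, `k x` being the scale of the
interval containing `x`. -/
def DyadicPartition (s : Finset ℤ) (k : ℤ → ℕ) : Prop :=
  ∀ x ∈ s, ∀ y ∈ dyadic (k x) x, y ∈ s ∧ k y = k x

namespace DyadicPartition

variable {s : Finset ℤ} {k : ℤ → ℕ}

theorem sum_condAvg (h : DyadicPartition s k) (f : ℤ → ℝ) :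
    ∑ x ∈ s, condAvg (k x) f x = ∑ x ∈ s, f x := by
  classical
  rw [← Finset.sum_fiberwise_of_maps_to (t := s.image k) (g := k)
      (fun x hx => Finset.mem_image_of_mem k hx),
    ← Finset.sum_fiberwise_of_maps_to (t := s.image k) (g := k)
      (fun x hx => Finset.mem_image_of_mem k hx) f]
  refine Finset.sum_congr rfl fun j _ => ?_
  have hcl : DyadicClosed j (s.filter (fun x : ℤ => k x = j)) := by
    intro x hx y hy
    rw [Finset.mem_filter] at hx ⊢
    rw [← hx.2] at hy
    have := h x hx.1 y hy
    exact ⟨this.1, this.2.trans hx.2⟩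
  rw [← _root_.sum_condAvg hcl f]
  refine Finset.sum_congr rfl fun x hx => ?_
  rw [(Finset.mem_filter.1 hx).2]

open Classical in
/-- The sum of `b` over the part to the left of `y` of the partition interval containing `y`. -/
noncomputable def partSum (s : Finset ℤ) (k : ℤ → ℕ) (b : ℤ → ℝ) (y : ℤ) : ℝ :=
  if y ∈ s then leftSum (k y) b y else 0

theorem partSum_succ (h : DyadicPartition s k) {b : ℤ → ℝ} (hb : ∀ x, x ∉ s → b x = 0)
    (hb0 : ∀ x ∈ s, condAvg (k x) b x = 0) (y : ℤ) :
    partSum s k b (y + 1) = partSum s k b y + b y := by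
  have key : y ∉ dyadic (k (y + 1)) (y + 1) → partSum s k b (y + 1) = 0 := fun hy => by
    unfold partSum
    split_ifs
    · exact leftSum_eq_zero_of_ne b hy
    · rfl
  by_cases hy : y ∈ s
  · have e : partSum s k b y + b y = leftSum (k y) b (y + 1) := by
      rw [partSum, if_pos hy, leftSum_succ y (hb0 y hy)]
    rw [e]
    by_cases hy1 : y + 1 ∈ dyadic (k y) y
    · obtain ⟨h1, h2⟩ := h y hy _ hy1
      rw [partSum, if_pos h1, h2]
    · have hy2 : y ∉ dyadic (k y) (y + 1) := fun h' => hy1 (mem_dyadic.2 (mem_dyadic.1 h').symm)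
      rw [leftSum_eq_zero_of_ne b hy2]
      by_cases h1 : y + 1 ∈ s
      · refine key fun h' => hy2 ?_
        rwa [(h _ h1 _ h').2]
      · rw [partSum, if_neg h1]
  · rw [hb y hy, partSum.eq_1 s k b y, if_neg hy, add_zero]
    by_cases h1 : y + 1 ∈ s
    · exact key fun h' => hy (h _ h1 _ h').1
    · rw [partSum, if_neg h1]

theorem avg_eq_partSum (h : DyadicPartition s k) {b : ℤ → ℝ} (hb : ∀ x, x ∉ s → b x = 0)
    (hb0 : ∀ x ∈ s, condAvg (k x) b x = 0) (n : ℕ) {x : ℤ} (hx : x ∉ s) :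
    avg n b x = partSum s k b (x + n) / n := by
  have : ∀ n : ℕ, ∑ l ∈ Finset.range n, b (x + l) = partSum s k b (x + n) := by
    intro n
    induction n with
    | zero => simp [partSum, hx]
    | succ n ih =>
      rw [Finset.sum_range_succ, ih, Nat.cast_succ, ← add_assoc, h.partSum_succ hb hb0]
  rw [avg, this]

/-- The enlargement of `s` by the left neighbours of the intervals of the partition. -/
noncomputable def enlarge (s : Finset ℤ) (k : ℤ → ℕ) : Finset ℤ :=
  s ∪ s.image (fun z => z - 2 ^ k z)

theorem card_enlarge_le (s : Finset ℤ) (k : ℤ → ℕ) : (enlarge s k).card ≤ 2 * s.card := by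
  refine (Finset.card_union_le _ _).trans ?_
  have := Finset.card_image_le (s := s) (f := fun z : ℤ => z - 2 ^ k z)
  omega

theorem two_pow_le (h : DyadicPartition s k) {x : ℤ} (hx : x ∉ enlarge s k) {n : ℕ}
    (hn : x + n ∈ s) : 2 ^ k (x + n) ≤ n := by
  rw [enlarge, Finset.mem_union, not_or] at hx
  by_contra hlt
  set y := x + (n : ℤ) with hy
  set j := k y with hj
  have hlt' : (n : ℤ) < 2 ^ j := by exact_mod_cast not_le.1 hlt
  have h1 := ediv_mul_le_self j y
  have h2 := lt_ediv_mul_add j y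
  have hxa : x < y / 2 ^ j * 2 ^ j := by
    by_contra hge
    refine hx.1 (h y hn x (mem_dyadic.2 ?_)).1
    refine le_antisymm (Int.ediv_le_ediv (by positivity) (by omega)) ?_
    exact (Int.le_ediv_iff_mul_le (by positivity)).2 (not_lt.1 hge)
  have hz : x + 2 ^ j ∈ dyadic j y := by
    refine mem_dyadic.2 (le_antisymm ?_ (Int.ediv_le_ediv (by positivity) (by omega)))
    exact Int.lt_add_one_iff.1 ((Int.ediv_lt_iff_lt_mul (by positivity)).2
      (by rw [add_mul, one_mul]; omega))
  obtain ⟨h3, h4⟩ := h y hn _ hz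
  refine hx.2 (Finset.mem_image.2 ⟨_, h3, ?_⟩)
  rw [h4]; ring

theorem sum_avgVar_sq_le {ρ : ℝ} (hρ : 2 ≤ ρ) (h : DyadicPartition s k) {b : ℤ → ℝ}
    (hb : ∀ x, x ∉ s → b x = 0) (hb0 : ∀ x ∈ s, condAvg (k x) b x = 0) {A : ℝ}
    (hA : ∀ x ∈ s, condAvg (k x) (fun y => |b y|) x ≤ A) (F : Finset ℤ)
    (hF : ∀ x ∈ F, x ∉ enlarge s k) (N : ℕ) :
    ∑ x ∈ F, avgVar ρ N b x ^ 2 ≤ 32 * (A ^ 2 * s.card) := by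
  classical
  set H : ℕ → ℤ → ℝ := fun n y => if y ∈ s then
    (if 2 ^ k y ≤ n then 4 * (2 ^ k y * A * (|b y| + A)) * (1 / (n : ℝ) ^ 2) else 0) else 0 with hH
  have hA0 : ∀ x ∈ s, 0 ≤ A := fun x hx =>
    (condAvg_nonneg (fun y => abs_nonneg (b y)) x).trans (hA x hx)
  have hH0 : ∀ n y, 0 ≤ H n y := by
    intro n y
    simp only [hH]
    split_ifs with h1
    · have := hA0 y h1
      positivity
    · rfl
    · rfl
  have hpt : ∀ x ∈ F, ∀ L : ℕ, |signedSq (avg (L + 1 + 1) b x) - signedSq (avg (L + 1) b x)|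
      ≤ H (L + 1) (x + (L + 1 : ℕ)) := by
    intro x hx L
    have hxs : x ∉ s := fun h' => hF x hx (Finset.mem_union_left _ h')
    set n := L + 1
    have hn1 : (1 : ℝ) ≤ n := by exact_mod_cast (by omega : 1 ≤ n)
    have hd := avg_succ_sub (n := n) (by omega) b x
    have he := h.avg_eq_partSum hb hb0 n hxs
    refine (abs_signedSq_sub_le _ _).trans ?_
    simp only [hH]
    by_cases hy : x + (n : ℤ) ∈ s
    · have hk := h.two_pow_le (hF x hx) hy
      rw [if_pos hy, if_pos hk]
      have hkn : (2 : ℝ) ^ k (x + n) ≤ n := by exact_mod_cast hk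
      set y := x + (n : ℤ)
      set β : ℝ := 2 ^ k y * A
      have hA' := hA0 y hy
      have hβ0 : 0 ≤ β := by positivity
      have hcb : (2 : ℝ) ^ k y * condAvg (k y) (fun z => |b z|) y ≤ β := by
        exact mul_le_mul_of_nonneg_left (hA y hy) (by positivity)
      have hω : |avg n b x| ≤ β / n := by
        rw [he, abs_div, Nat.abs_cast, partSum, if_pos hy]
        gcongr
        exact (abs_leftSum_le _ _ _).trans hcb
      have hbβ : |b y| ≤ β := by
        refine le_trans ?_ hcb
        rw [condAvg, mul_div_cancel₀ _ (by positivity)]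
        exact Finset.single_le_sum (f := fun z => |b z|) (fun _ _ => abs_nonneg _)
          (self_mem_dyadic (k y) y)
      have hβA : β / n ≤ A := by
        rw [div_le_iff₀ (by positivity), mul_comm A]
        exact mul_le_mul_of_nonneg_right hkn hA'
      have hΔ : |avg (n + 1) b x - avg n b x| ≤ (|b y| + A) / n := by
        rw [hd, abs_div, abs_of_pos (by positivity : (0 : ℝ) < n + 1)]
        refine div_le_div₀ (by positivity) ?_ (by positivity) (by linarith)
        exact (abs_sub _ _).trans (by linarith)
      have hω2 : |avg (n + 1) b x| + |avg n b x| ≤ 4 * β / n := by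
        have h1 : |avg (n + 1) b x| ≤ |avg (n + 1) b x - avg n b x| + |avg n b x| := by
          simpa using abs_add_le (avg (n + 1) b x - avg n b x) (avg n b x)
        have h2 : |avg (n + 1) b x - avg n b x| ≤ (β + β) / n := by
          rw [hd, abs_div, abs_of_pos (by positivity : (0 : ℝ) < n + 1)]
          refine div_le_div₀ (by positivity) ?_ (by positivity) (by linarith)
          have h3 : β / n ≤ β := div_le_self hβ0 hn1
          exact (abs_sub _ _).trans (by linarith)
        have h3 : 4 * β / n = (β + β) / n + β / n + β / n := by ring
        linarith
      calc _ ≤ (|b y| + A) / n * (4 * β / n) := by gcongr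
        _ = _ := by field_simp
    · have h0 : avg n b x = 0 := by rw [he, partSum, if_neg hy, zero_div]
      have h1 : avg (n + 1) b x - avg n b x = 0 := by rw [hd, h0, hb _ hy]; simp
      rw [h1, if_neg hy]; simp
  have hsum : ∀ y ∈ s, ∑ L ∈ Finset.range N, H (L + 1) y ≤ 8 * (A * (|b y| + A)) := by
    intro y hy
    have hA' := hA0 y hy
    have e : ∑ L ∈ Finset.range N, H (L + 1) y = 4 * (2 ^ k y * A * (|b y| + A))
        * ∑ L ∈ Finset.range N, (if 2 ^ k y ≤ L + 1 then 1 / ((L : ℝ) + 1) ^ 2 else (0 : ℝ)) := by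
      rw [Finset.mul_sum]
      refine Finset.sum_congr rfl fun L _ => ?_
      simp only [hH, if_pos hy, mul_ite, mul_zero, Nat.cast_add, Nat.cast_one]
    rw [e]
    calc _ ≤ 4 * (2 ^ k y * A * (|b y| + A)) * (2 / (2 ^ k y : ℕ)) :=
          mul_le_mul_of_nonneg_left (sum_inv_sq_tail_le (by positivity) N) (by positivity)
      _ = _ := by push_cast; field_simp; ring
  calc ∑ x ∈ F, avgVar ρ N b x ^ 2
      ≤ ∑ x ∈ F, 2 * ∑ L ∈ Finset.range N, H (L + 1) (x + (L + 1 : ℕ)) := by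
        refine Finset.sum_le_sum fun x hx => ?_
        refine (truncVar_sq_le hρ N (fun L => avg (L + 1) b x)).trans ?_
        gcongr with L _
        exact hpt x hx L
    _ = 2 * ∑ L ∈ Finset.range N, ∑ x ∈ F, H (L + 1) (x + (L + 1 : ℕ)) := by
        rw [← Finset.mul_sum, Finset.sum_comm]
    _ ≤ 2 * ∑ L ∈ Finset.range N, ∑ y ∈ s, H (L + 1) y := by
        gcongr with L _
        exact sum_shift_le F s (hH0 _) (fun x hx => by simp only [hH, if_neg hx]) _
    _ = 2 * ∑ y ∈ s, ∑ L ∈ Finset.range N, H (L + 1) y := by rw [Finset.sum_comm]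
    _ ≤ 2 * ∑ y ∈ s, 8 * (A * (|b y| + A)) := by gcongr with y hy; exact hsum y hy
    _ = 16 * (A * (∑ y ∈ s, |b y| + s.card * A)) := by
        rw [← Finset.mul_sum, ← Finset.mul_sum, Finset.sum_add_distrib, Finset.sum_const,
          nsmul_eq_mul]
        ring
    _ ≤ 16 * (A * (s.card * A + s.card * A)) := by
        rcases s.eq_empty_or_nonempty with rfl | ⟨x, hx⟩
        · simp
        have hA' := hA0 x hx
        gcongr
        rw [← h.sum_condAvg fun y => |b y|, ← nsmul_eq_mul]
        exact Finset.sum_le_card_nsmul _ _ _ hA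
    _ = _ := by ring

end DyadicPartition

/-- The dyadic maximal function of `|f|` over the scales `0, …, K`. -/
noncomputable def dyadicMax (K : ℕ) (f : ℤ → ℝ) (x : ℤ) : ℝ :=
  partialSups (fun s => dyadicMart K (fun y => |f y|) s x) K

theorem condAvg_abs_le_dyadicMax {k K : ℕ} (hk : k ≤ K) (f : ℤ → ℝ) (x : ℤ) :
    condAvg k (fun y => |f y|) x ≤ dyadicMax K f x := by
  have h : dyadicMart K (fun y => |f y|) (K - k) x ≤ dyadicMax K f x :=
    le_partialSups_of_le (fun s => dyadicMart K (fun y => |f y|) s x) (Nat.sub_le K k)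
  rwa [dyadicMart, Nat.sub_sub_self hk] at h

theorem abs_le_dyadicMax (K : ℕ) (f : ℤ → ℝ) (x : ℤ) : |f x| ≤ dyadicMax K f x := by
  simpa only [condAvg_zero] using condAvg_abs_le_dyadicMax (Nat.zero_le K) f x

theorem dyadicMax_nonneg (K : ℕ) (f : ℤ → ℝ) (x : ℤ) : 0 ≤ dyadicMax K f x :=
  (abs_nonneg _).trans (abs_le_dyadicMax K f x)

open Classical in
/-- The Calderón–Zygmund exceptional set of `f` at height `lam`. -/
noncomputable def badSet (K : ℕ) (f : ℤ → ℝ) (lam : ℝ) : Finset ℤ :=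
  (box K).filter fun x : ℤ => ∃ k ≤ K, lam < condAvg k (fun y => |f y|) x

open Classical in
/-- The largest scale `k ≤ K` at which the average of `|f|` around `x` exceeds `lam`. -/
noncomputable def stopScale (K : ℕ) (f : ℤ → ℝ) (lam : ℝ) (x : ℤ) : ℕ :=
  Nat.findGreatest (fun k => lam < condAvg k (fun y => |f y|) x) K

section CalderonZygmund

variable {K : ℕ} {f : ℤ → ℝ} {lam : ℝ} {x : ℤ}

theorem lt_dyadicMax_of_mem_badSet (hx : x ∈ badSet K f lam) : lam < dyadicMax K f x := by
  obtain ⟨k, hk, h⟩ := (Finset.mem_filter.1 hx).2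
  exact h.trans_le (condAvg_abs_le_dyadicMax hk f x)

theorem lt_condAvg_stopScale (hx : x ∈ badSet K f lam) :
    lam < condAvg (stopScale K f lam x) (fun y => |f y|) x := by
  classical
  obtain ⟨k, hk, h⟩ := (Finset.mem_filter.1 hx).2
  exact Nat.findGreatest_spec (P := fun k => lam < condAvg k (fun y => |f y|) x) hk h

theorem stopScale_le (K : ℕ) (f : ℤ → ℝ) (lam : ℝ) (x : ℤ) : stopScale K f lam x ≤ K := by
  classical
  exact Nat.findGreatest_le K

theorem condAvg_le_of_stopScale_lt {k : ℕ} (h : stopScale K f lam x < k) (hk : k ≤ K) :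
    condAvg k (fun y => |f y|) x ≤ lam := by
  classical
  exact not_lt.1 (Nat.findGreatest_is_greatest h hk)

theorem dyadicPartition_badSet (K : ℕ) (f : ℤ → ℝ) (lam : ℝ) :
    DyadicPartition (badSet K f lam) (stopScale K f lam) := by
  intro x hx y hy
  have hxy := mem_dyadic.1 hy
  have hle := stopScale_le K f lam x
  have h1 : lam < condAvg (stopScale K f lam x) (fun y => |f y|) y := by
    rw [dyadicConst_condAvg _ _ hxy]; exact lt_condAvg_stopScale hx
  have hyb : y ∈ badSet K f lam := by
    refine Finset.mem_filter.2 ⟨?_, _, hle, h1⟩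
    exact (dyadicClosed_box K).mono hle x (Finset.mem_filter.1 hx).1 hy
  refine ⟨hyb, le_antisymm ?_ ?_⟩
  · by_contra hlt
    have h2 := condAvg_le_of_stopScale_lt (not_le.1 hlt) (stopScale_le K f lam y)
    rw [← dyadicConst_condAvg _ _ (ediv_two_pow_congr (not_le.1 hlt).le hxy)] at h2
    exact absurd (lt_condAvg_stopScale hyb) (not_lt.2 h2)
  · by_contra hlt
    exact absurd h1 (not_lt.2 (condAvg_le_of_stopScale_lt (not_le.1 hlt) hle))

theorem condAvg_stopScale_le (htop : ∀ x ∈ box K, condAvg K (fun y => |f y|) x ≤ lam)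
    (hx : x ∈ badSet K f lam) : condAvg (stopScale K f lam x) (fun y => |f y|) x ≤ 2 * lam := by
  have hlt : stopScale K f lam x < K := by
    refine lt_of_le_of_ne (stopScale_le K f lam x) fun h => ?_
    have := lt_condAvg_stopScale hx
    rw [h] at this
    exact absurd this (not_lt.2 (htop x (Finset.mem_filter.1 hx).1))
  have h1 := condAvg_le_two_mul (k := stopScale K f lam x) (fun y => abs_nonneg (f y)) x
  have h2 := condAvg_le_of_stopScale_lt (Nat.lt_succ_self (stopScale K f lam x)) hlt
  linarith

open Classical in
/-- The good part of the Calderón–Zygmund decomposition of `f` at height `lam`. -/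
noncomputable def goodPart (K : ℕ) (f : ℤ → ℝ) (lam : ℝ) (x : ℤ) : ℝ :=
  if x ∈ badSet K f lam then condAvg (stopScale K f lam x) f x else f x

theorem abs_goodPart_le (htop : ∀ x ∈ box K, condAvg K (fun y => |f y|) x ≤ lam)
    (hx : x ∈ box K) :
    |goodPart K f lam x| ≤ 2 * min (dyadicMax K f x) lam := by
  unfold goodPart
  split_ifs with h
  · rw [min_eq_right (lt_dyadicMax_of_mem_badSet h).le]
    exact (abs_condAvg_le _ _ _).trans (condAvg_stopScale_le htop h)
  · have h1 := abs_le_dyadicMax K f x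
    have h2 : |f x| ≤ lam := by
      by_contra hlt
      exact h (Finset.mem_filter.2 ⟨hx, 0, Nat.zero_le _, by
        rw [condAvg_zero]; exact not_le.1 hlt⟩)
    have := le_min h1 h2
    have := abs_nonneg (f x)
    linarith

theorem condAvg_badPart (hx : x ∈ badSet K f lam) :
    condAvg (stopScale K f lam x) (fun y => f y - goodPart K f lam y) x = 0 := by
  have h : condAvg (stopScale K f lam x) (goodPart K f lam) x
      = condAvg (stopScale K f lam x) f x := by
    set k := stopScale K f lam x
    have : ∀ y ∈ dyadic k x, goodPart K f lam y = condAvg k f x := by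
      intro y hy
      obtain ⟨h1, h2⟩ := dyadicPartition_badSet K f lam x hx y hy
      rw [goodPart, if_pos h1, h2]
      exact dyadicConst_condAvg k f (mem_dyadic.1 hy)
    rw [condAvg, Finset.sum_congr rfl this, Finset.sum_const, card_dyadic, nsmul_eq_mul]
    push_cast
    field_simp
  rw [condAvg_sub, h, sub_self]

theorem condAvg_abs_badPart_le (htop : ∀ x ∈ box K, condAvg K (fun y => |f y|) x ≤ lam)
    (hx : x ∈ badSet K f lam) :
    condAvg (stopScale K f lam x) (fun y => |f y - goodPart K f lam y|) x ≤ 4 * lam := by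
  have h1 := condAvg_stopScale_le htop hx
  set k := stopScale K f lam x with hk
  have : condAvg k (fun y => |f y - goodPart K f lam y|) x
      ≤ condAvg k (fun y => |f y| + 2 * lam) x := by
    refine condAvg_mono fun y hy => (abs_sub _ _).trans (add_le_add_right ?_ _)
    obtain ⟨h2, h3⟩ := dyadicPartition_badSet K f lam x hx y hy
    rw [goodPart, if_pos h2, h3, ← hk, dyadicConst_condAvg k f (mem_dyadic.1 hy)]
    exact (abs_condAvg_le _ _ _).trans h1
  rw [condAvg_add, condAvg_const] at this
  linarith

end CalderonZygmund

theorem exists_weakType {ρ : ℝ} (hρ : 2 < ρ) : ∃ C : ℝ, 0 < C ∧ ∀ (N K : ℕ) (f : ℤ → ℝ),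
    (∀ x, x ∉ box K → f x = 0) → ∀ lam : ℝ, 0 < lam →
      lam ^ 2 * ((box K).filter (fun x : ℤ => 2 * lam < avgVar ρ N f x)).card
        ≤ C * ∑ x ∈ box K, min (dyadicMax K f x) lam ^ 2 := by
  classical
  obtain ⟨C, hC, h2⟩ := strongType_two hρ
  refine ⟨4 * C + 514, by positivity, fun N K f hf lam hlam => ?_⟩
  set Φ := ∑ x ∈ box K, min (dyadicMax K f x) lam ^ 2 with hΦ
  have hΦ0 : 0 ≤ Φ := Finset.sum_nonneg fun _ _ => sq_nonneg _
  have hsub : ∀ s ⊆ box K, (∀ x ∈ s, lam < dyadicMax K f x) → lam ^ 2 * s.card ≤ Φ := by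
    intro s hs h
    calc lam ^ 2 * s.card = ∑ x ∈ s, min (dyadicMax K f x) lam ^ 2 := by
          rw [Finset.sum_congr rfl fun x hx => by rw [min_eq_right (h x hx).le],
            Finset.sum_const, nsmul_eq_mul, mul_comm]
      _ ≤ Φ := Finset.sum_le_sum_of_subset_of_nonneg hs fun _ _ _ => sq_nonneg _
  by_cases htop : ∀ x ∈ box K, condAvg K (fun y => |f y|) x ≤ lam
  swap
  · push Not at htop
    obtain ⟨x, hx, hlt⟩ := htop
    have h1 := hsub (dyadic K x) (dyadicClosed_box K x hx) fun y hy => by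
      refine lt_of_lt_of_le ?_ (condAvg_abs_le_dyadicMax le_rfl f y)
      rwa [dyadicConst_condAvg K _ (mem_dyadic.1 hy)]
    rw [card_dyadic] at h1
    have h3 : (((box K).filter (fun x : ℤ => 2 * lam < avgVar ρ N f x)).card : ℝ) ≤ 2 * 2 ^ K := by
      have := (Finset.card_filter_le (box K) fun x : ℤ => 2 * lam < avgVar ρ N f x)
      rw [card_box] at this
      exact_mod_cast this
    push_cast at h1
    have := mul_le_mul_of_nonneg_left h3 (sq_nonneg lam)
    nlinarith
  · set Ω := badSet K f lam with hΩ
    set k := stopScale K f lam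
    set g := goodPart K f lam with hg
    set b : ℤ → ℝ := fun y => f y - g y with hb
    have hg0 : ∀ x, x ∉ box K → g x = 0 := fun x hx => by
      have h : x ∉ badSet K f lam := fun h => hx (Finset.mem_filter.1 h).1
      rw [hg, goodPart, if_neg h, hf x hx]
    have hbΩ : ∀ x, x ∉ Ω → b x = 0 := fun x hx => by
      simp only [hb, hg]
      rw [goodPart, if_neg hx, sub_self]
    have hgood : lam ^ 2 * ((box K).filter (fun x : ℤ => lam < avgVar ρ N g x)).card
        ≤ 4 * C * Φ := by
      calc lam ^ 2 * ((box K).filter (fun x : ℤ => lam < avgVar ρ N g x)).card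
          ≤ ∑ x ∈ (box K).filter (fun x : ℤ => lam < avgVar ρ N g x), avgVar ρ N g x ^ 2 := by
            rw [mul_comm, ← nsmul_eq_mul]
            refine Finset.card_nsmul_le_sum _ _ _ fun x hx => ?_
            exact pow_le_pow_left₀ hlam.le (Finset.mem_filter.1 hx).2.le 2
        _ ≤ ∑ x ∈ box K, avgVar ρ N g x ^ 2 :=
            Finset.sum_le_sum_of_subset_of_nonneg (Finset.filter_subset _ _)
              fun _ _ _ => sq_nonneg _
        _ ≤ C * ∑ x ∈ box K, |g x| ^ 2 := by
            simpa only [Real.rpow_two] using h2 N K g hg0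
        _ ≤ C * ∑ x ∈ box K, (2 * min (dyadicMax K f x) lam) ^ 2 := by
            gcongr with x hx
            exact abs_goodPart_le htop hx
        _ = 4 * C * Φ := by
            simp only [mul_pow]
            rw [← Finset.mul_sum]; ring
    have hΩΦ : lam ^ 2 * Ω.card ≤ Φ :=
      hsub Ω (Finset.filter_subset _ _) fun x hx => lt_dyadicMax_of_mem_badSet hx
    set E := DyadicPartition.enlarge Ω k
    set F := (box K).filter (fun x : ℤ => lam < avgVar ρ N b x ∧ x ∉ E)
    have hbad : lam ^ 2 * F.card ≤ 512 * Φ := by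
      calc lam ^ 2 * F.card ≤ ∑ x ∈ F, avgVar ρ N b x ^ 2 := by
            rw [mul_comm, ← nsmul_eq_mul]
            refine Finset.card_nsmul_le_sum _ _ _ fun x hx => ?_
            exact pow_le_pow_left₀ hlam.le (Finset.mem_filter.1 hx).2.1.le 2
        _ ≤ 32 * ((4 * lam) ^ 2 * Ω.card) :=
            (dyadicPartition_badSet K f lam).sum_avgVar_sq_le hρ.le hbΩ
              (fun x hx => condAvg_badPart hx) (fun x hx => condAvg_abs_badPart_le htop hx) F
              (fun x hx => (Finset.mem_filter.1 hx).2.2) N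
        _ = 512 * (lam ^ 2 * Ω.card) := by ring
        _ ≤ _ := by gcongr
    have hE : (E.card : ℝ) ≤ 2 * Ω.card := by
      exact_mod_cast DyadicPartition.card_enlarge_le Ω k
    have hcover : (((box K).filter (fun x : ℤ => 2 * lam < avgVar ρ N f x)).card : ℝ)
        ≤ ((box K).filter (fun x : ℤ => lam < avgVar ρ N g x)).card + (F.card + E.card) := by
      have : (box K).filter (fun x : ℤ => 2 * lam < avgVar ρ N f x)
          ⊆ (box K).filter (fun x : ℤ => lam < avgVar ρ N g x) ∪ (F ∪ E) := by
        intro x hx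
        rw [Finset.mem_filter] at hx
        have h3 : avgVar ρ N f x ≤ avgVar ρ N g x + avgVar ρ N b x := by
          have := truncVar_add_le hρ.le (N := N) (fun L => avg (L + 1) g x)
            (fun L => avg (L + 1) b x)
          simp only [← avg_add] at this
          simpa [hb, avgVar] using this
        simp only [Finset.mem_union, Finset.mem_filter, F]
        by_cases h4 : lam < avgVar ρ N g x
        · exact Or.inl ⟨hx.1, h4⟩
        · by_cases h5 : x ∈ E
          · exact Or.inr (Or.inr h5)
          · exact Or.inr (Or.inl ⟨hx.1, by linarith, h5⟩)
      have h6 := (Finset.card_le_card this).trans ((Finset.card_union_le _ _).trans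
        (Nat.add_le_add_left (Finset.card_union_le F E) _))
      exact_mod_cast h6
    have := mul_le_mul_of_nonneg_left hcover (sq_nonneg lam)
    have := mul_le_mul_of_nonneg_left hE (sq_nonneg lam)
    nlinarith

theorem exists_sum_zpow_min_le {p : ℝ} (hp0 : 0 < p) (hp2 : p < 2) : ∃ C : ℝ, 0 < C ∧
    ∀ (s : Finset ℤ) (t : ℝ), 0 ≤ t →
      ∑ j ∈ s, ((2 : ℝ) ^ j) ^ (p - 2) * min t (2 ^ j) ^ 2 ≤ C * t ^ p := by
  set q : ℝ := max (2 ^ (-p)) (2 ^ (p - 2)) with hq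
  have hq0 : 0 < q := lt_max_of_lt_left (by positivity)
  have hq1 : q < 1 := max_lt (Real.rpow_lt_one_of_one_lt_of_neg one_lt_two (by linarith))
    (Real.rpow_lt_one_of_one_lt_of_neg one_lt_two (by linarith))
  obtain ⟨S, hS, hsum⟩ := exists_sum_pow_natAbs_le hq0.le hq1
  refine ⟨4 * S, by positivity, fun s t ht => ?_⟩
  rcases ht.eq_or_lt with rfl | ht
  · rw [Real.zero_rpow hp0.ne', mul_zero]
    refine (Finset.sum_eq_zero fun j _ => ?_).le
    rw [min_eq_left (by positivity)]; simp
  obtain ⟨j₀, hj₀, hj₁⟩ := exists_mem_Ico_zpow (y := (2 : ℝ)) ht one_lt_two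
  have key : ∀ j : ℤ, ((2 : ℝ) ^ j) ^ (p - 2) * min t (2 ^ j) ^ 2
      ≤ 4 * t ^ p * q ^ (j - j₀).natAbs := by
    intro j
    have hu : (0 : ℝ) < 2 ^ j := by positivity
    rcases le_or_gt j j₀ with h | h
    · obtain ⟨m, hm⟩ : ∃ m : ℕ, j₀ = j + m := ⟨(j₀ - j).toNat, by omega⟩
      have e : (j - j₀).natAbs = m := by omega
      rw [e]
      have h1 : (2 : ℝ) ^ j ≤ t * (2 : ℝ) ^ (-(m : ℝ)) := by
        rw [Real.rpow_neg two_pos.le, Real.rpow_natCast, ← div_eq_mul_inv,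
          le_div_iff₀ (by positivity), ← zpow_natCast, ← zpow_add₀ two_ne_zero, ← hm]
        exact hj₀
      have h2 : (2 : ℝ) ^ (-p) ≤ q := le_max_left _ _
      calc ((2 : ℝ) ^ j) ^ (p - 2) * min t (2 ^ j) ^ 2
          ≤ ((2 : ℝ) ^ j) ^ (p - 2) * (2 ^ j) ^ 2 := by
            gcongr
            exact min_le_right _ _
        _ = ((2 : ℝ) ^ j) ^ p := by
            rw [← Real.rpow_two ((2 : ℝ) ^ j), ← Real.rpow_add hu]; ring_nf
        _ ≤ (t * (2 : ℝ) ^ (-(m : ℝ))) ^ p := by gcongr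
        _ = t ^ p * (2 ^ (-p)) ^ m := by
            rw [Real.mul_rpow ht.le (by positivity), ← Real.rpow_mul two_pos.le,
              ← Real.rpow_natCast, ← Real.rpow_mul two_pos.le]
            ring_nf
        _ ≤ t ^ p * q ^ m := by gcongr
        _ ≤ 4 * t ^ p * q ^ m := by
            have : 0 ≤ t ^ p * q ^ m := by positivity
            linarith
    · obtain ⟨m, hm⟩ : ∃ m : ℕ, j = j₀ + m := ⟨(j - j₀).toNat, by omega⟩
      have e : (j - j₀).natAbs = m := by omega
      rw [e]
      have h1 : t * (2 : ℝ) ^ ((m : ℝ) - 1) ≤ 2 ^ j := by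
        have e2 : (2 : ℝ) ^ ((m : ℝ) - 1) = 2 ^ ((m : ℤ) - 1) := by
          rw [← Real.rpow_intCast]; push_cast; rfl
        rw [e2]
        calc t * 2 ^ ((m : ℤ) - 1) ≤ 2 ^ (j₀ + 1) * 2 ^ ((m : ℤ) - 1) := by gcongr
          _ = 2 ^ j := by rw [← zpow_add₀ two_ne_zero, hm]; ring_nf
      have h2 : (2 : ℝ) ^ (p - 2) ≤ q := le_max_right _ _
      calc ((2 : ℝ) ^ j) ^ (p - 2) * min t (2 ^ j) ^ 2
          ≤ (t * (2 : ℝ) ^ ((m : ℝ) - 1)) ^ (p - 2) * t ^ 2 := by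
            refine mul_le_mul (Real.rpow_le_rpow_of_nonpos (by positivity) h1 (by linarith)) ?_
              (by positivity) (by positivity)
            exact pow_le_pow_left₀ (by positivity) (min_le_left _ _) 2
        _ = t ^ p * (2 ^ (2 - p) * (2 ^ (p - 2)) ^ m) := by
            rw [Real.mul_rpow ht.le (by positivity), ← Real.rpow_mul two_pos.le,
              ← Real.rpow_natCast (2 ^ (p - 2)), ← Real.rpow_mul two_pos.le,
              ← Real.rpow_add two_pos, ← Real.rpow_two t,
              mul_right_comm, ← Real.rpow_add ht]
            ring_nf
        _ ≤ t ^ p * (4 * q ^ m) := by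
            gcongr
            calc (2 : ℝ) ^ (2 - p) ≤ 2 ^ (2 : ℝ) :=
                  Real.rpow_le_rpow_of_exponent_le one_le_two (by linarith)
              _ = 4 := by norm_num
        _ = _ := by ring
  calc _ ≤ ∑ j ∈ s, 4 * t ^ p * q ^ (j - j₀).natAbs := Finset.sum_le_sum fun j _ => key j
    _ = 4 * t ^ p * ∑ m ∈ s.map (Equiv.subRight j₀).toEmbedding, q ^ m.natAbs := by
        rw [Finset.sum_map, Finset.mul_sum]; rfl
    _ ≤ 4 * t ^ p * S := by gcongr; exact hsum _
    _ = _ := by ring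

theorem rpow_le_sum_zpow {p : ℝ} (hp : 0 < p) {M : ℕ} {t : ℝ} (ht : 0 ≤ t) (htM : t ≤ 2 ^ M)
    (htM' : t = 0 ∨ (2 ^ M)⁻¹ < t) :
    t ^ p ≤ 2 ^ p * ∑ j ∈ Finset.Icc (-(M : ℤ)) M, (if 2 ^ j < t then ((2 : ℝ) ^ j) ^ p else 0) := by
  have h0 : ∀ j : ℤ, 0 ≤ (if 2 ^ j < t then ((2 : ℝ) ^ j) ^ p else 0) := fun j => by
    split_ifs <;> positivity
  rcases htM' with rfl | htM'
  · rw [Real.zero_rpow hp.ne']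
    exact mul_nonneg (by positivity) (Finset.sum_nonneg fun j _ => h0 j)
  have ht' : 0 < t := lt_trans (by positivity) htM'
  obtain ⟨j, hj1, hj2⟩ := exists_mem_Ioc_zpow (y := (2 : ℝ)) ht' one_lt_two
  have h1 : j ∈ Finset.Icc (-(M : ℤ)) M := by
    rw [Finset.mem_Icc]
    constructor
    · have : (2 : ℝ) ^ (-(M : ℤ)) < 2 ^ (j + 1) := by
        rw [zpow_neg, zpow_natCast]; exact htM'.trans_le hj2
      have := (zpow_lt_zpow_iff_right₀ (one_lt_two : (1 : ℝ) < 2)).1 this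
      omega
    · have : (2 : ℝ) ^ j < 2 ^ (M : ℤ) := by
        rw [zpow_natCast]; exact hj1.trans_le htM
      exact ((zpow_lt_zpow_iff_right₀ (one_lt_two : (1 : ℝ) < 2)).1 this).le
  have h2 := Finset.single_le_sum (f := fun j : ℤ => if 2 ^ j < t then ((2 : ℝ) ^ j) ^ p else 0)
    (fun j _ => h0 j) h1
  simp only [if_pos hj1] at h2
  calc t ^ p ≤ (2 * 2 ^ j) ^ p := by
        gcongr
        rwa [zpow_add_one₀ two_ne_zero, mul_comm] at hj2
    _ = 2 ^ p * ((2 : ℝ) ^ j) ^ p := Real.mul_rpow (by positivity) (by positivity)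
    _ ≤ _ := by gcongr

theorem exists_pow_bounds (s : Finset ℤ) {u : ℤ → ℝ} (hu : ∀ x, 0 ≤ u x) : ∃ M : ℕ,
    ∀ x ∈ s, u x ≤ 2 ^ M ∧ (u x = 0 ∨ (2 ^ M : ℝ)⁻¹ < u x) := by
  have h : ∀ x, ∀ᶠ M : ℕ in Filter.atTop, u x ≤ 2 ^ M ∧ (u x = 0 ∨ (2 ^ M : ℝ)⁻¹ < u x) := by
    intro x
    have h1 : Filter.Tendsto (fun M : ℕ => (2 : ℝ) ^ M) Filter.atTop Filter.atTop :=
      tendsto_pow_atTop_atTop_of_one_lt one_lt_two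
    refine (h1.eventually_ge_atTop (u x)).and ?_
    rcases (hu x).eq_or_lt with h0 | h0
    · exact Filter.Eventually.of_forall fun _ => Or.inl h0.symm
    · exact (h1.inv_tendsto_atTop.eventually (gt_mem_nhds h0)).mono fun _ h => Or.inr h
  exact ((Filter.eventually_all_finset s).2 fun x _ => h x).exists

theorem strongType_of_lt_two {ρ : ℝ} (hρ : 2 < ρ) {p : ℝ} (hp1 : 1 < p) (hp2 : p < 2) :
    StrongType ρ p := by
  classical
  obtain ⟨C₁, hC₁, hweak⟩ := exists_weakType hρ
  obtain ⟨C₂, hC₂, hlayer⟩ := exists_sum_zpow_min_le (by linarith : 0 < p) hp2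
  obtain ⟨C₃, hC₃, hdoob⟩ := doob_maximal hp1
  have hp0 : 0 < p := by linarith
  refine ⟨2 ^ p * (2 ^ p * (C₁ * (C₂ * C₃))), by positivity, fun N K f hf => ?_⟩
  set u : ℤ → ℝ := fun x => avgVar ρ N f x / 2 with hu
  have hu0 : ∀ x, 0 ≤ u x := fun x => div_nonneg (avgVar_nonneg _ _ _ _) two_pos.le
  obtain ⟨M, hM⟩ := exists_pow_bounds (box K) hu0
  set I := Finset.Icc (-(M : ℤ)) M
  have hlev : ∀ j : ℤ, ∑ x ∈ box K, (if 2 ^ j < u x then ((2 : ℝ) ^ j) ^ p else 0)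
      ≤ C₁ * ∑ x ∈ box K, ((2 : ℝ) ^ j) ^ (p - 2) * min (dyadicMax K f x) (2 ^ j) ^ 2 := by
    intro j
    have hj : (0 : ℝ) < 2 ^ j := by positivity
    have h1 := hweak N K f hf (2 ^ j) hj
    have e : (box K).filter (fun x : ℤ => 2 * 2 ^ j < avgVar ρ N f x)
        = (box K).filter (fun x : ℤ => 2 ^ j < u x) :=
      Finset.filter_congr fun x _ => by
        simp only [hu]; rw [lt_div_iff₀ two_pos, mul_comm]
    rw [e] at h1
    rw [← Finset.sum_filter, Finset.sum_const, nsmul_eq_mul, ← Finset.mul_sum]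
    calc _ = ((2 : ℝ) ^ j) ^ (p - 2) * ((2 ^ j) ^ 2
          * ((box K).filter (fun x : ℤ => 2 ^ j < u x)).card) := by
          rw [← mul_assoc, ← Real.rpow_two, ← Real.rpow_add hj, sub_add_cancel, mul_comm]
      _ ≤ ((2 : ℝ) ^ j) ^ (p - 2)
          * (C₁ * ∑ x ∈ box K, min (dyadicMax K f x) (2 ^ j) ^ 2) := by gcongr
      _ = _ := by ring
  calc ∑ x ∈ box K, avgVar ρ N f x ^ p = 2 ^ p * ∑ x ∈ box K, u x ^ p := by
        rw [Finset.mul_sum]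
        refine Finset.sum_congr rfl fun x _ => ?_
        rw [← Real.mul_rpow two_pos.le (hu0 x)]
        simp only [hu]; congr 1; ring
    _ ≤ 2 ^ p * ∑ x ∈ box K, 2 ^ p * ∑ j ∈ I, (if 2 ^ j < u x then ((2 : ℝ) ^ j) ^ p else 0) := by
        gcongr with x hx
        exact rpow_le_sum_zpow hp0 (hu0 x) (hM x hx).1 (hM x hx).2
    _ = 2 ^ p * (2 ^ p * ∑ j ∈ I, ∑ x ∈ box K,
          (if 2 ^ j < u x then ((2 : ℝ) ^ j) ^ p else 0)) := by
        rw [← Finset.mul_sum, Finset.sum_comm]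
    _ ≤ 2 ^ p * (2 ^ p * ∑ j ∈ I, C₁ * ∑ x ∈ box K,
          ((2 : ℝ) ^ j) ^ (p - 2) * min (dyadicMax K f x) (2 ^ j) ^ 2) := by
        gcongr with j _
        exact hlev j
    _ = 2 ^ p * (2 ^ p * (C₁ * ∑ x ∈ box K, ∑ j ∈ I,
          ((2 : ℝ) ^ j) ^ (p - 2) * min (dyadicMax K f x) (2 ^ j) ^ 2)) := by
        rw [← Finset.mul_sum, Finset.sum_comm]
    _ ≤ 2 ^ p * (2 ^ p * (C₁ * ∑ x ∈ box K, C₂ * dyadicMax K f x ^ p)) := by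
        gcongr with x _
        exact hlayer I _ (dyadicMax_nonneg K f x)
    _ = 2 ^ p * (2 ^ p * (C₁ * (C₂ * ∑ x ∈ box K, dyadicMax K f x ^ p))) := by
        rw [← Finset.mul_sum]
    _ ≤ 2 ^ p * (2 ^ p * (C₁ * (C₂ * (C₃ * ∑ x ∈ box K, |f x| ^ p)))) := by
        gcongr
        exact hdoob K (fun y => |f y|) fun _ => abs_nonneg _
    _ = _ := by ring

theorem sum_range_add_eq_sum_Ico (h : ℤ → ℝ) (x : ℤ) (n : ℕ) :
    ∑ l ∈ Finset.range n, h (x + l) = ∑ y ∈ Finset.Ico x (x + n), h y := by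
  induction n with
  | zero => simp
  | succ n ih =>
    rw [Finset.sum_range_succ, ih, Nat.cast_succ, ← add_assoc, sum_Ico_int_succ h (by omega)]

theorem sum_Ico_div_sq_le {a : ℕ → ℝ} (ha : ∀ n, 0 ≤ a n) {γ : ℝ} (hγ0 : 0 ≤ γ) {m M : ℕ}
    (hm : m ≠ 0)
    (hγ : ∀ n ≤ M, ∑ l ∈ Finset.range n, a l ≤ n * γ) :
    ∑ n ∈ Finset.Ico m M, a n / (n : ℝ) ^ 2 ≤ 3 * γ / m := by
  have hA : ∀ n, 0 ≤ ∑ l ∈ Finset.range n, a l := fun n => Finset.sum_nonneg fun l _ => ha l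
  rcases le_or_gt M m with hMm | hMm
  · rw [Finset.Ico_eq_empty_of_le hMm, Finset.sum_empty]
    positivity
  have key : ∀ n : ℕ, m ≤ n → n ≤ M → ∑ i ∈ Finset.Ico m n, a i / (i : ℝ) ^ 2
      ≤ (∑ l ∈ Finset.range n, a l) / (n : ℝ) ^ 2 + 3 * γ * (1 / m - 1 / n) := by
    intro n hmn
    induction n, hmn using Nat.le_induction with
    | base =>
      intro _
      rw [Finset.Ico_self, Finset.sum_empty, sub_self, mul_zero, add_zero]
      exact div_nonneg (hA m) (sq_nonneg _)
    | succ n hmn ih =>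
      intro hn
      have hn0 : (0 : ℝ) < n := by
        have : 0 < n := by omega
        exact_mod_cast this
      have h2 := hγ (n + 1) hn
      rw [Finset.sum_Ico_succ_top hmn]
      rw [Finset.sum_range_succ] at h2 ⊢
      set A := ∑ l ∈ Finset.range n, a l
      have h1 := ih (by omega)
      push_cast at h2 ⊢
      have h3 : (A + a n) / (n : ℝ) ^ 2 - (A + a n) / ((n : ℝ) + 1) ^ 2
          ≤ 3 * γ * (1 / n - 1 / ((n : ℝ) + 1)) := by
        have e1 : (A + a n) / (n : ℝ) ^ 2 - (A + a n) / ((n : ℝ) + 1) ^ 2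
            = (A + a n) * ((2 * n + 1) / (n ^ 2 * (n + 1) ^ 2)) := by field_simp; ring
        have e2 : 3 * γ * (1 / n - 1 / ((n : ℝ) + 1))
            = ((n + 1) * γ) * (3 * n / (n ^ 2 * (n + 1) ^ 2)) := by field_simp; ring
        rw [e1, e2]
        have h1n : (1 : ℝ) ≤ n := by exact_mod_cast (by omega : 1 ≤ n)
        gcongr
        linarith
      have e3 : a n / (n : ℝ) ^ 2 + A / (n : ℝ) ^ 2 = (A + a n) / (n : ℝ) ^ 2 := by ring
      have e4 : 3 * γ * (1 / (m : ℝ) - 1 / (n + 1))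
          = 3 * γ * (1 / m - 1 / n) + 3 * γ * (1 / n - 1 / ((n : ℝ) + 1)) := by ring
      linarith
  have hM0 : (0 : ℝ) < M := by
    have : 0 < M := by omega
    exact_mod_cast this
  have hm0 : (0 : ℝ) < m := by positivity
  have h1 := key M hMm.le le_rfl
  have h2 : (∑ l ∈ Finset.range M, a l) / (M : ℝ) ^ 2 ≤ γ / M := by
    rw [div_le_div_iff₀ (by positivity) hM0]
    nlinarith [hγ M le_rfl]
  have h3 : 3 * γ * (1 / (m : ℝ) - 1 / M) = 3 * γ / m - 3 * (γ / M) := by ring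
  have h4 : 0 ≤ γ / M := by positivity
  linarith

theorem sum_shift_div_sq_le {h : ℤ → ℝ} {a : ℤ} {m δ d N : ℕ} (hδ : δ ≤ m) (hd : d ≤ δ)
    (hh : ∀ y < a + 2 * m, h y = 0) :
    ∑ n ∈ Finset.Ico 1 N, h (a + n + d) ^ 2 / (n : ℝ) ^ 2
      ≤ ∑ n ∈ Finset.Ico m N, h (a + δ + n) ^ 2 / (n : ℝ) ^ 2 := by
  obtain ⟨e, rfl⟩ := Nat.exists_eq_add_of_le hd
  rcases Nat.eq_zero_or_pos m with rfl | hm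
  · obtain ⟨rfl, rfl⟩ : d = 0 ∧ e = 0 := by omega
    simp only [Nat.cast_zero, add_zero]
    exact Finset.sum_le_sum_of_subset_of_nonneg
      (Finset.Ico_subset_Ico (Nat.zero_le _) le_rfl) fun _ _ _ => by positivity
  calc ∑ n ∈ Finset.Ico 1 N, h (a + n + d) ^ 2 / (n : ℝ) ^ 2
      = ∑ n ∈ Finset.Ico (m + e) N, h (a + n + d) ^ 2 / (n : ℝ) ^ 2 := by
        symm
        refine Finset.sum_subset (Finset.Ico_subset_Ico (by omega) le_rfl) fun n hn hn' => ?_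
        rw [Finset.mem_Ico] at hn hn'
        rw [hh _ (by omega)]; simp
    _ ≤ ∑ n ∈ Finset.Ico (m + e) N,
          h (a + (d + e : ℕ) + (n - e : ℕ)) ^ 2 / ((n - e : ℕ) : ℝ) ^ 2 := by
        refine Finset.sum_le_sum fun n hn => ?_
        rw [Finset.mem_Ico] at hn
        have e1 : a + (d + e : ℕ) + (n - e : ℕ) = a + n + d := by omega
        rw [e1]
        have : (0 : ℝ) < (n - e : ℕ) := by
          have : 0 < n - e := by omega
          exact_mod_cast this
        gcongr
        omega
    _ = ∑ n ∈ (Finset.Ico (m + e) N).image (fun n => n - e),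
          h (a + (d + e : ℕ) + n) ^ 2 / (n : ℝ) ^ 2 := by
        rw [Finset.sum_image]
        intro i hi j hj hij
        simp only [Finset.coe_Ico, Set.mem_Ico] at hi hj hij
        omega
    _ ≤ _ := by
        refine Finset.sum_le_sum_of_subset_of_nonneg ?_ fun _ _ _ => by positivity
        intro n hn
        obtain ⟨i, hi, rfl⟩ := Finset.mem_image.1 hn
        rw [Finset.mem_Ico] at hi ⊢
        omega

theorem avg_sub_avg_eq {h : ℤ → ℝ} {a : ℤ} {δ : ℕ} (hh : ∀ y < a + δ, h y = 0) (n : ℕ) :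
    avg n h (a + δ) - avg n h a = (∑ d ∈ Finset.range δ, h (a + n + d)) / n := by
  unfold avg
  rw [← _root_.sub_div]
  congr 1
  have h1 := Finset.sum_range_add (fun i : ℕ => h (a + i)) δ n
  have h2 := Finset.sum_range_add (fun i : ℕ => h (a + i)) n δ
  have h3 : ∑ d ∈ Finset.range δ, h (a + d) = 0 := Finset.sum_eq_zero fun d hd => by
    rw [Finset.mem_range] at hd
    exact hh _ (by omega)
  rw [add_comm n δ] at h2
  rw [h2, h3, zero_add] at h1
  push_cast at h1
  simp only [← add_assoc] at h1
  linarith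

theorem truncVar_avg_sub_avg_sq_le {ρ : ℝ} (hρ : 2 ≤ ρ) {h : ℤ → ℝ} {a : ℤ} {m δ N : ℕ}
    {γ : ℝ} (hm : m ≠ 0) (hδ : δ ≤ m) (hh : ∀ y < a + 2 * m, h y = 0)
    (hγ : ∀ n ≤ N + 2, ∑ l ∈ Finset.range n, h (a + δ + l) ^ 2 ≤ n * γ) :
    truncVar ρ N (fun L => avg (L + 1) h (a + δ) - avg (L + 1) h a) ^ 2 ≤ 66 * γ := by
  have hm' : (0 : ℝ) < m := by positivity
  set G := ∑ n ∈ Finset.Ico m (N + 2), h (a + δ + n) ^ 2 / (n : ℝ) ^ 2 with hG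
  have hG0 : 0 ≤ G := Finset.sum_nonneg fun _ _ => by positivity
  have hγ0 : 0 ≤ γ := by
    have h1 := hγ 1 (by omega)
    simp only [Finset.sum_range_one, Nat.cast_one, one_mul] at h1
    exact (sq_nonneg _).trans h1
  have hGγ : G ≤ 3 * γ / m :=
    sum_Ico_div_sq_le (fun n => sq_nonneg (h (a + δ + n))) hγ0 hm hγ
  set D : ℕ → ℝ := fun n => avg n h (a + δ) - avg n h a with hD
  set S : ℕ → ℝ := fun n => ∑ d ∈ Finset.range δ, h (a + n + d) ^ 2 with hS
  have hS0 : ∀ n, 0 ≤ S n := fun n => Finset.sum_nonneg fun _ _ => sq_nonneg _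
  have hDS : ∀ n : ℕ, D n ^ 2 ≤ m * (S n / n ^ 2) := by
    intro n
    simp only [hD]
    rw [avg_sub_avg_eq (fun y hy => hh y (by omega)), div_pow, ← mul_div_assoc]
    gcongr
    refine (sq_sum_le_card_mul_sum_sq).trans ?_
    rw [Finset.card_range]
    have : (δ : ℝ) ≤ m := by exact_mod_cast hδ
    exact mul_le_mul_of_nonneg_right this (hS0 n)
  have hDS2 : ∀ n : ℕ, m * D n ^ 2 ≤ S n := by
    intro n
    rcases lt_or_ge n m with hn | hn
    · have h0 : S n = 0 := Finset.sum_eq_zero fun d hd => by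
        rw [Finset.mem_range] at hd
        rw [hh _ (by omega)]; simp
      have h1 := hDS n
      rw [h0, zero_div, mul_zero] at h1
      rw [h0]
      nlinarith
    · have hn' : (m : ℝ) ≤ n := by exact_mod_cast hn
      have hn0 : (0 : ℝ) < n := hm'.trans_le hn'
      calc m * D n ^ 2 ≤ m * (m * (S n / n ^ 2)) := by gcongr; exact hDS n
        _ = S n * ((m : ℝ) ^ 2 / n ^ 2) := by ring
        _ ≤ S n * 1 := by
            gcongr
            exact (div_le_one (by positivity)).2 (by gcongr)
        _ = S n := mul_one _
  have hΔ : ∀ L : ℕ, |signedSq (D (L + 1 + 1)) - signedSq (D (L + 1))|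
      ≤ (3 * m * (h (a + δ + (L + 1 : ℕ)) ^ 2 + h (a + (L + 1 : ℕ)) ^ 2)
          + 4 * S (L + 1)) / ((L + 1 : ℕ) : ℝ) ^ 2
        + S (L + 1 + 1) / ((L + 1 + 1 : ℕ) : ℝ) ^ 2 := by
    intro L
    set n := L + 1
    have hn : (0 : ℝ) < n := by positivity
    have h1 : D (n + 1) - D n = (h (a + δ + n) - h (a + n) - D n) / (n + 1) := by
      have e1 := avg_succ_sub (n := n) (by omega) h (a + δ)
      have e2 := avg_succ_sub (n := n) (by omega) h a
      simp only [hD]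
      rw [sub_sub_sub_comm, e1, e2, ← _root_.sub_div]
      ring
    have h2 : (D (n + 1) - D n) ^ 2
        ≤ 3 * (h (a + δ + n) ^ 2 + h (a + n) ^ 2 + D n ^ 2) / n ^ 2 := by
      rw [h1, div_pow]
      gcongr
      · nlinarith [sq_nonneg (h (a + δ + n) + h (a + n)), sq_nonneg (h (a + δ + n) + D n),
          sq_nonneg (h (a + n) - D n)]
      · linarith
    refine (abs_signedSq_sub_le _ _).trans ((mul_abs_add_le _ _ _ hm').trans ?_)
    have h3 : (m : ℝ) * (D (n + 1) - D n) ^ 2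
        ≤ (3 * m * (h (a + δ + n) ^ 2 + h (a + n) ^ 2) + 3 * S n) / n ^ 2 := by
      calc (m : ℝ) * (D (n + 1) - D n) ^ 2
          ≤ m * (3 * (h (a + δ + n) ^ 2 + h (a + n) ^ 2 + D n ^ 2) / n ^ 2) := by gcongr
        _ = (3 * m * (h (a + δ + n) ^ 2 + h (a + n) ^ 2) + 3 * (m * D n ^ 2)) / n ^ 2 := by ring
        _ ≤ _ := by gcongr; exact hDS2 n
    have h4 : (D (n + 1) ^ 2 + D n ^ 2) / (2 * m)
        ≤ S (n + 1) / ((n + 1 : ℕ) : ℝ) ^ 2 + S n / (n : ℝ) ^ 2 := by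
      have e1 := hDS (n + 1)
      have e2 := hDS n
      have e3 : 0 ≤ S (n + 1) / ((n + 1 : ℕ) : ℝ) ^ 2 := div_nonneg (hS0 _) (sq_nonneg _)
      have e4 : 0 ≤ S n / (n : ℝ) ^ 2 := div_nonneg (hS0 _) (sq_nonneg _)
      rw [div_le_iff₀ (by positivity)]
      nlinarith
    have h5 : (3 * m * (h (a + δ + n) ^ 2 + h (a + n) ^ 2) + 4 * S n) / (n : ℝ) ^ 2
        = (3 * m * (h (a + δ + n) ^ 2 + h (a + n) ^ 2) + 3 * S n) / n ^ 2 + S n / (n : ℝ) ^ 2 := by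
      ring
    rw [h5]
    linarith
  have hT : ∀ d ≤ δ, ∑ n ∈ Finset.Ico 1 (N + 2), h (a + n + d) ^ 2 / (n : ℝ) ^ 2 ≤ G :=
    fun d hd => sum_shift_div_sq_le hδ hd hh
  have hTδ := hT δ le_rfl
  have hT0 := hT 0 (Nat.zero_le _)
  simp only [Nat.cast_zero, add_zero] at hT0
  have hTS : ∑ n ∈ Finset.Ico 1 (N + 2), S n / (n : ℝ) ^ 2 ≤ m * G := by
    simp only [hS, Finset.sum_div]
    rw [Finset.sum_comm]
    calc _ ≤ ∑ d ∈ Finset.range δ, G :=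
          Finset.sum_le_sum fun d hd => hT d (Finset.mem_range.1 hd).le
      _ = δ * G := by rw [Finset.sum_const, Finset.card_range, nsmul_eq_mul]
      _ ≤ m * G := by gcongr
  have hreindex : ∀ u : ℕ → ℝ, (∀ n, 0 ≤ u n) →
      ∑ L ∈ Finset.range N, u (L + 1) ≤ ∑ n ∈ Finset.Ico 1 (N + 2), u n ∧
      ∑ L ∈ Finset.range N, u (L + 1 + 1) ≤ ∑ n ∈ Finset.Ico 1 (N + 2), u n := by
    intro u hu
    constructor
    · rw [Finset.range_eq_Ico, Finset.sum_Ico_add' u 0 N 1]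
      exact Finset.sum_le_sum_of_subset_of_nonneg (Finset.Ico_subset_Ico (by omega) (by omega))
        fun _ _ _ => hu _
    · rw [Finset.range_eq_Ico]
      simp only [add_assoc]
      rw [Finset.sum_Ico_add' u 0 N (1 + 1)]
      exact Finset.sum_le_sum_of_subset_of_nonneg (Finset.Ico_subset_Ico (by omega) (by omega))
        fun _ _ _ => hu _
  have hS0' : ∀ n : ℕ, 0 ≤ S n / (n : ℝ) ^ 2 := fun n => div_nonneg (hS0 n) (sq_nonneg _)
  calc truncVar ρ N (fun L => D (L + 1)) ^ 2
      ≤ 2 * ∑ L ∈ Finset.range N, |signedSq (D (L + 1 + 1)) - signedSq (D (L + 1))| :=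
        truncVar_sq_le hρ N fun L => D (L + 1)
    _ ≤ 2 * (∑ L ∈ Finset.range N,
            (3 * m * (h (a + δ + (L + 1 : ℕ)) ^ 2 + h (a + (L + 1 : ℕ)) ^ 2)
              + 4 * S (L + 1)) / ((L + 1 : ℕ) : ℝ) ^ 2
          + ∑ L ∈ Finset.range N, S (L + 1 + 1) / ((L + 1 + 1 : ℕ) : ℝ) ^ 2) := by
        rw [← Finset.sum_add_distrib]
        gcongr with L _
        exact hΔ L
    _ ≤ 2 * (∑ n ∈ Finset.Ico 1 (N + 2),
            (3 * m * (h (a + δ + n) ^ 2 + h (a + n) ^ 2) + 4 * S n) / (n : ℝ) ^ 2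
          + ∑ n ∈ Finset.Ico 1 (N + 2), S n / (n : ℝ) ^ 2) := by
        have h1 := (hreindex (fun n => (3 * m * (h (a + δ + n) ^ 2 + h (a + n) ^ 2)
          + 4 * S n) / (n : ℝ) ^ 2) fun n => by have := hS0 n; positivity).1
        have h2 := (hreindex (fun n => S n / (n : ℝ) ^ 2) hS0').2
        linarith
    _ = 2 * (3 * m * (∑ n ∈ Finset.Ico 1 (N + 2), h (a + n + δ) ^ 2 / (n : ℝ) ^ 2
            + ∑ n ∈ Finset.Ico 1 (N + 2), h (a + n) ^ 2 / (n : ℝ) ^ 2)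
          + 5 * ∑ n ∈ Finset.Ico 1 (N + 2), S n / (n : ℝ) ^ 2) := by
        simp only [← Finset.sum_add_distrib, Finset.mul_sum]
        refine Finset.sum_congr rfl fun n _ => ?_
        rw [add_right_comm a (δ : ℤ)]
        ring
    _ ≤ 2 * (3 * m * (G + G) + 5 * (m * G)) := by gcongr
    _ = 22 * (m * G) := by ring
    _ ≤ 22 * (m * (3 * γ / m)) := by gcongr
    _ = 66 * γ := by field_simp; ring

theorem exists_subset_box (s : Finset ℤ) : ∃ K, s ⊆ box K := by
  refine ⟨s.sup Int.natAbs, fun y hy => ?_⟩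
  have h1 : y.natAbs ≤ s.sup Int.natAbs := Finset.le_sup (f := Int.natAbs) hy
  have h2 : (y.natAbs : ℤ) < 2 ^ s.sup Int.natAbs := by
    exact_mod_cast h1.trans_lt Nat.lt_two_pow_self
  unfold box
  rw [Finset.mem_Ico]
  omega

/-- A strong-type estimate holds with arbitrary finite sets in place of boxes. -/
theorem sum_avgVar_rpow_le {ρ p C : ℝ} (hp : 0 < p)
    (h : ∀ (N K : ℕ) (f : ℤ → ℝ), (∀ x, x ∉ box K → f x = 0) →
      ∑ x ∈ box K, avgVar ρ N f x ^ p ≤ C * ∑ x ∈ box K, |f x| ^ p)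
    (N : ℕ) (F s : Finset ℤ) {f : ℤ → ℝ} (hf : ∀ x, x ∉ s → f x = 0) :
    ∑ x ∈ F, avgVar ρ N f x ^ p ≤ C * ∑ x ∈ s, |f x| ^ p := by
  classical
  obtain ⟨K, hK⟩ := exists_subset_box (F ∪ s)
  rw [Finset.sum_subset (Finset.subset_union_right.trans hK) fun x _ hx => by
    rw [hf x hx, abs_zero, Real.zero_rpow hp.ne']]
  refine le_trans ?_ (h N K f fun x hx => hf x fun hx' =>
    hx (hK (Finset.mem_union_right _ hx')))
  exact Finset.sum_le_sum_of_subset_of_nonneg (Finset.subset_union_left.trans hK)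
    fun _ _ _ => Real.rpow_nonneg (avgVar_nonneg _ _ _ _) p

/-- The squared norm of `f` over the double of a dyadic interval. -/
theorem sum_sq_double_le {f γ : ℤ → ℝ} {K k : ℕ} (hk : k ≤ K) (hγ0 : ∀ x, f x ^ 2 ≤ γ x)
    (hγ : ∀ x, ∀ n : ℕ, n ≤ 2 ^ (K + 1) → ∑ l ∈ Finset.range n, f (x + l) ^ 2 ≤ n * γ x) (z : ℤ) :
    ∑ y ∈ Finset.Ico (z / 2 ^ k * 2 ^ k) (z / 2 ^ k * 2 ^ k + 2 * 2 ^ k), f y ^ 2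
      ≤ 3 * ∑ x ∈ dyadic k z, γ x := by
  set a : ℤ := z / 2 ^ k * 2 ^ k with ha
  have h2 : (0 : ℤ) < 2 ^ k := by positivity
  have hI : dyadic k z = Finset.Ico a (a + 2 ^ k) := rfl
  have hsplit : ∑ y ∈ Finset.Ico a (a + 2 * 2 ^ k), f y ^ 2
      = ∑ y ∈ Finset.Ico a (a + 2 ^ k), f y ^ 2
        + ∑ y ∈ Finset.Ico (a + 2 ^ k) (a + 2 * 2 ^ k), f y ^ 2 := by
    rw [← Finset.sum_union (Finset.Ico_disjoint_Ico_consecutive _ _ _),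
      Finset.Ico_union_Ico_eq_Ico (by omega) (by omega)]
  set J := ∑ y ∈ Finset.Ico (a + 2 ^ k) (a + 2 * 2 ^ k), f y ^ 2 with hJ
  have hJx : ∀ x ∈ dyadic k z, J ≤ 2 ^ (k + 1) * γ x := fun x hx => by
    rw [hI, Finset.mem_Ico] at hx
    have h := hγ x (2 ^ (k + 1)) (Nat.pow_le_pow_right (by norm_num) (by omega))
    rw [sum_range_add_eq_sum_Ico (fun y => f y ^ 2)] at h
    push_cast at h
    refine le_trans (Finset.sum_le_sum_of_subset_of_nonneg
      (Finset.Ico_subset_Ico hx.2.le ?_) fun _ _ _ => sq_nonneg _) h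
    rw [pow_succ]; omega
  have hJ2 : J ≤ 2 * ∑ x ∈ dyadic k z, γ x := by
    have h := Finset.sum_le_sum hJx
    rw [Finset.sum_const, card_dyadic, nsmul_eq_mul, ← Finset.mul_sum, pow_succ] at h
    push_cast at h
    have h3 : (0 : ℝ) < 2 ^ k := by positivity
    rw [mul_assoc] at h
    exact le_of_mul_le_mul_left h h3
  have h1 : ∑ y ∈ Finset.Ico a (a + 2 ^ k), f y ^ 2 ≤ ∑ x ∈ dyadic k z, γ x := by
    rw [hI]; exact Finset.sum_le_sum fun y _ => hγ0 y
  rw [hsplit]; linarith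

/-- The mean oscillation of `avgVar` over a dyadic interval. -/
theorem exists_sum_sq_avgVar_sub_le {ρ C : ℝ} (hρ : 2 ≤ ρ) (hC : 0 ≤ C)
    (h : ∀ (N K : ℕ) (f : ℤ → ℝ), (∀ x, x ∉ box K → f x = 0) →
      ∑ x ∈ box K, avgVar ρ N f x ^ (2 : ℝ) ≤ C * ∑ x ∈ box K, |f x| ^ (2 : ℝ))
    {N K k : ℕ} {f γ : ℤ → ℝ} (hN : N + 2 ≤ 2 ^ (K + 1)) (hk : k ≤ K) (hγ0 : ∀ x, f x ^ 2 ≤ γ x)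
    (hγ : ∀ x, ∀ n : ℕ, n ≤ 2 ^ (K + 1) → ∑ l ∈ Finset.range n, f (x + l) ^ 2 ≤ n * γ x) (z : ℤ) :
    ∃ c : ℝ, ∑ x ∈ dyadic k z, (avgVar ρ N f x - c) ^ 2
      ≤ (6 * C + 132) * ∑ x ∈ dyadic k z, γ x := by
  classical
  set a : ℤ := z / 2 ^ k * 2 ^ k with ha
  have hI : dyadic k z = Finset.Ico a (a + 2 ^ k) := rfl
  set s := Finset.Ico a (a + 2 * 2 ^ k) with hs
  set f1 : ℤ → ℝ := fun y => if y ∈ s then f y else 0 with hf1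
  set f2 : ℤ → ℝ := fun y => if a + 2 * 2 ^ k ≤ y then f y else 0 with hf2
  have hff : ∀ y, a ≤ y → f y = f1 y + f2 y := fun y hy => by
    simp only [hf1, hf2, hs, Finset.mem_Ico]
    by_cases h1 : y < a + 2 * 2 ^ k
    · rw [if_pos ⟨hy, h1⟩, if_neg (not_le.2 h1), add_zero]
    · rw [if_neg fun h => h1 h.2, if_pos (not_lt.1 h1), zero_add]
  refine ⟨truncVar ρ N (fun L => avg (L + 1) f2 a), ?_⟩
  have hpt : ∀ x ∈ dyadic k z,
      (avgVar ρ N f x - truncVar ρ N (fun L => avg (L + 1) f2 a)) ^ 2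
        ≤ 2 * avgVar ρ N f1 x ^ (2 : ℝ) + 132 * γ x := fun x hx => by
    rw [hI, Finset.mem_Ico] at hx
    obtain ⟨δ, hδ⟩ := Int.eq_ofNat_of_zero_le (sub_nonneg.2 hx.1)
    obtain rfl : x = a + δ := by omega
    have hfar := truncVar_avg_sub_avg_sq_le (ρ := ρ) hρ (h := f2) (a := a) (m := 2 ^ k) (δ := δ)
      (N := N) (γ := γ (a + δ)) (by positivity)
      (by zify; omega) (fun y hy => by
        simp only [hf2]; push_cast at hy; rw [if_neg (not_le.2 hy)])
      (fun n hn => by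
        refine le_trans (Finset.sum_le_sum fun l _ => ?_) (hγ (a + δ) n (hn.trans hN))
        simp only [hf2]
        split_ifs
        · exact le_rfl
        · rw [zero_pow two_ne_zero]; exact sq_nonneg _)
    have havg : ∀ n, avg n f (a + δ) = avg n f1 (a + δ) + avg n f2 (a + δ) := fun n => by
      unfold avg
      rw [← _root_.add_div, ← Finset.sum_add_distrib]
      congr 1
      exact Finset.sum_congr rfl fun l _ => hff _ (by omega)
    have habs : |avgVar ρ N f (a + δ) - truncVar ρ N (fun L => avg (L + 1) f2 a)|
        ≤ avgVar ρ N f1 (a + δ)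
          + truncVar ρ N (fun L => avg (L + 1) f2 (a + δ) - avg (L + 1) f2 a) := by
      refine (abs_truncVar_sub_le hρ _ _).trans ?_
      simp only [havg, add_sub_assoc]
      exact truncVar_add_le hρ _ _
    rw [Real.rpow_two, ← sq_abs]
    have h1 := pow_le_pow_left₀ (abs_nonneg _) habs 2
    have h2 := add_sq_le (a := avgVar ρ N f1 (a + δ))
      (b := truncVar ρ N (fun L => avg (L + 1) f2 (a + δ) - avg (L + 1) f2 a))
    linarith
  have hnear := sum_avgVar_rpow_le two_pos h N (dyadic k z) s (f := f1) fun x hx => if_neg hx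
  have hs2 : ∑ x ∈ s, |f1 x| ^ (2 : ℝ) = ∑ y ∈ s, f y ^ 2 := by
    refine Finset.sum_congr rfl fun y hy => ?_
    rw [Real.rpow_two, sq_abs]
    simp only [hf1, if_pos hy]
  rw [hs2] at hnear
  have hd := sum_sq_double_le hk hγ0 hγ z
  calc _ ≤ ∑ x ∈ dyadic k z, (2 * avgVar ρ N f1 x ^ (2 : ℝ) + 132 * γ x) :=
        Finset.sum_le_sum hpt
    _ = 2 * ∑ x ∈ dyadic k z, avgVar ρ N f1 x ^ (2 : ℝ) + 132 * ∑ x ∈ dyadic k z, γ x := by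
        rw [Finset.sum_add_distrib, Finset.mul_sum, Finset.mul_sum]
    _ ≤ 2 * (C * (3 * ∑ x ∈ dyadic k z, γ x)) + 132 * ∑ x ∈ dyadic k z, γ x := by
        gcongr
        exact hnear.trans (mul_le_mul_of_nonneg_left hd hC)
    _ = _ := by ring

theorem condAvg_abs_sub_sq_le {k : ℕ} {g γ : ℤ → ℝ} {c D : ℝ} {z : ℤ}
    (h : ∑ x ∈ dyadic k z, (g x - c) ^ 2 ≤ D * ∑ x ∈ dyadic k z, γ x) :
    condAvg k (fun x => |g x - condAvg k g z|) z ^ 2 ≤ 4 * D * condAvg k γ z := by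
  have h2 : (0 : ℝ) < 2 ^ k := by positivity
  have h1 : condAvg k (fun x => (g x - c) ^ 2) z ≤ D * condAvg k γ z := by
    unfold condAvg
    rw [← mul_div_assoc]
    gcongr
  set e := condAvg k (fun x => |g x - c|) z with he
  have hec : |c - condAvg k g z| ≤ e := by
    have := abs_condAvg_le k (fun x => g x - c) z
    rw [condAvg_sub, condAvg_const] at this
    rwa [abs_sub_comm]
  have hle : condAvg k (fun x => |g x - condAvg k g z|) z ≤ 2 * e := by
    calc _ ≤ condAvg k (fun x => |g x - c| + e) z :=
          condAvg_mono fun x _ => (abs_sub_le _ c _).trans (by gcongr)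
      _ = e + e := by rw [condAvg_add, condAvg_const]
      _ = 2 * e := by ring
  have h3 : e ^ 2 ≤ condAvg k (fun x => (g x - c) ^ 2) z := by
    have := condAvg_sq_le k (fun x => |g x - c|) z
    simpa only [sq_abs] using this
  have h4 := pow_le_pow_left₀ (condAvg_nonneg (fun _ => abs_nonneg _) z) hle 2
  nlinarith

/-- A pathwise bound for the last value of a sequence by its oscillations. -/
theorem rpow_le_pathwise {p : ℝ} (hp : 1 < p) (g : ℕ → ℝ) (hg : ∀ r, 0 ≤ g r) (K : ℕ) :
    g K ^ p ≤ p * (g 0 ^ (p - 1) * g K + ∑ s ∈ Finset.range K,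
      (partialSups g (s + 1) ^ (p - 1) - partialSups g s ^ (p - 1)) * |g K - g s|) := by
  have hp1 : 0 < p - 1 := by linarith
  have hpow : ∀ c : ℝ, 0 ≤ c → c ^ p = c ^ (p - 1) * c := fun c hc => by
    rw [← Real.rpow_add_one' hc (by linarith)]; congr 1; ring
  have ha : ∀ s, 0 ≤ partialSups g s := partialSups_nonneg hg
  set G := g K with hG
  have hG0 : 0 ≤ G := hg K
  have key : ∀ s, p * (G * min (partialSups g s) G ^ (p - 1))
        - (p - 1) * min (partialSups g s) G ^ p
      ≤ p * (g 0 ^ (p - 1) * G + ∑ r ∈ Finset.range s,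
        (partialSups g (r + 1) ^ (p - 1) - partialSups g r ^ (p - 1)) * |G - g r|) := by
    intro s
    induction s with
    | zero =>
      simp only [Finset.range_zero, Finset.sum_empty, add_zero]
      rw [show partialSups g 0 = g 0 by simp]
      have h1 : min (g 0) G ^ (p - 1) ≤ g 0 ^ (p - 1) :=
        Real.rpow_le_rpow (le_min (hg 0) hG0) (min_le_left _ _) hp1.le
      have h2 : 0 ≤ min (g 0) G ^ p := Real.rpow_nonneg (le_min (hg 0) hG0) p
      have h3 : G * min (g 0) G ^ (p - 1) ≤ g 0 ^ (p - 1) * G := by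
        rw [mul_comm]; gcongr
      nlinarith
    | succ s ih =>
      rw [Finset.sum_range_succ]
      have hmono : partialSups g s ≤ partialSups g (s + 1) := (partialSups g).mono s.le_succ
      have hu : 0 ≤ partialSups g (s + 1) ^ (p - 1) - partialSups g s ^ (p - 1) :=
        sub_nonneg.2 (Real.rpow_le_rpow (ha s) hmono hp1.le)
      rcases le_total G (partialSups g s) with h | h
      · rw [min_eq_right h] at ih
        rw [min_eq_right (h.trans hmono)]
        have : 0 ≤ (partialSups g (s + 1) ^ (p - 1) - partialSups g s ^ (p - 1)) * |G - g s| :=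
          mul_nonneg hu (abs_nonneg _)
        nlinarith
      · rw [min_eq_left h] at ih
        set m := partialSups g s with hm
        set M := min (partialSups g (s + 1)) G with hM
        have hm0 : 0 ≤ m := ha s
        have hM0 : 0 ≤ M := le_min (ha _) hG0
        have hgs : g s ≤ m := le_partialSups g s
        have hyoung := mul_rpow_sub_one_le hp hm0 hM0
        have hMa : M ^ (p - 1) ≤ partialSups g (s + 1) ^ (p - 1) :=
          Real.rpow_le_rpow hM0 (min_le_left _ _) hp1.le
        have habs : G - m ≤ |G - g s| := le_trans (by linarith) (le_abs_self _)
        have hstep : (M ^ (p - 1) - m ^ (p - 1)) * (G - m)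
            ≤ (partialSups g (s + 1) ^ (p - 1) - m ^ (p - 1)) * |G - g s| := by
          have h1 : (M ^ (p - 1) - m ^ (p - 1)) * (G - m)
              ≤ (partialSups g (s + 1) ^ (p - 1) - m ^ (p - 1)) * (G - m) :=
            mul_le_mul_of_nonneg_right (by linarith) (by linarith)
          exact h1.trans (mul_le_mul_of_nonneg_left habs hu)
        rw [hpow m hm0] at ih hyoung
        have := mul_le_mul_of_nonneg_left hstep (by linarith : 0 ≤ p)
        linarith
  have h := key K
  rw [min_eq_right (le_partialSups g K), hpow G hG0] at h
  rw [hpow G hG0]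
  linarith

/-- A dyadic sharp-function estimate: if the mean oscillation of `g` is controlled by the averages
of `γ`, then the `p`-norm of `g` is controlled by that of its top-level average and of `√γ`. -/
theorem sum_rpow_le_of_oscillation {p : ℝ} (hp : 2 < p) {D : ℝ} (hD : 0 ≤ D) :
    ∃ C : ℝ, 0 < C ∧ ∀ (K : ℕ) (g γ : ℤ → ℝ), (∀ x, 0 ≤ g x) → (∀ x, 0 ≤ γ x) →
      (∀ k ≤ K, ∀ z, condAvg k (fun x => |g x - condAvg k g z|) z ^ 2 ≤ D * condAvg k γ z) →
      ∑ x ∈ box K, g x ^ p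
        ≤ C * (∑ x ∈ box K, condAvg K g x ^ p + ∑ x ∈ box K, γ x ^ (p / 2)) := by
  have hp1 : 1 < p := by linarith
  have hp0 : 0 ≤ p := by linarith
  have hpm : 0 < p - 1 := by linarith
  obtain ⟨C₁, hC₁, hdoob⟩ := doob_maximal hp1
  obtain ⟨C₂, hC₂, hdoob'⟩ := doob_maximal (p := p / 2) (by linarith)
  set ε : ℝ := 1 / (4 * p * C₁) with hε
  have hε0 : 0 < ε := by positivity
  refine ⟨2 * p + 4 * p * ε ^ (1 - p) * D ^ (p / 2) * C₂, by positivity,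
    fun K g γ hg hγ hosc => ?_⟩
  have hgs : ∀ x s, 0 ≤ dyadicMart K g s x := fun x s => condAvg_nonneg hg x
  have hγs : ∀ x s, 0 ≤ dyadicMart K γ s x := fun x s => condAvg_nonneg hγ x
  set a : ℕ → ℤ → ℝ := fun s x => partialSups (fun r => dyadicMart K g r x) s with ha
  have ha0 : ∀ s x, 0 ≤ a s x := fun s x => partialSups_nonneg (hgs x) s
  have hamono : ∀ x, Monotone fun s => a s x := fun x => (partialSups _).mono
  set γ' : ℤ → ℝ := fun x => partialSups (fun r => dyadicMart K γ r x) K with hγ'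
  have hγ'0 : ∀ x, 0 ≤ γ' x := fun x => partialSups_nonneg (hγs x) K
  have hac : ∀ s, DyadicConst (K - s) (a s) := fun s =>
    dyadicConst_partialSups (dyadicMart K g) fun r hr => dyadicConst_dyadicMart K g hr
  have hpath : ∀ x, g x ^ p ≤ p * (dyadicMart K g 0 x ^ (p - 1) * g x
      + ∑ s ∈ Finset.range K, (a (s + 1) x ^ (p - 1) - a s x ^ (p - 1))
        * |g x - dyadicMart K g s x|) := fun x => by
    have h := rpow_le_pathwise hp1 (fun s => dyadicMart K g s x) (hgs x) K
    simp only [dyadicMart_last] at h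
    exact h
  have hstep : ∀ s ∈ Finset.range K, ∑ x ∈ box K, (a (s + 1) x ^ (p - 1) - a s x ^ (p - 1))
        * |g x - dyadicMart K g s x|
      ≤ ∑ x ∈ box K, (a (s + 1) x ^ (p - 1) - a s x ^ (p - 1)) * (2 * √(D * γ' x)) := by
    intro s hs
    rw [Finset.mem_range] at hs
    obtain ⟨k, hk⟩ : ∃ k, K - s = k + 1 := ⟨K - s - 1, by omega⟩
    have hk' : K - (s + 1) = k := by omega
    have huc : DyadicConst k (fun x => a (s + 1) x ^ (p - 1) - a s x ^ (p - 1)) :=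
      fun x y hxy => by
        have h1 := hac (s + 1)
        rw [hk'] at h1
        have h2 := (hac s).mono (j := k) (by omega)
        simp only [h1 hxy, h2 hxy]
    rw [← sum_mul_condAvg ((dyadicClosed_box K).mono (by omega)) huc]
    refine Finset.sum_le_sum fun x _ => mul_le_mul_of_nonneg_left ?_
      (sub_nonneg.2 (Real.rpow_le_rpow (ha0 s x) (hamono x s.le_succ) hpm.le))
    refine (condAvg_le_two_mul (fun _ => abs_nonneg _) x).trans
      (mul_le_mul_of_nonneg_left (Real.le_sqrt_of_sq_le ?_) two_pos.le)
    have heq : condAvg (k + 1) (fun y => |g y - dyadicMart K g s y|) x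
        = condAvg (k + 1) (fun y => |g y - condAvg (k + 1) g x|) x := by
      refine congrArg (· / (2 : ℝ) ^ (k + 1)) (Finset.sum_congr rfl fun y hy => ?_)
      have h1 : dyadicMart K g s y = condAvg (k + 1) g y := by unfold dyadicMart; rw [hk]
      change |g y - dyadicMart K g s y| = |g y - condAvg (k + 1) g x|
      rw [h1, dyadicConst_condAvg (k + 1) g (mem_dyadic.1 hy)]
    rw [heq]
    refine (hosc (k + 1) (by omega) x).trans (mul_le_mul_of_nonneg_left ?_ hD)
    have h2 : condAvg (k + 1) γ x = dyadicMart K γ s x := by unfold dyadicMart; rw [hk]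
    rw [h2]
    exact le_partialSups_of_le (fun r => dyadicMart K γ r x) hs.le
  have htop : ∑ x ∈ box K, dyadicMart K g 0 x ^ (p - 1) * g x = ∑ x ∈ box K, condAvg K g x ^ p := by
    have hc : DyadicConst (K - 0) fun x => dyadicMart K g 0 x ^ (p - 1) := fun x y hxy => by
      have h1 := dyadicConst_dyadicMart K g (le_refl 0) hxy
      simp only [h1]
    rw [← sum_mul_dyadicMart (le_refl 0) hc]
    refine Finset.sum_congr rfl fun x _ => ?_
    rw [← Real.rpow_add_one' (hgs x 0) (by linarith), sub_add_cancel]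
    rfl
  have hpt : ∀ x, ∑ s ∈ Finset.range K, (a (s + 1) x ^ (p - 1) - a s x ^ (p - 1))
        * (2 * √(D * γ' x))
      ≤ 2 * (ε ^ (1 - p) * (D ^ (p / 2) * γ' x ^ (p / 2)) + ε * a K x ^ p) := fun x => by
    rw [← Finset.sum_mul, Finset.sum_range_sub fun s => a s x ^ (p - 1)]
    have h1 : 0 ≤ a 0 x ^ (p - 1) := Real.rpow_nonneg (ha0 0 x) _
    have h2 := mul_rpow_sub_one_le_eps hp1 (Real.sqrt_nonneg (D * γ' x)) (ha0 K x) hε0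
    have h3 : √(D * γ' x) ^ p = D ^ (p / 2) * γ' x ^ (p / 2) := by
      rw [Real.sqrt_eq_rpow, ← Real.rpow_mul (mul_nonneg hD (hγ'0 x)),
        Real.mul_rpow hD (hγ'0 x)]
      ring_nf
    rw [h3] at h2
    have h4 := Real.sqrt_nonneg (D * γ' x)
    nlinarith
  set S := ∑ x ∈ box K, g x ^ p with hS
  set T := ∑ x ∈ box K, condAvg K g x ^ p with hT
  set U := ∑ x ∈ box K, γ x ^ (p / 2) with hU
  have hT0 : 0 ≤ T := Finset.sum_nonneg fun x _ => Real.rpow_nonneg (condAvg_nonneg hg x) _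
  have hU0 : 0 ≤ U := Finset.sum_nonneg fun x _ => Real.rpow_nonneg (hγ x) _
  have h1 : ∑ x ∈ box K, γ' x ^ (p / 2) ≤ C₂ * U := hdoob' K γ hγ
  have h2 : ∑ x ∈ box K, a K x ^ p ≤ C₁ * S := hdoob K g hg
  have hmain : S ≤ p * (T + 2 * (ε ^ (1 - p) * (D ^ (p / 2) * (C₂ * U)) + ε * (C₁ * S))) := by
    calc S ≤ ∑ x ∈ box K, p * (dyadicMart K g 0 x ^ (p - 1) * g x
          + ∑ s ∈ Finset.range K, (a (s + 1) x ^ (p - 1) - a s x ^ (p - 1))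
            * |g x - dyadicMart K g s x|) := Finset.sum_le_sum fun x _ => hpath x
      _ = p * (T + ∑ s ∈ Finset.range K, ∑ x ∈ box K,
            (a (s + 1) x ^ (p - 1) - a s x ^ (p - 1)) * |g x - dyadicMart K g s x|) := by
          rw [← Finset.mul_sum, Finset.sum_add_distrib, htop, Finset.sum_comm]
      _ ≤ p * (T + ∑ s ∈ Finset.range K, ∑ x ∈ box K,
            (a (s + 1) x ^ (p - 1) - a s x ^ (p - 1)) * (2 * √(D * γ' x))) := by
          exact mul_le_mul_of_nonneg_left (add_le_add_right (Finset.sum_le_sum hstep) T) hp0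
      _ ≤ p * (T + ∑ x ∈ box K,
            2 * (ε ^ (1 - p) * (D ^ (p / 2) * γ' x ^ (p / 2)) + ε * a K x ^ p)) := by
          rw [Finset.sum_comm]
          exact mul_le_mul_of_nonneg_left
            (add_le_add_right (Finset.sum_le_sum fun x _ => hpt x) T) hp0
      _ = p * (T + 2 * (ε ^ (1 - p) * (D ^ (p / 2) * ∑ x ∈ box K, γ' x ^ (p / 2))
            + ε * ∑ x ∈ box K, a K x ^ p)) := by
          rw [← Finset.mul_sum, Finset.sum_add_distrib, ← Finset.mul_sum, ← Finset.mul_sum,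
            ← Finset.mul_sum]
      _ ≤ _ := by gcongr
  have habs : ε * C₁ * (4 * p) = 1 := by rw [hε]; field_simp
  calc S = 2 * S - ε * C₁ * (4 * p) * S := by rw [habs]; ring
    _ ≤ 2 * (p * (T + 2 * (ε ^ (1 - p) * (D ^ (p / 2) * (C₂ * U)) + ε * (C₁ * S))))
          - ε * C₁ * (4 * p) * S := by gcongr
    _ = 2 * p * T + 4 * p * ε ^ (1 - p) * D ^ (p / 2) * C₂ * U := by ring
    _ ≤ 2 * p * T + 4 * p * ε ^ (1 - p) * D ^ (p / 2) * C₂ * U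
          + (2 * p * U + 4 * p * ε ^ (1 - p) * D ^ (p / 2) * C₂ * T) :=
        le_add_of_nonneg_right (by positivity)
    _ = _ := by ring

theorem add_rpow_le_two_rpow_mul {q a b : ℝ} (hq : 0 ≤ q) (ha : 0 ≤ a) (hb : 0 ≤ b) :
    (a + b) ^ q ≤ 2 ^ q * (a ^ q + b ^ q) := by
  have ha' := Real.rpow_nonneg ha q
  have hb' := Real.rpow_nonneg hb q
  have h2 : (0 : ℝ) ≤ 2 ^ q := by positivity
  rcases le_total a b with h | h
  · calc (a + b) ^ q ≤ (2 * b) ^ q := Real.rpow_le_rpow (by positivity) (by linarith) hq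
      _ = 2 ^ q * b ^ q := Real.mul_rpow two_pos.le hb
      _ ≤ _ := by gcongr; linarith
  · calc (a + b) ^ q ≤ (2 * a) ^ q := Real.rpow_le_rpow (by positivity) (by linarith) hq
      _ = 2 ^ q * a ^ q := Real.mul_rpow two_pos.le ha
      _ ≤ _ := by gcongr; linarith

/-- All forward averages of `f` are controlled by its value and its variation. -/
theorem sum_range_le_mul_add_avgVar {ρ : ℝ} (hρ : 2 ≤ ρ) {N n : ℕ} (hn : n ≤ N) (f : ℤ → ℝ)
    (x : ℤ) :
    ∑ l ∈ Finset.range n, f (x + l) ≤ n * (f x + avgVar ρ N f x) := by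
  rcases n with _ | L
  · simp
  have h := abs_sub_le_truncVar (ρ := ρ) hρ (fun L => avg (L + 1) f x) (m := L) (n := 0) (N := N)
    (by omega) (Nat.zero_le _)
  simp only [zero_add, avg_one] at h
  have h1 : avg (L + 1) f x ≤ f x + avgVar ρ N f x := by
    have := (le_abs_self _).trans h
    unfold avgVar
    linarith
  unfold avg at h1
  rw [div_le_iff₀ (by positivity)] at h1
  linarith

theorem sum_condAvg_top_rpow_le {p : ℝ} (hp : 2 < p) {C : ℝ} (hC : 0 ≤ C) {K : ℕ} {f g : ℤ → ℝ}
    (hg : ∀ x, 0 ≤ g x) (h : ∑ x ∈ box K, g x ^ 2 ≤ C * ∑ x ∈ box K, f x ^ 2) :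
    ∑ x ∈ box K, condAvg K g x ^ p ≤ (2 * C) ^ (p / 2) * ∑ x ∈ box K, |f x| ^ p := by
  have hq : 1 ≤ p / 2 := by linarith
  have hq0 : 0 ≤ p / 2 := by linarith
  set F := ∑ x ∈ box K, f x ^ 2 with hF
  have hF0 : 0 ≤ F := Finset.sum_nonneg fun _ _ => sq_nonneg _
  have h2 : (0 : ℝ) < 2 ^ K := by positivity
  set M : ℝ := 2 ^ K with hM
  have hsqrt : ∀ c : ℝ, 0 ≤ c → (c ^ 2) ^ (p / 2) = c ^ p := fun c hc => by
    rw [← Real.rpow_two, ← Real.rpow_mul hc]; congr 1; ring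
  have hpt : ∀ x ∈ box K, condAvg K g x ^ p ≤ (C * F / M) ^ (p / 2) := fun x hx => by
    rw [← hsqrt _ (condAvg_nonneg hg x)]
    refine Real.rpow_le_rpow (sq_nonneg _) ((condAvg_sq_le K g x).trans ?_) hq0
    unfold condAvg
    gcongr
    exact (Finset.sum_le_sum_of_subset_of_nonneg (dyadicClosed_box K x hx)
      fun _ _ _ => sq_nonneg _).trans h
  have hJ : F ^ (p / 2) ≤ (2 * M) ^ (p / 2 - 1) * ∑ x ∈ box K, |f x| ^ p := by
    have := Real.rpow_sum_le_const_mul_sum_rpow_of_nonneg (s := box K) (f := fun x => f x ^ 2) hq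
      fun _ _ => sq_nonneg _
    rw [card_box] at this
    push_cast at this
    refine this.trans_eq (congrArg _ (Finset.sum_congr rfl fun x _ => ?_))
    rw [← sq_abs, hsqrt _ (abs_nonneg _)]
  calc ∑ x ∈ box K, condAvg K g x ^ p ≤ ∑ _x ∈ box K, (C * F / M) ^ (p / 2) :=
        Finset.sum_le_sum hpt
    _ = 2 * M * (C * F / M) ^ (p / 2) := by
        rw [Finset.sum_const, card_box, nsmul_eq_mul]; push_cast; rfl
    _ = 2 * M * (C ^ (p / 2) * F ^ (p / 2) / M ^ (p / 2)) := by
        rw [Real.div_rpow (by positivity) h2.le, Real.mul_rpow hC hF0]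
    _ ≤ 2 * M * (C ^ (p / 2) * ((2 * M) ^ (p / 2 - 1) * ∑ x ∈ box K, |f x| ^ p)
          / M ^ (p / 2)) := by gcongr
    _ = (2 * M) ^ (p / 2 - 1) * (2 * M) * C ^ (p / 2) / M ^ (p / 2)
          * ∑ x ∈ box K, |f x| ^ p := by ring
    _ = _ := by
        rw [← Real.rpow_add_one (by positivity), sub_add_cancel, Real.mul_rpow two_pos.le h2.le,
          Real.mul_rpow two_pos.le hC]
        congr 1
        have : M ^ (p / 2) ≠ 0 := by positivity
        field_simp

/-- Doubling the exponent of a strong-type estimate. -/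
theorem StrongType.of_half {ρ p : ℝ} (hρ : 2 < ρ) (hp : 2 < p) (h : StrongType ρ (p / 2)) :
    StrongType ρ p := by
  obtain ⟨C₂, hC₂, h2⟩ := strongType_two hρ
  obtain ⟨C₃, hC₃, h3⟩ := h
  obtain ⟨C₄, hC₄, h4⟩ := sum_rpow_le_of_oscillation hp (D := 4 * (6 * C₂ + 132)) (by positivity)
  refine StrongType.of_large (by linarith)
    ⟨C₄ * ((2 * C₂) ^ (p / 2) + 2 ^ (p / 2) * (1 + C₃)), by positivity, fun N K f hN hf => ?_⟩
  have hq0 : 0 < p / 2 := by linarith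
  set γ : ℤ → ℝ := fun x => f x ^ 2 + avgVar ρ (2 ^ (K + 1)) (fun y => f y ^ 2) x with hγdef
  have hγ0 : ∀ x, f x ^ 2 ≤ γ x := fun x => le_add_of_nonneg_right (avgVar_nonneg _ _ _ _)
  have hγ : ∀ x, ∀ n : ℕ, n ≤ 2 ^ (K + 1) → ∑ l ∈ Finset.range n, f (x + l) ^ 2 ≤ n * γ x :=
    fun x n hn => sum_range_le_mul_add_avgVar hρ.le hn (fun y => f y ^ 2) x
  have hsq : ∀ x, |f x ^ 2| ^ (p / 2) = |f x| ^ p := fun x => by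
    rw [abs_pow, ← Real.rpow_two, ← Real.rpow_mul (abs_nonneg _)]; congr 1; ring
  have hγsum : ∑ x ∈ box K, γ x ^ (p / 2) ≤ 2 ^ (p / 2) * (1 + C₃) * ∑ x ∈ box K, |f x| ^ p := by
    have h5 := h3 (2 ^ (K + 1)) K (fun y => f y ^ 2) fun x hx => by
      simp only [hf x hx]; norm_num
    simp only [hsq] at h5
    calc _ ≤ ∑ x ∈ box K, 2 ^ (p / 2) * (|f x| ^ p
            + avgVar ρ (2 ^ (K + 1)) (fun y => f y ^ 2) x ^ (p / 2)) := by
          refine Finset.sum_le_sum fun x _ => ?_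
          have := add_rpow_le_two_rpow_mul hq0.le (sq_nonneg (f x))
            (avgVar_nonneg ρ (2 ^ (K + 1)) (fun y => f y ^ 2) x)
          rwa [← abs_of_nonneg (sq_nonneg (f x)), hsq, abs_of_nonneg (sq_nonneg (f x))] at this
      _ = 2 ^ (p / 2) * (∑ x ∈ box K, |f x| ^ p
            + ∑ x ∈ box K, avgVar ρ (2 ^ (K + 1)) (fun y => f y ^ 2) x ^ (p / 2)) := by
          rw [← Finset.mul_sum, Finset.sum_add_distrib]
      _ ≤ 2 ^ (p / 2) * (∑ x ∈ box K, |f x| ^ p + C₃ * ∑ x ∈ box K, |f x| ^ p) := by gcongr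
      _ = _ := by ring
  have htop := sum_condAvg_top_rpow_le hp hC₂.le (K := K) (f := f) (g := avgVar ρ N f)
    (avgVar_nonneg ρ N f) (by simpa only [Real.rpow_two, sq_abs] using h2 N K f hf)
  have hosc := h4 K (avgVar ρ N f) γ (avgVar_nonneg ρ N f)
    (fun x => (sq_nonneg _).trans (hγ0 x)) fun k hk z => by
      obtain ⟨c, hc⟩ := exists_sum_sq_avgVar_sub_le hρ.le hC₂.le h2 (N := N) (K := K) (k := k)
        (f := f) (γ := γ) (by rw [pow_succ]; omega) hk hγ0 hγ z
      exact condAvg_abs_sub_sq_le hc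
  calc _ ≤ _ := hosc
    _ ≤ C₄ * ((2 * C₂) ^ (p / 2) * ∑ x ∈ box K, |f x| ^ p
          + 2 ^ (p / 2) * (1 + C₃) * ∑ x ∈ box K, |f x| ^ p) := by gcongr
    _ = _ := by ring

/-- The variation of the averages on `ℤ` is of strong type `(p, p)` for all `1 < p`. -/
theorem strongType {ρ p : ℝ} (hρ : 2 < ρ) (hp : 1 < p) : StrongType ρ p := by
  have key : ∀ n : ℕ, ∀ p : ℝ, 1 < p → p ≤ 2 ^ (n + 1) → StrongType ρ p := by
    intro n
    induction n with
    | zero =>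
      intro p hp hp2
      rcases hp2.lt_or_eq with h | rfl
      · exact strongType_of_lt_two hρ hp (by simpa using h)
      · simpa using strongType_two hρ
    | succ n ih =>
      intro p hp hpn
      rcases lt_trichotomy p 2 with h | rfl | h
      · exact strongType_of_lt_two hρ hp h
      · exact strongType_two hρ
      · exact StrongType.of_half hρ h (ih _ (by linarith) (by rw [pow_succ] at hpn; linarith))
  obtain ⟨n, hn⟩ := pow_unbounded_of_one_lt p one_lt_two
  exact key n p hp (hn.le.trans (pow_le_pow_right₀ one_le_two n.le_succ))

/-! ### Centred averages -/

/-- The centred average of length `2 * L + 1`. -/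
noncomputable def centredAvg (L : ℕ) (f : ℤ → ℝ) (i : ℤ) : ℝ :=
  (∑ l ∈ Finset.Icc (-(L : ℤ)) L, f (i - l)) / (2 * L + 1)

theorem Qdisc_eq_mul (φ ψ : ℤ → ℝ) (L : ℕ) (i : ℤ) :
    Qdisc φ ψ L i = centredAvg L φ i * centredAvg L ψ i := by
  unfold Qdisc centredAvg
  rw [← Finset.sum_mul_sum, div_mul_div_comm, ← sq, div_eq_inv_mul]

theorem sum_Icc_eq_add_sub (f : ℤ → ℝ) (i : ℤ) (L : ℕ) :
    ∑ l ∈ Finset.Icc (-(L : ℤ)) L, f (i - l)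
      = ∑ l ∈ Finset.range (L + 1), f (i + l) + ∑ l ∈ Finset.range (L + 1), f (i - l) - f i := by
  induction L with
  | zero => simp
  | succ L ih =>
    have h : Finset.Icc (-((L + 1 : ℕ) : ℤ)) ((L + 1 : ℕ) : ℤ)
        = insert (-((L : ℤ) + 1)) (insert ((L : ℤ) + 1) (Finset.Icc (-(L : ℤ)) L)) := by
      ext y
      simp only [Finset.mem_insert, Finset.mem_Icc]
      omega
    rw [h, Finset.sum_insert, Finset.sum_insert, ih, Finset.sum_range_succ _ (L + 1),
      Finset.sum_range_succ _ (L + 1), sub_neg_eq_add]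
    · push_cast
      ring
    · simp only [Finset.mem_Icc]; omega
    · simp only [Finset.mem_insert, Finset.mem_Icc]; omega

theorem centredAvg_eq (f : ℤ → ℝ) (i : ℤ) (L : ℕ) :
    centredAvg L f i = (1 + 1 / (2 * L + 1 : ℝ)) / 2
      * (avg (L + 1) f i + avg (L + 1) (fun y => f (-y)) (-i)) - 1 / (2 * L + 1 : ℝ) * f i := by
  have h : ∀ l : ℕ, f (-(-i + l)) = f (i - l) := fun l => congrArg f (by ring)
  unfold centredAvg avg
  rw [sum_Icc_eq_add_sub]
  simp only [h]
  push_cast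
  field_simp
  ring

/-- A majorant of the centred averages and of their variation. -/
noncomputable def centredBound (ρ : ℝ) (N : ℕ) (f : ℤ → ℝ) (i : ℤ) : ℝ :=
  3 * |f i| + (avgVar ρ N f i + avgVar ρ N (fun y => f (-y)) (-i))

theorem centredBound_nonneg (ρ : ℝ) (N : ℕ) (f : ℤ → ℝ) (i : ℤ) : 0 ≤ centredBound ρ N f i :=
  add_nonneg (by positivity) (add_nonneg (avgVar_nonneg _ _ _ _) (avgVar_nonneg _ _ _ _))

theorem one_div_two_mul_add_one_mem (n : ℕ) :
    0 ≤ 1 / (2 * n + 1 : ℝ) ∧ 1 / (2 * n + 1 : ℝ) ≤ 1 := by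
  refine ⟨by positivity, ?_⟩
  rw [div_le_one (by positivity)]
  have : (0 : ℝ) ≤ n := Nat.cast_nonneg n
  linarith

theorem truncVar_one_div_le {ρ : ℝ} (hρ : 2 ≤ ρ) (N : ℕ) :
    truncVar ρ N (fun n => 1 / (2 * n + 1 : ℝ)) ≤ 2 := by
  have h := truncVar_sq_le hρ N (fun n => 1 / (2 * n + 1 : ℝ))
  have h1 : ∀ n : ℕ, |signedSq (1 / (2 * (n + 1 : ℕ) + 1 : ℝ)) - signedSq (1 / (2 * n + 1 : ℝ))|
      = (1 / (2 * n + 1 : ℝ)) ^ 2 - (1 / (2 * (n + 1 : ℕ) + 1 : ℝ)) ^ 2 := fun n => by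
    unfold signedSq
    rw [abs_of_nonneg (one_div_two_mul_add_one_mem n).1,
      abs_of_nonneg (one_div_two_mul_add_one_mem (n + 1)).1, ← sq, ← sq, abs_sub_comm,
      abs_of_nonneg]
    refine sub_nonneg.2 (pow_le_pow_left₀ (one_div_two_mul_add_one_mem (n + 1)).1 ?_ 2)
    gcongr
    omega
  simp only [h1] at h
  rw [Finset.sum_range_sub' fun n : ℕ => (1 / (2 * n + 1 : ℝ)) ^ 2] at h
  have h2 : (0 : ℝ) ≤ (1 / (2 * N + 1 : ℝ)) ^ 2 := sq_nonneg _
  simp only [Nat.cast_zero, mul_zero, zero_add, div_one, one_pow] at h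
  have h3 : truncVar ρ N (fun n => 1 / (2 * n + 1 : ℝ)) ^ 2 ≤ 2 ^ 2 := by linarith
  exact (pow_le_pow_iff_left₀ (truncVar_nonneg _ _ _) two_pos.le two_ne_zero).1 h3

theorem abs_avg_le {ρ : ℝ} (hρ : 2 ≤ ρ) {N n : ℕ} (hn : n ≤ N) (f : ℤ → ℝ) (x : ℤ) :
    |avg (n + 1) f x| ≤ |f x| + avgVar ρ N f x := by
  have h := abs_sub_le_truncVar (ρ := ρ) hρ (fun L => avg (L + 1) f x) hn (Nat.zero_le N)
  simp only [zero_add, avg_one] at h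
  have h1 := abs_sub_abs_le_abs_sub (avg (n + 1) f x) (f x)
  unfold avgVar
  linarith

theorem abs_centredAvg_le {ρ : ℝ} (hρ : 2 ≤ ρ) {N n : ℕ} (hn : n ≤ N) (f : ℤ → ℝ) (i : ℤ) :
    |centredAvg n f i| ≤ centredBound ρ N f i := by
  have h1 := abs_avg_le hρ hn f i
  have h2 := abs_avg_le hρ hn (fun y => f (-y)) (-i)
  simp only [neg_neg] at h2
  rw [centredAvg_eq]
  unfold centredBound
  obtain ⟨hv0, hv1⟩ := one_div_two_mul_add_one_mem n
  set v := 1 / (2 * n + 1 : ℝ)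
  set S := avg (n + 1) f i + avg (n + 1) (fun y => f (-y)) (-i)
  have hS := abs_add_le (avg (n + 1) f i) (avg (n + 1) (fun y => f (-y)) (-i))
  have h3 : |(1 + v) / 2 * S| ≤ |S| := by
    rw [abs_mul, abs_of_nonneg (by linarith : 0 ≤ (1 + v) / 2)]
    exact mul_le_of_le_one_left (abs_nonneg _) (by linarith)
  have h4 : |v * f i| ≤ |f i| := by
    rw [abs_mul, abs_of_nonneg hv0]
    exact mul_le_of_le_one_left (abs_nonneg _) hv1
  have h5 := abs_sub ((1 + v) / 2 * S) (v * f i)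
  linarith

theorem truncVar_centredAvg_le {ρ : ℝ} (hρ : 2 ≤ ρ) (N : ℕ) (f : ℤ → ℝ) (i : ℤ) :
    truncVar ρ N (fun L => centredAvg L f i) ≤ 3 * centredBound ρ N f i := by
  set V := avgVar ρ N f i with hV
  set V' := avgVar ρ N (fun y => f (-y)) (-i) with hV'
  have hB := centredBound_nonneg ρ N f i
  have hV0 : 0 ≤ V := avgVar_nonneg _ _ _ _
  have hV0' : 0 ≤ V' := avgVar_nonneg _ _ _ _
  set S : ℕ → ℝ := fun L => avg (L + 1) f i + avg (L + 1) (fun y => f (-y)) (-i) with hS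
  set v : ℕ → ℝ := fun L => 1 / (2 * L + 1 : ℝ) with hv
  have hSV : truncVar ρ N S ≤ V + V' := truncVar_add_le hρ _ _
  have hSb : ∀ n ≤ N, |S n| ≤ 2 * |f i| + (V + V') := fun n hn => by
    have h1 := abs_avg_le hρ hn f i
    have h2 := abs_avg_le hρ hn (fun y => f (-y)) (-i)
    simp only [neg_neg] at h2
    have h3 := abs_add_le (avg (n + 1) f i) (avg (n + 1) (fun y => f (-y)) (-i))
    simp only [hS]
    linarith
  have h := truncVar_le_of_abs_sub_le (ρ := ρ) (N := N) (a := S) (b := v)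
    (c := fun L => centredAvg L f i) (A := 1) (B := centredBound ρ N f i) hρ zero_le_one hB
    fun m hm n hn => by
      obtain ⟨hv0, hv1⟩ := one_div_two_mul_add_one_mem m
      have e : centredAvg m f i - centredAvg n f i
          = (1 + v m) / 2 * (S m - S n) + (v m - v n) * (S n / 2 - f i) := by
        rw [centredAvg_eq, centredAvg_eq]; simp only [hv, hS]; ring
      rw [e]
      refine (abs_add_le _ _).trans (add_le_add ?_ ?_)
      · rw [abs_mul, abs_of_nonneg (by simp only [hv]; linarith : 0 ≤ (1 + v m) / 2)]
        gcongr
        simp only [hv]; linarith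
      · rw [abs_mul, mul_comm]
        gcongr
        have h1 := hSb n hn
        have h2 := abs_sub (S n / 2) (f i)
        rw [abs_div, abs_two] at h2
        unfold centredBound
        have := abs_nonneg (f i)
        linarith
  have h2 := mul_le_mul_of_nonneg_left (truncVar_one_div_le hρ N) hB
  have h3 : V + V' ≤ centredBound ρ N f i := le_add_of_nonneg_left (by positivity)
  linarith

theorem truncVar_Qdisc_le {ρ : ℝ} (hρ : 2 ≤ ρ) (N : ℕ) (φ ψ : ℤ → ℝ) (i : ℤ) :
    truncVar ρ N (fun L => Qdisc φ ψ L i)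
      ≤ 6 * (centredBound ρ N φ i * centredBound ρ N ψ i) := by
  have hφ := centredBound_nonneg ρ N φ i
  have hψ := centredBound_nonneg ρ N ψ i
  have h := truncVar_le_of_abs_sub_le (ρ := ρ) (N := N) (a := fun L => centredAvg L φ i)
    (b := fun L => centredAvg L ψ i) (c := fun L => Qdisc φ ψ L i) hρ hψ hφ fun m hm n hn => by
      have e : Qdisc φ ψ m i - Qdisc φ ψ n i
          = centredAvg m ψ i * (centredAvg m φ i - centredAvg n φ i)
            + centredAvg n φ i * (centredAvg m ψ i - centredAvg n ψ i) := by
        rw [Qdisc_eq_mul, Qdisc_eq_mul]; ring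
      rw [e]
      refine (abs_add_le _ _).trans ?_
      rw [abs_mul, abs_mul]
      gcongr
      · exact abs_centredAvg_le hρ hm ψ i
      · exact abs_centredAvg_le hρ hn φ i
  have h1 := mul_le_mul_of_nonneg_left (truncVar_centredAvg_le hρ N φ i) hψ
  have h2 := mul_le_mul_of_nonneg_left (truncVar_centredAvg_le hρ N ψ i) hφ
  linarith

theorem exists_sum_centredBound_rpow_le {ρ p : ℝ} (hρ : 2 < ρ) (hp : 1 < p) :
    ∃ C : ℝ, 0 < C ∧ ∀ (N : ℕ) (F s : Finset ℤ) (f : ℤ → ℝ), (∀ x, x ∉ s → f x = 0) →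
      ∑ x ∈ F, centredBound ρ N f x ^ p ≤ C * ∑ x ∈ s, |f x| ^ p := by
  classical
  obtain ⟨C, hC, h⟩ := strongType hρ hp
  have hp0 : 0 < p := by linarith
  refine ⟨2 ^ p * (3 ^ p + 2 ^ p * (2 * C)), by positivity, fun N F s f hf => ?_⟩
  have h1 := sum_avgVar_rpow_le hp0 h N F s hf
  have h2 := sum_avgVar_rpow_le hp0 h N (F.map (Equiv.neg ℤ).toEmbedding)
    (s.map (Equiv.neg ℤ).toEmbedding) (f := fun y => f (-y)) fun x hx => hf _ fun hx' =>
      hx (Finset.mem_map.2 ⟨-x, hx', by simp⟩)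
  simp only [Finset.sum_map, Equiv.coe_toEmbedding, Equiv.neg_apply, neg_neg] at h2
  have h3 : ∑ x ∈ F, |f x| ^ p ≤ ∑ x ∈ s, |f x| ^ p := by
    have := sum_shift_le F s (h := fun x => |f x| ^ p) (fun x => by positivity)
      (fun x hx => by simp only [hf x hx, abs_zero, Real.zero_rpow hp0.ne']) 0
    simpa using this
  have hpt : ∀ x, centredBound ρ N f x ^ p ≤ 2 ^ p * (3 ^ p * |f x| ^ p
      + 2 ^ p * (avgVar ρ N f x ^ p + avgVar ρ N (fun y => f (-y)) (-x) ^ p)) := fun x => by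
    have hV := avgVar_nonneg ρ N f x
    have hV' := avgVar_nonneg ρ N (fun y => f (-y)) (-x)
    rw [← Real.mul_rpow (by norm_num) (abs_nonneg _)]
    refine (add_rpow_le_two_rpow_mul hp0.le (by positivity) (add_nonneg hV hV')).trans ?_
    gcongr
    exact add_rpow_le_two_rpow_mul hp0.le hV hV'
  calc _ ≤ ∑ x ∈ F, 2 ^ p * (3 ^ p * |f x| ^ p
          + 2 ^ p * (avgVar ρ N f x ^ p + avgVar ρ N (fun y => f (-y)) (-x) ^ p)) :=
        Finset.sum_le_sum fun x _ => hpt x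
    _ = 2 ^ p * (3 ^ p * ∑ x ∈ F, |f x| ^ p + 2 ^ p * (∑ x ∈ F, avgVar ρ N f x ^ p
          + ∑ x ∈ F, avgVar ρ N (fun y => f (-y)) (-x) ^ p)) := by
        simp only [← Finset.mul_sum, Finset.sum_add_distrib]
    _ ≤ 2 ^ p * (3 ^ p * ∑ x ∈ s, |f x| ^ p + 2 ^ p * (C * ∑ x ∈ s, |f x| ^ p
          + C * ∑ x ∈ s, |f x| ^ p)) := by gcongr
    _ = _ := by ring

theorem centredBound_mono {ρ : ℝ} (hρ : 2 ≤ ρ) (f : ℤ → ℝ) (i : ℤ) :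
    Monotone fun N => centredBound ρ N f i := fun N M h => by
  have htv : ∀ a : ℕ → ℝ, truncVar ρ N a ≤ truncVar ρ M a := fun a =>
    ENNReal.toReal_mono (varNorm_Iic_ne_top hρ M a) (varNorm_mono_set (Set.Iic_subset_Iic.2 h) a)
  exact add_le_add_right (add_le_add (htv _) (htv _)) _

/-- The supremum of `centredBound` over all truncations. -/
noncomputable def centredMajorant (ρ : ℝ) (f : ℤ → ℝ) (i : ℤ) : ℝ≥0∞ :=
  ⨆ N, ENNReal.ofReal (centredBound ρ N f i)

theorem varNorm_Qdisc_le {ρ : ℝ} (hρ : 2 ≤ ρ) (φ ψ : ℤ → ℝ) (i : ℤ) :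
    varNorm ρ (Set.univ : Set ℕ) (fun L => Qdisc φ ψ L i)
      ≤ 6 * (centredMajorant ρ φ i * centredMajorant ρ ψ i) := by
  rw [varNorm_univ_eq_iSup]
  refine iSup_le fun N => ?_
  rw [← ofReal_truncVar hρ]
  refine (ENNReal.ofReal_le_ofReal (truncVar_Qdisc_le hρ N φ ψ i)).trans ?_
  rw [ENNReal.ofReal_mul (by norm_num), ENNReal.ofReal_mul (centredBound_nonneg ρ N φ i)]
  refine mul_le_mul' (by norm_num) (mul_le_mul' ?_ ?_)
  · exact le_iSup (fun N => ENNReal.ofReal (centredBound ρ N φ i)) N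
  · exact le_iSup (fun N => ENNReal.ofReal (centredBound ρ N ψ i)) N

theorem exists_tsum_centredMajorant_rpow_le {ρ p : ℝ} (hρ : 2 < ρ) (hp : 1 < p) :
    ∃ C : ℝ, 0 < C ∧ ∀ f : ℤ → ℝ, (Function.support f).Finite →
      (∑' i, centredMajorant ρ f i ^ p) ^ (1 / p)
        ≤ ENNReal.ofReal C * (∑' i, (‖f i‖₊ : ℝ≥0∞) ^ p) ^ (1 / p) := by
  obtain ⟨C, hC, h⟩ := exists_sum_centredBound_rpow_le hρ hp
  have hp0 : 0 < p := by linarith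
  refine ⟨C ^ (1 / p), by positivity, fun f hf => ?_⟩
  rw [← ENNReal.ofReal_rpow_of_nonneg hC.le (by positivity),
    ← ENNReal.mul_rpow_of_nonneg _ _ (by positivity)]
  refine ENNReal.rpow_le_rpow ?_ (by positivity)
  rw [ENNReal.tsum_eq_iSup_sum]
  refine iSup_le fun F => ?_
  have hsup : ∀ i, centredMajorant ρ f i ^ p
      = ⨆ N, ENNReal.ofReal (centredBound ρ N f i ^ p) := fun i => by
    have := (ENNReal.orderIsoRpow p hp0).map_iSup fun N => ENNReal.ofReal (centredBound ρ N f i)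
    simp only [ENNReal.orderIsoRpow_apply,
      ENNReal.ofReal_rpow_of_nonneg (centredBound_nonneg _ _ _ _) hp0.le] at this
    exact this
  simp only [hsup]
  rw [ENNReal.finsetSum_iSup_of_monotone fun i N M hNM => ENNReal.ofReal_le_ofReal
    (Real.rpow_le_rpow (centredBound_nonneg _ _ _ _) (centredBound_mono hρ.le f i hNM) hp0.le)]
  refine iSup_le fun N => ?_
  have hpos : ∀ i, 0 ≤ |f i| ^ p := fun i => by positivity
  rw [← ENNReal.ofReal_sum_of_nonneg fun i _ =>
    Real.rpow_nonneg (centredBound_nonneg _ _ _ _) p]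
  refine (ENNReal.ofReal_le_ofReal (h N F hf.toFinset f fun x hx => ?_)).trans ?_
  · simpa using hx
  · rw [ENNReal.ofReal_mul hC.le, ENNReal.ofReal_sum_of_nonneg fun i _ => hpos i]
    gcongr
    refine le_trans (le_of_eq (Finset.sum_congr rfl fun i _ => ?_))
      (ENNReal.sum_le_tsum hf.toFinset)
    rw [← ENNReal.ofReal_rpow_of_nonneg (abs_nonneg _) hp0.le, ← Real.enorm_eq_ofReal_abs]
    rfl

/-- variational inequality for discrete bilinear averages on `ℤ`. -/
theorem varNorm_Qdisc_lp (ρ : ℝ) (hρ : 2 < ρ) (p p₁ p₂ : ℝ)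
    (hp₁ : 1 < p₁) (hp₂ : 1 < p₂) (hp : 1 / p = 1 / p₁ + 1 / p₂) :
    ∃ C : ℝ, 0 < C ∧ ∀ φ ψ : ℤ → ℝ,
      (Function.support φ).Finite → (Function.support ψ).Finite →
      (∑' i : ℤ, (varNorm ρ (Set.univ : Set ℕ) (fun L => Qdisc φ ψ L i)) ^ p) ^ (1 / p) ≤
        ENNReal.ofReal C * (∑' i : ℤ, (‖φ i‖₊ : ℝ≥0∞) ^ p₁) ^ (1 / p₁) *
          (∑' i : ℤ, (‖ψ i‖₊ : ℝ≥0∞) ^ p₂) ^ (1 / p₂) := by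
  obtain ⟨C₁, hC₁, h₁⟩ := exists_tsum_centredMajorant_rpow_le hρ hp₁
  obtain ⟨C₂, hC₂, h₂⟩ := exists_tsum_centredMajorant_rpow_le hρ hp₂
  have h10 : 0 < 1 / p₁ := by positivity
  have h20 : 0 < 1 / p₂ := by positivity
  have hp0 : 0 < p := one_div_pos.1 (by rw [hp]; positivity)
  have hlt : p < p₁ := (one_div_lt_one_div (by linarith) hp0).1 (by rw [hp]; linarith)
  refine ⟨6 * (C₁ * C₂), by positivity, fun φ ψ hφ hψ => ?_⟩
  have hH := ENNReal.lintegral_Lp_mul_le_Lq_mul_Lr hp0 hlt hp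
    (Measure.count : Measure ℤ) (f := centredMajorant ρ φ) (g := centredMajorant ρ ψ)
    (measurable_of_countable _).aemeasurable (measurable_of_countable _).aemeasurable
  simp only [lintegral_count, Pi.mul_apply] at hH
  calc _ ≤ (∑' i : ℤ, 6 ^ p * (centredMajorant ρ φ i * centredMajorant ρ ψ i) ^ p) ^ (1 / p) := by
        refine ENNReal.rpow_le_rpow (ENNReal.tsum_le_tsum fun i => ?_) (by positivity)
        rw [← ENNReal.mul_rpow_of_nonneg _ _ hp0.le]
        exact ENNReal.rpow_le_rpow (varNorm_Qdisc_le hρ.le φ ψ i) hp0.le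
    _ = 6 * (∑' i : ℤ, (centredMajorant ρ φ i * centredMajorant ρ ψ i) ^ p) ^ (1 / p) := by
        rw [ENNReal.tsum_mul_left, ENNReal.mul_rpow_of_nonneg _ _ (by positivity),
          ← ENNReal.rpow_mul, mul_one_div_cancel hp0.ne', ENNReal.rpow_one]
    _ ≤ 6 * ((∑' i, centredMajorant ρ φ i ^ p₁) ^ (1 / p₁)
          * (∑' i, centredMajorant ρ ψ i ^ p₂) ^ (1 / p₂)) := by gcongr
    _ ≤ 6 * ((ENNReal.ofReal C₁ * (∑' i : ℤ, (‖φ i‖₊ : ℝ≥0∞) ^ p₁) ^ (1 / p₁))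
          * (ENNReal.ofReal C₂ * (∑' i : ℤ, (‖ψ i‖₊ : ℝ≥0∞) ^ p₂) ^ (1 / p₂))) :=
        mul_le_mul' le_rfl (mul_le_mul' (h₁ φ hφ) (h₂ ψ hψ))
    _ = _ := by
        rw [ENNReal.ofReal_mul (by norm_num), ENNReal.ofReal_mul hC₁.le,
          show ENNReal.ofReal 6 = 6 by norm_num]
        ring
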